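/- Let D be a convex drawing of K_n in the plane with star vertex v_⋆, with m ≥ 2 bad edges and a labeling satisfying sidedness and nestedness, bad edges b_i = {v_i, v_i+1} with v_1 < … < v_m, smallest and largest witnesses w_i^L and w_i^R of b_i, and for 1 ≤ i ≤ m−1 let L_i = {x : w_{i+1}^R < x < w_i^L} and R_i = {x : v_i + 1 ≤ x ≤ v_{i+1}}. Then for every i with 1 ≤ i ≤ m−1, no edge {u,v} with u, v ∈ L_i ∪ R_i crosses a star edge {z, v_⋆} with z ∉ L_i ∪ R_i. -/

import Mathlib

open Set

/-- Cyclic successor on `Fin m` (indices modulo `m`). -/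
def finCycSucc {m : ℕ} (i : Fin m) : Fin m := ⟨((i : ℕ) + 1) % m, Nat.mod_lt _ i.pos⟩

/-- `p` is a proper (transversal) crossing point of the arcs `α` and `β` : `p` lies on both arcs
and, locally around `p`, the arc `β` has points in two different sides of `α`
(it passes from one side of `α` to the other). -/
def ProperCrossingAt (α β : Set (ℝ × ℝ)) (p : ℝ × ℝ) : Prop :=
  p ∈ α ∩ β ∧
    ∀ U ∈ nhds p, ∃ V ∈ nhds p, V ⊆ U ∧
      ∃ q₁ ∈ β ∩ V, ∃ q₂ ∈ β ∩ V, q₁ ∉ α ∧ q₂ ∉ α ∧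
        connectedComponentIn (V \ α) q₁ ≠ connectedComponentIn (V \ α) q₂

/-- A simple drawing of the complete graph `K n` in the plane: `n` distinct vertex points,
a simple arc joining each pair of distinct vertices, no edge passing through another vertex,
and any two (distinct) edges meeting in at most one point, which is either a common endpoint
or a proper crossing. -/
structure SimpleDrawing (n : ℕ) where
  vert : Fin n → ℝ × ℝ
  vert_inj : Function.Injective vert
  arc : Fin n → Fin n → Set (ℝ × ℝ)
  arc_symm : ∀ i j, arc i j = arc j i
  arc_simple : ∀ i j, i ≠ j → ∃ f : ℝ → ℝ × ℝ,
    ContinuousOn f (Icc (0:ℝ) 1) ∧ InjOn f (Icc (0:ℝ) 1) ∧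
    f '' Icc (0:ℝ) 1 = arc i j ∧ f 0 = vert i ∧ f 1 = vert j
  no_through_vertex : ∀ i j k, i ≠ j → vert k ∈ arc i j → k = i ∨ k = j
  inter_subsingleton : ∀ i j k l, i ≠ j → k ≠ l → s(i, j) ≠ s(k, l) →
    (arc i j ∩ arc k l).Subsingleton
  inter_proper : ∀ i j k l, i ≠ j → k ≠ l → s(i, j) ≠ s(k, l) →
    ∀ p ∈ arc i j ∩ arc k l,
      (∃ a, (a = i ∨ a = j) ∧ (a = k ∨ a = l) ∧ p = vert a) ∨
      ProperCrossingAt (arc i j) (arc k l) p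

namespace SimpleDrawing

variable {n : ℕ} (D : SimpleDrawing n)

/-- The arc realizing an (unordered) edge. -/
def earc : Sym2 (Fin n) → Set (ℝ × ℝ) := Sym2.lift ⟨D.arc, D.arc_symm⟩

/-- Two (distinct) edges cross: they share a point that is not a common endpoint. -/
def Crosses (e e' : Sym2 (Fin n)) : Prop :=
  e ≠ e' ∧ ∃ p ∈ D.earc e ∩ D.earc e', ¬∃ a, a ∈ e ∧ a ∈ e' ∧ p = D.vert a

/-- A set of edges is plane if no two of its edges cross. -/
def IsPlane (E : Set (Sym2 (Fin n))) : Prop :=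
  ∀ e ∈ E, ∀ e' ∈ E, ¬D.Crosses e e'

/-- A plane subdrawing: a plane set of (genuine, non-loop) edges of the drawing. -/
def IsPlaneSub (E : Set (Sym2 (Fin n))) : Prop :=
  (∀ e ∈ E, ¬e.IsDiag) ∧ D.IsPlane E

/-- A maximal plane subdrawing: no further edge can be added while keeping the set plane. -/
def IsMaximalPlaneSub (E : Set (Sym2 (Fin n))) : Prop :=
  D.IsPlaneSub E ∧ ∀ e, ¬e.IsDiag → e ∉ E → ¬D.IsPlaneSub (insert e E)

/-- The triangle of the drawing spanned by three vertices: the union of the three arcs. -/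
def triangle (a b c : Fin n) : Set (ℝ × ℝ) := D.arc a b ∪ D.arc b c ∪ D.arc a c

/-- `S` is a side of the triangle on `a b c`: the closure of a connected component of the
complement of the triangle. -/
def IsSideOf (S : Set (ℝ × ℝ)) (a b c : Fin n) : Prop :=
  ∃ p, p ∉ D.triangle a b c ∧ S = closure (connectedComponentIn (D.triangle a b c)ᶜ p)

/-- `S` is a convex side of the triangle on `a b c`: every edge of the drawing with both
endpoints in `S` is contained in `S`. -/
def IsConvexSideOf (S : Set (ℝ × ℝ)) (a b c : Fin n) : Prop :=
  D.IsSideOf S a b c ∧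
    ∀ i j : Fin n, i ≠ j → D.vert i ∈ S → D.vert j ∈ S → D.arc i j ⊆ S

/-- A convex drawing: every triangle has a convex side. -/
def Convex : Prop :=
  ∀ a b c : Fin n, a ≠ b → b ≠ c → a ≠ c → ∃ S, D.IsConvexSideOf S a b c

/-- A plane Hamiltonian cycle: a plane set of `n` edges forming a cycle through all vertices. -/
def IsPlaneHamCycle (E : Set (Sym2 (Fin n))) : Prop :=
  D.IsPlane E ∧ ∃ c : ZMod n → Fin n, Function.Bijective c ∧
    E = {e | ∃ k : ZMod n, e = s(c k, c (k + 1))}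

/-- A plane Hamiltonian path from `s` to `t`: a plane set of `n-1` edges forming a path
through all `n` vertices with endpoints `s` and `t`. -/
def IsPlaneHamPath (E : Set (Sym2 (Fin n))) (s t : Fin n) : Prop :=
  D.IsPlane E ∧ ∃ p : Fin n → Fin n, Function.Bijective p ∧
    (∀ i : Fin n, (i : ℕ) = 0 → p i = s) ∧
    (∀ i : Fin n, (i : ℕ) = n - 1 → p i = t) ∧
    E = {e | ∃ i j : Fin n, (j : ℕ) = (i : ℕ) + 1 ∧ e = s(p i, p j)}

/-- The edge from `a` towards `b` emanates (at `a`) into the set `C`. -/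
def EmanatesInto (a b : Fin n) (C : Set (ℝ × ℝ)) : Prop :=
  ∃ U ∈ nhds (D.vert a), (D.arc a b ∩ U) \ {D.vert a} ⊆ C

/-- At the vertex `vs`, the edges towards `b` and towards `d` emanate into different
connected components of the complement of the triangle on `vs`, `a`, `c`;
i.e. the pair `{a, c}` locally separates `b` from `d` in the rotation at `vs`. -/
def SeparatesAt (vs a c b d : Fin n) : Prop :=
  ∃ p q : ℝ × ℝ, p ∉ D.triangle vs a c ∧ q ∉ D.triangle vs a c ∧
    connectedComponentIn (D.triangle vs a c)ᶜ p ≠ connectedComponentIn (D.triangle vs a c)ᶜ q ∧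
    D.EmanatesInto vs b (connectedComponentIn (D.triangle vs a c)ᶜ p) ∧
    D.EmanatesInto vs d (connectedComponentIn (D.triangle vs a c)ᶜ q)

/-- `lab` labels the `n-1` non-star vertices according to the cyclic order (the rotation)
in which the star edges emanate from the star vertex `vs`: it is a bijection onto the
non-star vertices such that, for any indices `i < j < k < l`, the edges towards `lab i` and
`lab k` locally separate the edges towards `lab j` and `lab l` at `vs`. -/
def IsRotationLabeling (vs : Fin n) (lab : Fin (n - 1) → Fin n) : Prop :=
  Function.Injective lab ∧ range lab = {x | x ≠ vs} ∧
    ∀ i j k l : Fin (n - 1), i < j → j < k → k < l →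
      D.SeparatesAt vs (lab i) (lab k) (lab j) (lab l)

/-- The edge `{lab x, lab (x+1)}` (indices mod `n-1`) is a bad edge with witness `w`:
it crosses the star edge `{lab w, vs}`. -/
def BadWitness (vs : Fin n) (lab : Fin (n - 1) → Fin n) (x w : Fin (n - 1)) : Prop :=
  D.Crosses s(lab x, lab (finCycSucc x)) s(lab w, vs)

/-- The non-star edge `{lab x, lab y}` is star-crossing: it crosses some star edge. -/
def StarCrossing (vs : Fin n) (lab : Fin (n - 1) → Fin n) (x y : Fin (n - 1)) : Prop :=
  ∃ w : Fin (n - 1), D.Crosses s(lab x, lab y) s(lab w, vs)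

end SimpleDrawing

/-- Four indices appear in this cyclic order. -/
def CyclicOrdered {m : ℕ} (a b c d : Fin m) : Prop :=
  (a < b ∧ b < c ∧ c < d) ∨ (b < c ∧ c < d ∧ d < a) ∨
  (c < d ∧ d < a ∧ a < b) ∨ (d < a ∧ a < b ∧ b < c)

namespace PlanarArc

open Complex Topology

/-! ### Continuous logarithms -/

/-- `h` has a continuous logarithm on `K`. -/
def HasLog (K : Set ℂ) (h : ℂ → ℂ) : Prop :=
  ∃ g : ℂ → ℂ, ContinuousOn g K ∧ ∀ z ∈ K, exp (g z) = h z

/-- Two continuous logarithms of the same function differ by a constant on a connected set. -/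
theorem exists_const_of_exp_eq {X : Type*} [TopologicalSpace X] {S : Set X} (hS : IsPreconnected S)
    {f g : X → ℂ} (hf : ContinuousOn f S) (hg : ContinuousOn g S)
    (h : ∀ x ∈ S, exp (f x) = exp (g x)) : ∃ c, ∀ x ∈ S, f x = g x + c := by
  have hd : DiscreteTopology (AddSubgroup.zmultiples (2 * Real.pi * I : ℂ)) :=
    NormedSpace.discreteTopology_zmultiples _
  have hd' : IsDiscrete (AddSubgroup.zmultiples (2 * Real.pi * I : ℂ) : Set ℂ) := ⟨hd⟩
  obtain ⟨c, -, hc⟩ := hS.eqOn_const_of_mapsTo hd' (hf.sub hg) (fun x hx => by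
    have : exp (f x - g x) = 1 := by
      rw [exp_sub, h x hx, div_self (exp_ne_zero _)]
    obtain ⟨n, hn⟩ := exp_eq_one_iff.1 this
    exact AddSubgroup.mem_zmultiples_iff.2 ⟨n, by rw [zsmul_eq_mul]; exact hn.symm⟩)
    ⟨0, zero_mem _⟩
  exact ⟨c, fun x hx => by have := hc hx; simp only [Function.const, Pi.sub_apply] at this; rw [← this]; ring⟩

theorem exists_lift_exp {X : Type*} [TopologicalSpace X] [SimplyConnectedSpace X]
    [LocallyPathConnectedSpace X] {h : X → ℂ} (hc : Continuous h) (h0 : ∀ x, h x ≠ 0) :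
    ∃ g : X → ℂ, Continuous g ∧ ∀ x, exp (g x) = h x := by
  obtain ⟨x₀⟩ : Nonempty X := inferInstance
  obtain ⟨F, ⟨-, hF⟩, -⟩ := isCoveringMapOn_exp.existsUnique_continuousMap_lifts ⟨h, hc⟩
    (a₀ := x₀) (e₀ := log (h x₀)) (exp_log (h0 x₀)) (fun a => h0 a)
  exact ⟨F, F.continuous, fun x => congrFun hF x⟩

/-! ### Components of the complement -/

/-- `p` and `q` lie in the same component of the complement of `K`. -/
def Same (K : Set ℂ) (p q : ℂ) : Prop := q ∈ connectedComponentIn Kᶜ p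

theorem Same.left {K : Set ℂ} {p q : ℂ} (h : Same K p q) : p ∉ K := by
  by_contra hp
  have : p ∉ Kᶜ := fun h => h hp
  simp [Same, connectedComponentIn_eq_empty this] at h

theorem Same.right {K : Set ℂ} {p q : ℂ} (h : Same K p q) : q ∉ K :=
  connectedComponentIn_subset _ _ h

theorem Same.refl {K : Set ℂ} {p : ℂ} (h : p ∉ K) : Same K p p := mem_connectedComponentIn h

theorem Same.symm {K : Set ℂ} {p q : ℂ} (h : Same K p q) : Same K q p := by
  unfold Same
  rw [← connectedComponentIn_eq h]
  exact Same.refl h.left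

theorem Same.trans {K : Set ℂ} {p q r : ℂ} (h : Same K p q) (h' : Same K q r) : Same K p r := by
  unfold Same at *
  rwa [connectedComponentIn_eq h]

theorem same_of_isPreconnected {K C : Set ℂ} {p q : ℂ} (hC : IsPreconnected C) (h : Disjoint C K)
    (hp : p ∈ C) (hq : q ∈ C) : Same K p q :=
  hC.subset_connectedComponentIn hp (h.subset_compl_right) hq

theorem isOpen_same {K : Set ℂ} (hK : IsClosed K) (p : ℂ) : IsOpen {q | Same K p q} :=
  IsOpen.connectedComponentIn hK.isOpen_compl

theorem isPreconnected_same {K : Set ℂ} (p : ℂ) : IsPreconnected {q | Same K p q} :=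
  isPreconnected_connectedComponentIn

theorem frontier_same_subset {K : Set ℂ} (hK : IsClosed K) (p : ℂ) :
    frontier {q | Same K p q} ⊆ K := by
  intro x hx
  by_contra hxK
  have h1 := isOpen_same hK x
  have hx' : x ∈ closure {q | Same K p q} := frontier_subset_closure hx
  obtain ⟨y, hy, hy'⟩ := mem_closure_iff.1 hx' _ h1 (Same.refl hxK)
  have : Same K p x := Same.trans hy' (Same.symm hy)
  rw [(isOpen_same hK p).frontier_eq] at hx
  exact hx.2 this

/-! ### Eilenberg's criterion -/

theorem Same.hasLog {K : Set ℂ} (hK : IsClosed K) {p q : ℂ} (h : Same K p q) :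
    HasLog K (fun z => (z - p) / (z - q)) := by
  have key : ∀ x ∉ K, ∀ᶠ y in 𝓝 x, HasLog K (fun z => (z - x) / (z - y)) := by
    intro x hx
    obtain ⟨ε, hε, hb⟩ := Metric.isOpen_iff.1 hK.isOpen_compl x hx
    filter_upwards [Metric.ball_mem_nhds x hε] with y hy
    have hne : ∀ z ∈ K, z - x ≠ 0 := fun z hz h0 => hx (by rwa [sub_eq_zero.1 h0] at hz)
    have hlt : ∀ z ∈ K, ‖-(y - x) / (z - x)‖ < 1 := fun z hz => by
      rw [norm_div, norm_neg, div_lt_one (norm_pos_iff.2 (hne z hz)), ← dist_eq_norm,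
        ← dist_eq_norm]
      refine (Metric.mem_ball.1 hy).trans_le ?_
      by_contra hlt
      exact hb (Metric.mem_ball.2 (not_le.1 hlt)) hz
    refine ⟨fun z => -log (1 + -(y - x) / (z - x)), ?_, fun z hz => ?_⟩
    · refine ContinuousOn.neg (ContinuousOn.clog ?_ fun z hz => mem_slitPlane_of_norm_lt_one (hlt z hz))
      exact continuousOn_const.add (continuousOn_const.div (by fun_prop) hne)
    · have h1 : 1 + -(y - x) / (z - x) ≠ 0 :=
        slitPlane_ne_zero (mem_slitPlane_of_norm_lt_one (hlt z hz))
      have h2 : 1 + -(y - x) / (z - x) = (z - y) / (z - x) := by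
        field_simp [hne z hz]; ring
      rw [exp_neg, exp_log h1, h2, inv_div]
  have hK' : ∀ {x y : ℂ}, x ∉ K → y ∉ K → ∀ z ∈ K, z - x ≠ 0 ∧ z - y ≠ 0 := fun hx hy z hz =>
    ⟨fun h0 => hx (by rwa [sub_eq_zero.1 h0] at hz), fun h0 => hy (by rwa [sub_eq_zero.1 h0] at hz)⟩
  refine (isPreconnected_connectedComponentIn (F := Kᶜ) (x := p)).induction₂
    (fun x y => HasLog K (fun z => (z - x) / (z - y))) ?_ ?_ ?_ (Same.refl h.left) h
  · exact fun x hx => (key x (Same.right hx)).filter_mono nhdsWithin_le_nhds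
  · rintro x y w hx hy hw ⟨g, hg, hg'⟩ ⟨k, hk, hk'⟩
    refine ⟨g + k, hg.add hk, fun z hz => ?_⟩
    have h1 := hK' (Same.right hx) (Same.right hy) z hz
    rw [Pi.add_apply, exp_add, hg' z hz, hk' z hz, div_mul_div_cancel₀ h1.2]
  · rintro x y hx hy ⟨g, hg, hg'⟩
    exact ⟨-g, hg.neg, fun z hz => by rw [Pi.neg_apply, exp_neg, hg' z hz, inv_div]⟩

theorem isPreconnected_norm_gt (R : ℝ) (hR : 0 ≤ R) : IsPreconnected {z : ℂ | R < ‖z‖} := by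
  have : {z : ℂ | R < ‖z‖} =
      (fun x : ℝ × ℝ => (x.1 : ℂ) * exp (x.2 * I)) '' (Ioi R ×ˢ univ) := by
    ext z
    simp only [mem_ofPred_eq, mem_image, mem_prod, mem_Ioi, mem_univ, and_true, Prod.exists]
    constructor
    · exact fun h => ⟨‖z‖, arg z, h, norm_mul_exp_arg_mul_I z⟩
    · rintro ⟨r, θ, hr, rfl⟩
      simpa [norm_exp_ofReal_mul_I, abs_of_pos (hR.trans_lt hr)] using hr
  rw [this]
  exact (isPreconnected_Ioi.prod isPreconnected_univ).image _ (by fun_prop)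

theorem no_log_of_eq_sub {M : ℂ → ℂ} (hM : Continuous M) {p : ℂ} {R : ℝ} (hp : ‖p‖ < R)
    (h : ∀ z, ‖z‖ = R → exp (M z) = z - p) : False := by
  have hR : 0 < R := (norm_nonneg p).trans_lt hp
  set c : ℝ → ℂ := fun θ => R * exp (θ * I) with hc
  have hcn : ∀ θ, ‖c θ‖ = R := fun θ => by
    simp [hc, norm_exp_ofReal_mul_I, abs_of_pos hR]
  have hc0 : ∀ θ, c θ ≠ 0 := fun θ => norm_pos_iff.1 (by rw [hcn]; exact hR)
  have hlt : ∀ θ, ‖-p / c θ‖ < 1 := fun θ => by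
    rw [norm_div, norm_neg, hcn, div_lt_one hR]; exact hp
  have hcc : Continuous c := by fun_prop
  obtain ⟨k, hk⟩ := exists_const_of_exp_eq (S := (univ : Set ℝ)) isPreconnected_univ
    (f := fun θ => M (c θ) - log (1 + -p / c θ)) (g := fun θ => θ * I + Real.log R)
    (by
      refine ContinuousOn.sub (by fun_prop) (ContinuousOn.clog ?_ fun z _ =>
        mem_slitPlane_of_norm_lt_one (hlt z))
      exact (continuous_const.add (continuous_const.div hcc hc0)).continuousOn)
    (by fun_prop) (fun θ _ => by
      have h1 : 1 + -p / c θ ≠ 0 := slitPlane_ne_zero (mem_slitPlane_of_norm_lt_one (hlt θ))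
      have h2 : 1 + -p / c θ = (c θ - p) / c θ := by field_simp [hc0 θ]; ring
      have h3 : c θ - p ≠ 0 := fun h0 => h1 (by rw [h2, h0, zero_div])
      rw [exp_sub, exp_log h1, h _ (hcn θ), h2, exp_add, ← ofReal_exp, Real.exp_log hR]
      field_simp
      simp [hc, mul_comm])
  have h0 := hk 0 trivial
  have h1 := hk (2 * Real.pi) trivial
  have h2 : c 0 = c (2 * Real.pi) := by simp [hc, exp_two_pi_mul_I]
  rw [← h2] at h1
  have h3 := h0.symm.trans h1
  have : (2 * Real.pi * I : ℂ) = 0 := by push_cast at h3; linear_combination -h3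
  exact two_pi_I_ne_zero this

theorem same_of_hasLog {K : Set ℂ} (hK : IsCompact K) {p q : ℂ} (hp : p ∉ K) (hq : q ∉ K)
    (h : HasLog K (fun z => (z - p) / (z - q))) : Same K p q := by
  have hne : ∀ {x y : ℂ}, x ∉ K → y ∉ K → ∀ z ∈ K, z - x ≠ 0 ∧ z - y ≠ 0 := fun hx hy z hz =>
    ⟨fun h0 => hx (by rwa [sub_eq_zero.1 h0] at hz), fun h0 => hy (by rwa [sub_eq_zero.1 h0] at hz)⟩
  -- the case of a bounded component
  have main : ∀ p q : ℂ, p ∉ K → q ∉ K → HasLog K (fun z => (z - p) / (z - q)) →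
      Bornology.IsBounded {x | Same K p x} → Same K p q := by
    rintro p q hp hq ⟨g, hg, hg'⟩ hb
    by_contra hn
    obtain ⟨G, hG⟩ := ContinuousMap.exists_restrict_eq hK.isClosed
      ⟨K.domRestrict g, continuousOn_iff_continuous_domRestrict.1 hg⟩
    have hG' : ∀ z ∈ K, G z = g z := fun z hz => congrArg (fun F : C(K, ℂ) => F ⟨z, hz⟩) hG
    classical
    set U := {x | Same K p x} with hU
    have hHc : Continuous (U.piecewise (fun z => exp (G z) * (z - q)) (fun z => z - p)) := by
      refine Continuous.piecewise (fun a ha => ?_) (by fun_prop) (by fun_prop)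
      have haK := frontier_same_subset hK.isClosed p ha
      rw [hG' a haK, hg' a haK, div_mul_cancel₀ _ (hne hp hq a haK).2]
    obtain ⟨M, hMc, hM⟩ := exists_lift_exp hHc (fun z => by
      by_cases hz : z ∈ U
      · rw [piecewise_eq_of_mem _ _ _ hz]
        refine mul_ne_zero (exp_ne_zero _) fun h0 => hn ?_
        rwa [sub_eq_zero.1 h0] at hz
      · rw [piecewise_eq_of_notMem _ _ _ hz]
        exact fun h0 => hz (by rw [sub_eq_zero.1 h0]; exact Same.refl hp))
    obtain ⟨R, hR⟩ := hb.subset_ball 0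
    refine no_log_of_eq_sub hMc (p := p) (R := R) ?_ fun z hz => ?_
    · simpa using hR (show p ∈ U from Same.refl hp)
    · rw [hM, piecewise_eq_of_notMem]
      exact fun hzU => by simpa [hz] using hR hzU
  by_cases hbp : Bornology.IsBounded {x | Same K p x}
  · exact main p q hp hq h hbp
  by_cases hbq : Bornology.IsBounded {x | Same K q x}
  · refine (main q p hq hp ?_ hbq).symm
    obtain ⟨g, hg, hg'⟩ := h
    exact ⟨-g, hg.neg, fun z hz => by rw [Pi.neg_apply, exp_neg, hg' z hz, inv_div]⟩
  obtain ⟨R, hR⟩ := hK.isBounded.subset_closedBall 0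
  have hR' : K ⊆ Metric.closedBall 0 (max R 0) :=
    hR.trans (Metric.closedBall_subset_closedBall (le_max_left _ _))
  have far : ∀ p, ¬ Bornology.IsBounded {x | Same K p x} → ∃ x, Same K p x ∧ max R 0 < ‖x‖ := by
    intro p hp
    by_contra! hcon
    exact hp ((Metric.isBounded_closedBall (x := (0 : ℂ)) (r := max R 0)).subset
      fun x hx => by rw [mem_closedBall_zero_iff]; exact hcon x hx)
  obtain ⟨x, hx, hx'⟩ := far p hbp
  obtain ⟨y, hy, hy'⟩ := far q hbq
  refine hx.trans ((same_of_isPreconnected (isPreconnected_norm_gt _ (le_max_right R 0)) ?_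
    hx' hy').trans hy.symm)
  refine disjoint_left.2 fun z hz hzK => ?_
  have := hR' hzK
  rw [mem_closedBall_zero_iff] at this
  exact absurd hz (not_lt.2 this)

/-! ### Arcs -/

/-- `A` is a simple arc from `a` to `b`. -/
def IsArc (A : Set ℂ) (a b : ℂ) : Prop :=
  ∃ f : ℝ → ℂ, ContinuousOn f (Icc (0:ℝ) 1) ∧ InjOn f (Icc (0:ℝ) 1) ∧
    f '' Icc (0:ℝ) 1 = A ∧ f 0 = a ∧ f 1 = b

theorem isArc_image_Icc {f : ℝ → ℂ} {s t : ℝ} (hst : s < t) (hf : ContinuousOn f (Icc s t))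
    (hi : InjOn f (Icc s t)) : IsArc (f '' Icc s t) (f s) (f t) := by
  have him : (fun x => (t - s) * x + s) '' Icc (0:ℝ) 1 = Icc s t := by
    rw [image_affine_Icc' (sub_pos.2 hst)]; simp
  have hm : MapsTo (fun x => (t - s) * x + s) (Icc (0:ℝ) 1) (Icc s t) :=
    mapsTo_iff_image_subset.2 him.subset
  refine ⟨f ∘ fun x => (t - s) * x + s, hf.comp (by fun_prop) hm, hi.comp ?_ hm, ?_, by simp,
    by simp⟩
  · intro x _ y _ h
    have h' : (t - s) * x = (t - s) * y := by simpa using h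
    exact mul_left_cancel₀ (sub_pos.2 hst).ne' h'
  · rw [image_comp, him]

theorem isArc_image_Icc' {f : ℝ → ℂ} {s t : ℝ} (hst : s < t) (hf : ContinuousOn f (Icc s t))
    (hi : InjOn f (Icc s t)) : IsArc (f '' Icc s t) (f t) (f s) := by
  have him : (fun x => -x) '' Icc (-t) (-s) = Icc s t := by simp
  have hm : MapsTo (fun x : ℝ => -x) (Icc (-t) (-s)) (Icc s t) :=
    mapsTo_iff_image_subset.2 him.subset
  have := isArc_image_Icc (f := f ∘ fun x => -x) (neg_lt_neg hst)
    (hf.comp (by fun_prop) hm) (hi.comp (neg_injective.injOn) hm)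
  rw [image_comp, him] at this
  simpa using this

namespace IsArc

variable {A B : Set ℂ} {a b c : ℂ}

theorem symm (h : IsArc A a b) : IsArc A b a := by
  obtain ⟨f, hf, hi, rfl, rfl, rfl⟩ := h
  exact isArc_image_Icc' zero_lt_one hf hi

theorem isCompact (h : IsArc A a b) : IsCompact A := by
  obtain ⟨f, hf, hi, rfl, rfl, rfl⟩ := h
  exact isCompact_Icc.image_of_continuousOn hf

theorem isClosed (h : IsArc A a b) : IsClosed A := h.isCompact.isClosed

theorem left_mem (h : IsArc A a b) : a ∈ A := by
  obtain ⟨f, hf, hi, rfl, rfl, rfl⟩ := h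
  exact mem_image_of_mem f (by simp)

theorem right_mem (h : IsArc A a b) : b ∈ A := h.symm.left_mem

theorem isPreconnected (h : IsArc A a b) : IsPreconnected A := by
  obtain ⟨f, hf, hi, rfl, rfl, rfl⟩ := h
  exact isPreconnected_Icc.image _ hf

theorem ne (h : IsArc A a b) : a ≠ b := by
  obtain ⟨f, hf, hi, rfl, rfl, rfl⟩ := h
  exact fun h => zero_ne_one (hi (by simp) (by simp) h)

theorem isPreconnected_diff_left (h : IsArc A a b) : IsPreconnected (A \ {a}) := by
  obtain ⟨f, hf, hi, rfl, rfl, rfl⟩ := h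
  have : f '' Icc 0 1 \ {f 0} = f '' Ioc 0 1 := by
    rw [← Icc_sdiff_left, hi.image_sdiff_subset (by simp), image_singleton]
  rw [this]
  exact isPreconnected_Ioc.image _ (hf.mono Ioc_subset_Icc_self)

theorem isPreconnected_diff_right (h : IsArc A a b) : IsPreconnected (A \ {b}) :=
  h.symm.isPreconnected_diff_left

theorem isPreconnected_diff_pair (h : IsArc A a b) : IsPreconnected (A \ {a, b}) := by
  obtain ⟨f, hf, hi, rfl, rfl, rfl⟩ := h
  have : f '' Icc 0 1 \ {f 0, f 1} = f '' Ioo 0 1 := by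
    rw [← Icc_sdiff_both, hi.image_sdiff_subset (by simp [insert_subset_iff]), image_pair]
  rw [this]
  exact isPreconnected_Ioo.image _ (hf.mono Ioo_subset_Icc_self)

theorem subset_closure_diff_pair (h : IsArc A a b) : A ⊆ closure (A \ {a, b}) := by
  obtain ⟨f, hf, hi, rfl, rfl, rfl⟩ := h
  have : f '' Icc 0 1 \ {f 0, f 1} = f '' Ioo 0 1 := by
    rw [← Icc_sdiff_both, hi.image_sdiff_subset (by simp [insert_subset_iff]), image_pair]
  rw [this, ← closure_Ioo zero_ne_one]
  rw [← closure_Ioo zero_ne_one] at hf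
  exact hf.image_closure

theorem exists_mem_diff_pair (h : IsArc A a b) : ∃ x, x ∈ A \ {a, b} := by
  have := closure_nonempty_iff.1 ⟨a, h.subset_closure_diff_pair h.left_mem⟩
  exact this

theorem exists_split (h : IsArc A a b) (hc : c ∈ A) (hca : c ≠ a) (hcb : c ≠ b) :
    ∃ A₁ A₂, IsArc A₁ a c ∧ IsArc A₂ c b ∧ A₁ ∪ A₂ = A ∧ A₁ ∩ A₂ = {c} := by
  obtain ⟨f, hf, hi, rfl, rfl, rfl⟩ := h
  obtain ⟨t, ht, rfl⟩ := hc
  have h0 : 0 < t := lt_of_le_of_ne ht.1 (by rintro rfl; exact hca rfl)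
  have h1 : t < 1 := lt_of_le_of_ne ht.2 (by rintro rfl; exact hcb rfl)
  have s1 : Icc 0 t ⊆ Icc (0:ℝ) 1 := Icc_subset_Icc le_rfl h1.le
  have s2 : Icc t 1 ⊆ Icc (0:ℝ) 1 := Icc_subset_Icc h0.le le_rfl
  refine ⟨f '' Icc 0 t, f '' Icc t 1, isArc_image_Icc h0 (hf.mono s1) (hi.mono s1),
    isArc_image_Icc h1 (hf.mono s2) (hi.mono s2), ?_, ?_⟩
  · rw [← image_union, Icc_union_Icc_eq_Icc h0.le h1.le]
  · rw [← hi.image_inter s1 s2, Icc_inter_Icc_eq_singleton h0.le h1.le, image_singleton]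

/-- A small neighbourhood window around an interior point of an arc. -/
theorem exists_window (h : IsArc A a b) {x : ℂ} (hx : x ∈ A) (hxa : x ≠ a) (hxb : x ≠ b)
    {U : Set ℂ} (hU : U ∈ 𝓝 x) :
    ∃ A₁ A₂ c d, IsArc A₁ a c ∧ IsArc A₂ d b ∧ A₁ ⊆ A ∧ A₂ ⊆ A ∧ Disjoint A₁ A₂ ∧
      A \ (A₁ ∪ A₂) ⊆ U ∧ x ∉ A₁ ∪ A₂ := by
  obtain ⟨f, hf, hi, rfl, rfl, rfl⟩ := h
  obtain ⟨t, ht, rfl⟩ := hx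
  have h0 : 0 < t := lt_of_le_of_ne ht.1 (by rintro rfl; exact hxa rfl)
  have h1 : t < 1 := lt_of_le_of_ne ht.2 (by rintro rfl; exact hxb rfl)
  have hct : ContinuousAt f t := (hf t ht).continuousAt (Icc_mem_nhds h0 h1)
  obtain ⟨ε, hε, hb⟩ := Metric.mem_nhds_iff.1 (hct hU)
  obtain ⟨δ, hδ, hδ'⟩ := exists_between (lt_min hε (lt_min h0 (sub_pos.2 h1)))
  obtain ⟨d1, d2, d3⟩ : δ < ε ∧ δ < t ∧ δ < 1 - t := by simpa using hδ'
  have s1 : Icc 0 (t - δ) ⊆ Icc (0:ℝ) 1 := Icc_subset_Icc le_rfl (by linarith)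
  have s2 : Icc (t + δ) 1 ⊆ Icc (0:ℝ) 1 := Icc_subset_Icc (by linarith) le_rfl
  have hI : ∀ {x}, x ∈ Icc (0:ℝ) 1 → (f x ∈ f '' Icc 0 (t - δ) ∪ f '' Icc (t + δ) 1 ↔
      x ∈ Icc 0 (t - δ) ∪ Icc (t + δ) 1) := fun {x} hx => by
    rw [← image_union, hi.mem_image_iff (union_subset s1 s2) hx]
  refine ⟨f '' Icc 0 (t - δ), f '' Icc (t + δ) 1, f (t - δ), f (t + δ),
    isArc_image_Icc (by linarith) (hf.mono s1) (hi.mono s1),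
    isArc_image_Icc (by linarith) (hf.mono s2) (hi.mono s2), image_mono s1, image_mono s2,
    ?_, ?_, ?_⟩
  · rw [disjoint_iff_inter_eq_empty, ← hi.image_inter s1 s2, image_eq_empty]
    ext y
    simp only [mem_inter_iff, mem_Icc, mem_empty_iff_false, iff_false]
    rintro ⟨⟨-, h2⟩, h3, -⟩
    linarith
  · rintro _ ⟨⟨y, hy, rfl⟩, hy'⟩
    rw [hI hy] at hy'
    refine hb ?_
    rw [Metric.mem_ball, Real.dist_eq, abs_lt]
    simp only [mem_union, mem_Icc, not_or, not_and, not_le] at hy'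
    constructor
    · linarith [hy'.1 hy.1]
    · by_contra hcon
      linarith [hy'.2 (by linarith), hy.2]
  · rw [hI ht]
    simp only [mem_union, mem_Icc, not_or, not_and, not_le]
    exact ⟨fun _ => by linarith, fun h => by linarith⟩

/-- A small initial piece of an arc. -/
theorem exists_initial (h : IsArc A a b) {U : Set ℂ} (hU : U ∈ 𝓝 a) :
    ∃ A₁ A₂ c, IsArc A₁ a c ∧ IsArc A₂ c b ∧ A₁ ∪ A₂ = A ∧ A₁ ∩ A₂ = {c} ∧ A₁ ⊆ U ∧
      c ∈ A \ {a, b} := by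
  obtain ⟨f, hf, hi, rfl, rfl, rfl⟩ := h
  have h0 : (0:ℝ) ∈ Icc (0:ℝ) 1 := by simp
  have hct := hf 0 h0 hU
  obtain ⟨ε, hε, hb⟩ := Metric.mem_nhdsWithin_iff.1 hct
  obtain ⟨δ, hδ, hδ'⟩ := exists_between (lt_min hε (zero_lt_one' ℝ))
  obtain ⟨d1, d2⟩ : δ < ε ∧ δ < 1 := by simpa using hδ'
  have hδm : δ ∈ Icc (0:ℝ) 1 := ⟨hδ.le, d2.le⟩
  have s1 : Icc 0 δ ⊆ Icc (0:ℝ) 1 := Icc_subset_Icc le_rfl d2.le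
  have s2 : Icc δ 1 ⊆ Icc (0:ℝ) 1 := Icc_subset_Icc hδ.le le_rfl
  refine ⟨f '' Icc 0 δ, f '' Icc δ 1, f δ, isArc_image_Icc hδ (hf.mono s1) (hi.mono s1),
    isArc_image_Icc d2 (hf.mono s2) (hi.mono s2), ?_, ?_, ?_, mem_image_of_mem _ hδm, ?_⟩
  · rw [← image_union, Icc_union_Icc_eq_Icc hδ.le d2.le]
  · rw [← hi.image_inter s1 s2, Icc_inter_Icc_eq_singleton hδ.le d2.le, image_singleton]
  · rintro _ ⟨y, hy, rfl⟩
    refine hb ⟨?_, s1 hy⟩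
    rw [Metric.mem_ball, Real.dist_eq, sub_zero, abs_lt]
    exact ⟨by linarith [hy.1], by linarith [hy.2]⟩
  · simp only [mem_insert_iff, mem_singleton_iff, not_or]
    exact ⟨fun h => hδ.ne' (hi hδm h0 h), fun h => d2.ne (hi hδm (by simp) h)⟩

theorem trans (hA : IsArc A a b) (hB : IsArc B b c) (h : A ∩ B = {b}) : IsArc (A ∪ B) a c := by
  obtain ⟨f, hf, hfi, rfl, rfl, rfl⟩ := hA
  obtain ⟨g, hg, hgi, rfl, hg0, rfl⟩ := hB
  set k : ℝ → ℂ := (Iic (1:ℝ)).piecewise f (fun t => g (t - 1)) with hk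
  have k1 : EqOn k f (Icc 0 1) := fun t ht => piecewise_eq_of_mem _ _ _ ht.2
  have k2 : EqOn k (fun t => g (t - 1)) (Icc 1 2) := fun t ht => by
    rcases ht.1.eq_or_lt with rfl | h1
    · rw [hk, piecewise_eq_of_mem _ _ _ (by simp)]; simp [hg0]
    · exact piecewise_eq_of_notMem _ _ _ (by simpa using h1)
  have hm : MapsTo (fun t : ℝ => t - 1) (Icc 1 2) (Icc 0 1) := fun t ht =>
    ⟨by linarith [ht.1], by linarith [ht.2]⟩
  have him : (fun t : ℝ => t - 1) '' Icc 1 2 = Icc 0 1 := by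
    rw [image_sub_const_Icc]; norm_num
  have e1 : k '' Icc 0 1 = f '' Icc 0 1 := k1.image_eq
  have e2 : k '' Icc 1 2 = g '' Icc 0 1 := by
    rw [k2.image_eq, ← him, image_image]
  have hu : Icc (0:ℝ) 1 ∪ Icc 1 2 = Icc 0 2 := Icc_union_Icc_eq_Icc (by norm_num) (by norm_num)
  have kc : ContinuousOn k (Icc 0 2) := by
    rw [← hu]
    exact (hf.congr k1).union_of_isClosed ((hg.comp (by fun_prop) hm).congr k2) isClosed_Icc
      isClosed_Icc
  have i1 : InjOn k (Icc 0 1) := hfi.congr k1.symm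
  have i2 : InjOn k (Icc 1 2) := (hgi.comp (fun x _ y _ h => by simpa using h) hm).congr k2.symm
  have k11 : k 1 = f 1 := k1 (by simp)
  have cross : ∀ x ∈ Icc (0:ℝ) 1, ∀ y ∈ Icc (1:ℝ) 2, k x = k y → x = y := by
    intro x hx y hy hxy
    have hmem : k x ∈ f '' Icc 0 1 ∩ g '' Icc 0 1 :=
      ⟨e1 ▸ mem_image_of_mem k hx, e2 ▸ hxy ▸ mem_image_of_mem k hy⟩
    rw [h, mem_singleton_iff, ← k11] at hmem
    have := i1 hx (by simp) hmem
    have := i2 hy (by simp) (hxy ▸ hmem)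
    simp_all
  have ki : InjOn k (Icc 0 2) := by
    rw [← hu]
    rintro x (hx | hx) y (hy | hy) hxy
    · exact i1 hx hy hxy
    · exact cross x hx y hy hxy
    · exact (cross y hy x hx hxy.symm).symm
    · exact i2 hx hy hxy
  have := isArc_image_Icc (by norm_num : (0:ℝ) < 2) kc ki
  rw [← hu, image_union, e1, e2, k1 (by simp), k2 (by norm_num)] at this
  norm_num at this
  exact this

theorem hasLog (h : IsArc A a b) {k : ℂ → ℂ} (hk : ContinuousOn k A) (h0 : ∀ z ∈ A, k z ≠ 0) :
    HasLog A k := by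
  obtain ⟨f, hf, hi, rfl, rfl, rfl⟩ := h
  have hc : Continuous fun t : ℝ => k (f (projIcc (0:ℝ) 1 zero_le_one t)) := by
    refine (hk.comp hf (mapsTo_image _ _)).comp_continuous (by fun_prop) fun t => Subtype.coe_prop _
  obtain ⟨G, hG, hG'⟩ := exists_lift_exp hc fun t => h0 _ (mem_image_of_mem _ (Subtype.coe_prop _))
  have he : IsClosedEmbedding ((Icc (0:ℝ) 1).domRestrict f) :=
    (continuousOn_iff_continuous_domRestrict.1 hf).isClosedEmbedding (injOn_iff_injective.1 hi)
  obtain ⟨φ, hφ⟩ := ContinuousMap.exists_extension he (Y := ℝ) ⟨Subtype.val, continuous_subtype_val⟩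
  refine ⟨G ∘ φ, (hG.comp φ.continuous).continuousOn, ?_⟩
  rintro _ ⟨t, ht, rfl⟩
  have : φ (f t) = t := congrArg (fun F : C(Icc (0:ℝ) 1, ℝ) => F ⟨t, ht⟩) hφ
  rw [Function.comp_apply, this, hG', projIcc_of_mem _ ht]

theorem hasLog_div (h : IsArc A a b) {p q : ℂ} (hp : p ∉ A) (hq : q ∉ A) :
    HasLog A (fun z => (z - p) / (z - q)) := by
  have hne : ∀ {x}, x ∉ A → ∀ z ∈ A, z - x ≠ 0 := fun hx z hz h0 =>
    hx (by rwa [sub_eq_zero.1 h0] at hz)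
  exact h.hasLog (ContinuousOn.div (by fun_prop) (by fun_prop) (hne hq)) fun z hz =>
    div_ne_zero (hne hp z hz) (hne hq z hz)

/-- Arcs do not separate the plane. -/
theorem same (h : IsArc A a b) {p q : ℂ} (hp : p ∉ A) (hq : q ∉ A) : Same A p q :=
  same_of_hasLog h.isCompact hp hq (h.hasLog_div hp hq)

end IsArc

theorem isArc_segment {s t : ℂ} (h : s ≠ t) : IsArc (segment ℝ s t) s t := by
  rw [segment_eq_image_lineMap]
  have := isArc_image_Icc (f := AffineMap.lineMap s t) (zero_lt_one' ℝ)
    (AffineMap.lineMap_continuous).continuousOn (AffineMap.lineMap_injective ℝ h).injOn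
  simpa using this

/-! ### Variation of the logarithm along an arc -/

open Classical in
/-- The variation from `a` to `b` of a continuous logarithm of `(z - p) / (z - q)` along `A`. -/
noncomputable def dlog (A : Set ℂ) (a b p q : ℂ) : ℂ :=
  if h : HasLog A (fun z => (z - p) / (z - q)) then h.choose b - h.choose a else 0

theorem dlog_eq {A : Set ℂ} {a b p q : ℂ} (hA : IsPreconnected A) (ha : a ∈ A) (hb : b ∈ A)
    {g : ℂ → ℂ} (hg : ContinuousOn g A) (h : ∀ z ∈ A, exp (g z) = (z - p) / (z - q)) :
    dlog A a b p q = g b - g a := by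
  have H : HasLog A (fun z => (z - p) / (z - q)) := ⟨g, hg, h⟩
  rw [dlog, dif_pos H]
  obtain ⟨c, hc⟩ := exists_const_of_exp_eq hA H.choose_spec.1 hg
    fun x hx => by rw [H.choose_spec.2 x hx, h x hx]
  rw [hc a ha, hc b hb]; ring

theorem dlog_swap (A : Set ℂ) (a b p q : ℂ) : dlog A b a p q = -dlog A a b p q := by
  unfold dlog; split_ifs <;> ring

section dlog

variable {A B K : Set ℂ} {a b c p q r : ℂ}

theorem sub_ne_zero_of_notMem (hp : p ∉ A) : ∀ z ∈ A, z - p ≠ 0 := fun z hz h0 =>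
  hp (by rwa [sub_eq_zero.1 h0] at hz)

theorem IsArc.dlog_add (h : IsArc A a b) (hp : p ∉ A) (hq : q ∉ A) (hr : r ∉ A) :
    dlog A a b p q + dlog A a b q r = dlog A a b p r := by
  obtain ⟨g, hg, hg'⟩ := h.hasLog_div hp hq
  obtain ⟨k, hk, hk'⟩ := h.hasLog_div hq hr
  rw [dlog_eq h.isPreconnected h.left_mem h.right_mem hg hg',
    dlog_eq h.isPreconnected h.left_mem h.right_mem hk hk',
    dlog_eq h.isPreconnected h.left_mem h.right_mem (hg.add hk) fun z hz => by
      rw [Pi.add_apply, exp_add, hg' z hz, hk' z hz,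
        div_mul_div_cancel₀ (sub_ne_zero_of_notMem hq z hz)]]
  simp only [Pi.add_apply]; ring

theorem dlog_union (hA : IsArc A a b) (hB : IsArc B b c) (h : IsArc (A ∪ B) a c)
    (hp : p ∉ A ∪ B) (hq : q ∉ A ∪ B) :
    dlog (A ∪ B) a c p q = dlog A a b p q + dlog B b c p q := by
  obtain ⟨g, hg, hg'⟩ := h.hasLog_div hp hq
  rw [dlog_eq h.isPreconnected h.left_mem h.right_mem hg hg',
    dlog_eq hA.isPreconnected hA.left_mem hA.right_mem (hg.mono subset_union_left)
      fun z hz => hg' z (.inl hz),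
    dlog_eq hB.isPreconnected hB.left_mem hB.right_mem (hg.mono subset_union_right)
      fun z hz => hg' z (.inr hz)]
  ring

/-- Points in the same component of the complement of `K` have a common potential on `K`. -/
theorem Same.exists_potential (hK : IsClosed K) (h : Same K p q) :
    ∃ g : ℂ → ℂ, ∀ A a b, IsArc A a b → A ⊆ K → dlog A a b p q = g b - g a := by
  obtain ⟨g, hg, hg'⟩ := h.hasLog hK
  exact ⟨g, fun A a b hA hAK => dlog_eq hA.isPreconnected hA.left_mem hA.right_mem (hg.mono hAK)
    fun z hz => hg' z (hAK hz)⟩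

end dlog

/-! ### Closed curves -/

/-- `A` and `B` are two arcs from `a` to `b` forming a simple closed curve. -/
structure Loop (A B : Set ℂ) (a b : ℂ) : Prop where
  fst : IsArc A a b
  snd : IsArc B a b
  inter : A ∩ B = {a, b}

/-- The variation of the logarithm of `(z - p) / (z - q)` along a closed curve. -/
noncomputable def wind (A B : Set ℂ) (a b p q : ℂ) : ℂ := dlog A a b p q - dlog B a b p q

namespace Loop

variable {A B : Set ℂ} {a b c p q r x y z : ℂ}

theorem swap (h : Loop A B a b) : Loop B A a b := ⟨h.snd, h.fst, by rw [inter_comm, h.inter]⟩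

theorem reverse (h : Loop A B a b) : Loop A B b a :=
  ⟨h.fst.symm, h.snd.symm, by rw [h.inter, pair_comm]⟩

theorem isClosed (h : Loop A B a b) : IsClosed (A ∪ B) := h.fst.isClosed.union h.snd.isClosed

theorem isCompact (h : Loop A B a b) : IsCompact (A ∪ B) := h.fst.isCompact.union h.snd.isCompact

theorem wind_add (h : Loop A B a b) (hp : p ∉ A ∪ B) (hq : q ∉ A ∪ B) (hr : r ∉ A ∪ B) :
    wind A B a b p q + wind A B a b q r = wind A B a b p r := by
  simp only [mem_union, not_or] at hp hq hr
  rw [wind, wind, wind, ← h.fst.dlog_add hp.1 hq.1 hr.1, ← h.snd.dlog_add hp.2 hq.2 hr.2]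
  ring

theorem wind_eq_zero (h : Loop A B a b) (hs : Same (A ∪ B) p q) : wind A B a b p q = 0 := by
  obtain ⟨g, hg⟩ := hs.exists_potential h.isClosed
  rw [wind, hg _ _ _ h.fst subset_union_left, hg _ _ _ h.snd subset_union_right, sub_self]

theorem same_of_wind_eq_zero (h : Loop A B a b) (hp : p ∉ A ∪ B) (hq : q ∉ A ∪ B)
    (hw : wind A B a b p q = 0) : Same (A ∪ B) p q := by
  have hp' := hp
  have hq' := hq
  simp only [mem_union, not_or] at hp' hq'
  obtain ⟨g, hg, hg'⟩ := h.fst.hasLog_div hp'.1 hq'.1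
  obtain ⟨k, hk, hk'⟩ := h.snd.hasLog_div hp'.2 hq'.2
  rw [wind, dlog_eq h.fst.isPreconnected h.fst.left_mem h.fst.right_mem hg hg',
    dlog_eq h.snd.isPreconnected h.snd.left_mem h.snd.right_mem hk hk'] at hw
  classical
  set G : ℂ → ℂ := A.piecewise g (fun z => k z + (g a - k a)) with hG
  have h1 : EqOn G g A := fun z hz => piecewise_eq_of_mem _ _ _ hz
  have h2 : EqOn G (fun z => k z + (g a - k a)) B := fun z hz => by
    by_cases hzA : z ∈ A
    · rw [h1 hzA]
      have : z ∈ ({a, b} : Set ℂ) := h.inter ▸ ⟨hzA, hz⟩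
      rcases this with rfl | rfl
      · ring
      · linear_combination hw
    · exact piecewise_eq_of_notMem _ _ _ hzA
  have hga : exp (g a - k a) = 1 := by
    rw [exp_sub, hg' a h.fst.left_mem, hk' a h.snd.left_mem, div_self]
    exact div_ne_zero (sub_ne_zero_of_notMem hp'.1 _ h.fst.left_mem)
      (sub_ne_zero_of_notMem hq'.1 _ h.fst.left_mem)
  refine same_of_hasLog h.isCompact hp hq ⟨G, ?_, ?_⟩
  · exact (hg.congr h1).union_of_isClosed ((hk.add continuousOn_const).congr h2) h.fst.isClosed
      h.snd.isClosed
  · rintro z (hz | hz)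
    · rw [h1 hz, hg' z hz]
    · rw [h2 hz, exp_add, hga, mul_one, hk' z hz]

theorem wind_eq_zero_iff (h : Loop A B a b) (hp : p ∉ A ∪ B) (hq : q ∉ A ∪ B) :
    wind A B a b p q = 0 ↔ Same (A ∪ B) p q :=
  ⟨h.same_of_wind_eq_zero hp hq, h.wind_eq_zero⟩

theorem rotate (h : Loop A B a b) (hc : c ∈ A) (hca : c ≠ a) (hcb : c ≠ b) :
    ∃ P Q, Loop P Q a c ∧ P ∪ Q = A ∪ B := by
  obtain ⟨P, Q, hP, hQ, rfl, hPQ⟩ := h.fst.exists_split hc hca hcb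
  have hbP : b ∉ P := fun hb => hcb (by
    have : b ∈ P ∩ Q := ⟨hb, hQ.right_mem⟩
    rw [hPQ] at this; exact this.symm)
  have haQ : a ∉ Q := fun ha => hca (by
    have : a ∈ P ∩ Q := ⟨hP.left_mem, ha⟩
    rw [hPQ] at this; exact this.symm)
  have hi : ∀ z, (z ∈ P ∨ z ∈ Q) ∧ z ∈ B ↔ z = a ∨ z = b := fun z => by
    have := Set.ext_iff.1 h.inter z
    simpa using this
  have hj : ∀ z, z ∈ P ∧ z ∈ Q ↔ z = c := fun z => by
    have := Set.ext_iff.1 hPQ z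
    simpa using this
  refine ⟨P, B ∪ Q, ⟨hP, h.snd.trans hQ.symm ?_, ?_⟩, by ext; simp; tauto⟩
  · ext z
    have h1 := hi z
    constructor
    · rintro ⟨hzB, hzQ⟩
      rcases h1.1 ⟨.inr hzQ, hzB⟩ with rfl | rfl
      · exact absurd hzQ haQ
      · rfl
    · rintro rfl
      exact ⟨h.snd.right_mem, hQ.right_mem⟩
  · ext z
    constructor
    · rintro ⟨hzP, hz | hz⟩
      · rcases (hi z).1 ⟨.inl hzP, hz⟩ with rfl | rfl
        · exact .inl rfl
        · exact absurd hzP hbP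
      · exact .inr ((hj z).1 ⟨hzP, hz⟩)
    · rintro (rfl | rfl)
      · exact ⟨hP.left_mem, .inl h.snd.left_mem⟩
      · exact ⟨hP.right_mem, .inr hQ.left_mem⟩

theorem exists_left (h : Loop A B a b) {s : ℂ} (hs : s ∈ A ∪ B) :
    ∃ P Q e, Loop P Q s e ∧ P ∪ Q = A ∪ B := by
  by_cases h1 : s = a
  · exact ⟨A, B, b, h1 ▸ h, rfl⟩
  by_cases h2 : s = b
  · exact ⟨A, B, a, h2 ▸ h.reverse, rfl⟩
  rcases hs with hs | hs
  · obtain ⟨P, Q, h, hu⟩ := h.rotate hs h1 h2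
    exact ⟨P, Q, a, h.reverse, hu⟩
  · obtain ⟨P, Q, h, hu⟩ := h.swap.rotate hs h1 h2
    exact ⟨P, Q, a, h.reverse, by rw [hu, union_comm]⟩

/-- A simple closed curve can be split at any two of its points. -/
theorem resplit (h : Loop A B a b) {s t : ℂ} (hs : s ∈ A ∪ B) (ht : t ∈ A ∪ B) (hst : s ≠ t) :
    ∃ P Q, Loop P Q s t ∧ P ∪ Q = A ∪ B := by
  obtain ⟨P, Q, e, hPQ, hu⟩ := h.exists_left hs
  rw [← hu] at ht ⊢
  by_cases h2 : t = e
  · exact ⟨P, Q, h2 ▸ hPQ, rfl⟩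
  rcases ht with ht | ht
  · exact hPQ.rotate ht hst.symm h2
  · obtain ⟨P', Q', h, hu⟩ := hPQ.swap.rotate ht hst.symm h2
    exact ⟨P', Q', h, by rw [hu, union_comm]⟩

/-- Every complementary component of a simple closed curve accumulates at every point of it. -/
theorem mem_closure_fst (h : Loop A B a b) (hp : p ∉ A ∪ B) (hx : x ∈ A) (hxa : x ≠ a)
    (hxb : x ≠ b) : x ∈ closure {q | Same (A ∪ B) p q} := by
  by_contra hcl
  set V := {q | Same (A ∪ B) p q} with hV
  have hVo : IsOpen V := isOpen_same h.isClosed p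
  obtain ⟨A₁, A₂, c, d, h1, h2, s1, s2, hd, hsub, hxn⟩ := h.fst.exists_window hx hxa hxb
    (isClosed_closure.isOpen_compl.mem_nhds hcl)
  have hi : ∀ z, z ∈ A → z ∈ B → z = a ∨ z = b := fun z h1 h2 => by
    have : z ∈ A ∩ B := ⟨h1, h2⟩
    rw [h.inter] at this; simpa using this
  have hK1 : IsArc (A₁ ∪ B) c b := by
    refine h1.symm.trans h.snd (Set.ext fun z => ⟨?_, ?_⟩)
    · rintro ⟨hz1, hz2⟩
      rcases hi z (s1 hz1) hz2 with rfl | rfl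
      · rfl
      · exact absurd h2.right_mem (disjoint_left.1 hd hz1)
    · rintro rfl; exact ⟨h1.left_mem, h.snd.left_mem⟩
  have hK : IsArc ((A₁ ∪ B) ∪ A₂) c d := by
    refine hK1.trans h2.symm (Set.ext fun z => ⟨?_, ?_⟩)
    · rintro ⟨hz1 | hz1, hz2⟩
      · exact absurd hz2 (disjoint_left.1 hd hz1)
      · rcases hi z (s2 hz2) hz1 with rfl | rfl
        · exact absurd hz2 (disjoint_left.1 hd h1.left_mem)
        · rfl
    · rintro rfl; exact ⟨.inr h.snd.right_mem, h2.right_mem⟩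
  set K := (A₁ ∪ B) ∪ A₂ with hKdef
  have hKsub : K ⊆ A ∪ B := by
    rintro z ((hz | hz) | hz)
    exacts [.inl (s1 hz), .inr hz, .inl (s2 hz)]
  have hpK : p ∉ K := fun h => hp (hKsub h)
  have hxK : x ∉ K := by
    rintro ((hz | hz) | hz)
    · exact hxn (.inl hz)
    · rcases hi x hx hz with rfl | rfl
      exacts [hxa rfl, hxb rfl]
    · exact hxn (.inr hz)
  have hsame : Same K p x := hK.same hpK hxK
  have : {q | Same K p q} ⊆ V := by
    refine (isPreconnected_same p).subset_of_closure_inter_subset hVo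
      ⟨p, Same.refl hpK, Same.refl hp⟩ ?_
    rintro z ⟨hz, hzK⟩
    by_contra hzV
    have hzf : z ∈ frontier V := by rw [hVo.frontier_eq]; exact ⟨hz, hzV⟩
    have hzJ := frontier_same_subset h.isClosed p hzf
    have hzK' : z ∉ K := Same.right hzK
    refine hsub (?_ : z ∈ A \ (A₁ ∪ A₂)) hz
    simp only [hKdef, mem_union, not_or] at hzK'
    rcases hzJ with hzA | hzB
    · exact ⟨hzA, by simp [hzK']⟩
    · exact absurd hzB hzK'.1.2
  exact Same.right (this hsame) (.inl hx)

theorem mem_closure (h : Loop A B a b) (hp : p ∉ A ∪ B) (hx : x ∈ A ∪ B) :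
    x ∈ closure {q | Same (A ∪ B) p q} := by
  have h1 : A \ {a, b} ⊆ closure {q | Same (A ∪ B) p q} := fun x hx => by
    have := hx.2
    simp only [mem_insert_iff, mem_singleton_iff, not_or] at this
    exact h.mem_closure_fst hp hx.1 this.1 this.2
  have h2 : B \ {a, b} ⊆ closure {q | Same (A ∪ B) p q} := fun x hx => by
    have := hx.2
    simp only [mem_insert_iff, mem_singleton_iff, not_or] at this
    rw [union_comm] at hp ⊢
    exact h.swap.mem_closure_fst hp hx.1 this.1 this.2
  rcases hx with hx | hx
  · exact closure_minimal h1 isClosed_closure (h.fst.subset_closure_diff_pair hx)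
  · exact closure_minimal h2 isClosed_closure (h.snd.subset_closure_diff_pair hx)

end Loop

theorem IsArc.eq_of_subset {A S : Set ℂ} {a b : ℂ} (hA : IsArc A a b) (hS : IsArc S a b)
    (h : S ⊆ A) : S = A := by
  refine h.antisymm fun c hc => ?_
  by_cases hca : c = a
  · exact hca ▸ hS.left_mem
  by_cases hcb : c = b
  · exact hcb ▸ hS.right_mem
  obtain ⟨P, Q, hP, hQ, rfl, hPQ⟩ := hA.exists_split hc hca hcb
  obtain ⟨z, hz, hz'⟩ := isPreconnected_closed_iff.1 hS.isPreconnected P Q hP.isClosed hQ.isClosed h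
    ⟨a, hS.left_mem, hP.left_mem⟩ ⟨b, hS.right_mem, hQ.right_mem⟩
  rw [hPQ] at hz'
  exact hz' ▸ hz

/-- The complement of `J` has exactly two components. -/
structure TwoSided (J : Set ℂ) : Prop where
  exists_not_same : ∃ p q, p ∉ J ∧ q ∉ J ∧ ¬ Same J p q
  same : ∀ x y z, x ∉ J → y ∉ J → z ∉ J → ¬ Same J x y → ¬ Same J y z → Same J x z

/-- The affine coordinate along the segment from `a` to `b`, centred at its midpoint. -/
noncomputable def segCoord (a b w : ℂ) : ℂ := (a + b) / 2 + (b - a) * w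

theorem segment_coord {a b : ℂ} {x : ℝ} (hx : |x| ≤ 1 / 2) : segCoord a b x ∈ segment ℝ a b := by
  rw [segment_eq_image]
  refine ⟨x + 1 / 2, ⟨by linarith [neg_le_of_abs_le hx], by linarith [le_of_abs_le hx]⟩, ?_⟩
  simp only [segCoord, real_smul]
  push_cast; ring

theorem exists_coord_of_mem_segment {a b z : ℂ} (hz : z ∈ segment ℝ a b) :
    ∃ x : ℝ, |x| ≤ 1 / 2 ∧ z = segCoord a b x := by
  rw [segment_eq_image] at hz
  obtain ⟨t, ht, rfl⟩ := hz
  refine ⟨t - 1 / 2, abs_le.2 ⟨by linarith [ht.1], by linarith [ht.2]⟩, ?_⟩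
  simp only [segCoord, real_smul]
  push_cast; ring

theorem segCoord_injective {a b : ℂ} (hab : a ≠ b) : Function.Injective (segCoord a b) :=
  fun x y h => by
    have h' : (b - a) * x = (b - a) * y := by simpa [segCoord] using h
    exact mul_left_cancel₀ (sub_ne_zero.2 hab.symm) h'

/-- The open upper half disc of radius `ρ` in the coordinate along the segment. -/
def halfDisc (a b : ℂ) (ρ : ℝ) : Set ℂ := segCoord a b '' {w | ‖w‖ < ρ ∧ 0 < w.im}

theorem isPreconnected_halfDisc (a b : ℂ) (ρ : ℝ) : IsPreconnected (halfDisc a b ρ) := by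
  refine IsPreconnected.image (_root_.Convex.isPreconnected ?_) _ ?_
  · have h1 : {w : ℂ | ‖w‖ < ρ ∧ 0 < w.im} = Metric.ball 0 ρ ∩ {w | 0 < w.im} := by
      ext w; simp
    rw [h1]
    exact (convex_ball _ _).inter (convex_halfSpace_im_gt 0)
  · unfold segCoord; fun_prop

theorem segCoord_swap (a b w : ℂ) : segCoord b a w = segCoord a b (-w) := by
  simp only [segCoord]; ring

theorem disjoint_halfDisc_segment {a b : ℂ} (hab : a ≠ b) (ρ : ℝ) :
    Disjoint (halfDisc a b ρ) (segment ℝ a b) := by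
  refine disjoint_left.2 ?_
  rintro _ ⟨w, hw, rfl⟩ hz
  obtain ⟨x, -, hx⟩ := exists_coord_of_mem_segment hz
  rw [segCoord_injective hab hx] at hw
  simpa using hw.2

theorem coord_mem_halfDisc {a b : ℂ} {ε ρ : ℝ} (h : ε < ρ) (h0 : 0 < ε) :
    segCoord a b (ε * I) ∈ halfDisc a b ρ :=
  ⟨_, by simp [h0, h, abs_of_pos h0], rfl⟩

theorem exists_radius {a b : ℂ} {K : Set ℂ} (hK : IsClosed K)
    (h : (a + b) / 2 ∉ K) :
    ∃ ρ > 0, ρ ≤ 1 / 2 ∧ ∀ w, ‖w‖ < ρ → segCoord a b w ∉ K := by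
  have hc : Continuous (segCoord a b) := by unfold segCoord; fun_prop
  have : segCoord a b ⁻¹' Kᶜ ∈ 𝓝 0 :=
    (hK.isOpen_compl.preimage hc).mem_nhds (by simpa [segCoord] using h)
  obtain ⟨r, hr, hr'⟩ := Metric.mem_nhds_iff.1 this
  refine ⟨min r (1 / 2), lt_min hr (by norm_num), min_le_right _ _, fun w hw => hr' ?_⟩
  simpa using hw.trans_le (min_le_left _ _)

theorem midpoint_notMem {A : Set ℂ} {a b : ℂ} (h : Loop A (segment ℝ a b) a b) :
    (a + b) / 2 ∉ A := by
  intro hm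
  have h1 : (a + b) / 2 ∈ segment ℝ a b := by
    have := segment_coord (a := a) (b := b) (x := 0) (by norm_num)
    simpa [segCoord] using this
  have : (a + b) / 2 ∈ ({a, b} : Set ℂ) := h.inter ▸ ⟨hm, h1⟩
  have hab := h.fst.ne
  rcases this with h2 | h2
  · exact hab (by linear_combination (-2) * h2)
  · rw [mem_singleton_iff] at h2
    exact hab (by linear_combination 2 * h2)

/-- The two sides of a segment are separated by a closed curve containing it. -/
theorem Loop.not_same_segment {A : Set ℂ} {a b : ℂ} (h : Loop A (segment ℝ a b) a b) {ρ ε : ℝ}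
    (hA : ∀ w, ‖w‖ < ρ → segCoord a b w ∉ A) (h0 : 0 < ε) (hε : ε < ρ) :
    ¬ Same (A ∪ segment ℝ a b) (segCoord a b (ε * I)) (segCoord a b (-(ε * I))) := by
  have hab := h.fst.ne
  have hba : b - a ≠ 0 := sub_ne_zero.2 hab.symm
  intro hs
  have hw := h.wind_eq_zero hs
  have ha : a = segCoord a b (-(1 / 2)) := by rw [segCoord]; ring
  have hb : b = segCoord a b (1 / 2) := by rw [segCoord]; ring
  set c : ℂ → ℂ := fun z => (z - (a + b) / 2) / (b - a) with hc
  have hcc : ∀ w, c (segCoord a b w) = w := fun w => by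
    simp only [hc, segCoord]; field_simp; ring
  have hca : c a = -(1 / 2) := by rw [ha, hcc]
  have hcb : c b = 1 / 2 := by rw [hb, hcc]
  have hcont : Continuous c := by fun_prop
  have hdiv : ∀ w, (segCoord a b w - segCoord a b (ε * I)) /
      (segCoord a b w - segCoord a b (-(ε * I))) = (w - ε * I) / (w + ε * I) := fun w => by
    simp only [segCoord]
    rw [show (a + b) / 2 + (b - a) * w - ((a + b) / 2 + (b - a) * (ε * I)) =
      (b - a) * (w - ε * I) by ring, show (a + b) / 2 + (b - a) * w -
      ((a + b) / 2 + (b - a) * -(ε * I)) = (b - a) * (w + ε * I) by ring,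
      mul_div_mul_left _ _ hba]
  -- on the segment
  have hS : dlog (segment ℝ a b) a b (segCoord a b (ε * I)) (segCoord a b (-(ε * I))) =
      2 * (log (ε + 1 / 2 * I) - log (ε - 1 / 2 * I)) := by
    have hre : ∀ x : ℝ, (ε + x * I : ℂ) ∈ slitPlane ∧ (ε - x * I : ℂ) ∈ slitPlane := fun x =>
      ⟨.inl (by simpa using h0), .inl (by simpa using h0)⟩
    have hz : ∀ z ∈ segment ℝ a b, ∃ x : ℝ, c z = x ∧ z = segCoord a b x := fun z hz => by
      obtain ⟨x, -, rfl⟩ := exists_coord_of_mem_segment hz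
      exact ⟨x, hcc _, rfl⟩
    rw [dlog_eq (g := fun z => log (ε + c z * I) - log (ε - c z * I) + Real.pi * I)
      h.snd.isPreconnected h.snd.left_mem h.snd.right_mem ?_ ?_]
    · simp only [hca, hcb]; ring_nf
    · refine ContinuousOn.add (ContinuousOn.sub (ContinuousOn.clog (by fun_prop) ?_)
        (ContinuousOn.clog (by fun_prop) ?_)) continuousOn_const
      · intro z hzs; obtain ⟨x, hx, -⟩ := hz z hzs; rw [hx]; exact (hre x).1
      · intro z hzs; obtain ⟨x, hx, -⟩ := hz z hzs; rw [hx]; exact (hre x).2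
    · intro z hzs
      obtain ⟨x, hx, rfl⟩ := hz z hzs
      have n1 := slitPlane_ne_zero (hre x).1
      have n2 := slitPlane_ne_zero (hre x).2
      have n3 : (x : ℂ) + ε * I ≠ 0 := fun h0 => n2 (by
        linear_combination (-I) * h0 + ε * I_sq)
      rw [hdiv, hcc, exp_add, exp_sub, exp_log n1, exp_log n2, exp_pi_mul_I]
      rw [mul_neg_one, neg_eq_iff_eq_neg, ← neg_div, div_eq_div_iff n2 n3]
      linear_combination (2 * ε * x) * I_sq
  have hAd : dlog A a b (segCoord a b (ε * I)) (segCoord a b (-(ε * I))) =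
      2 * log ((1 / 2 - ε * I) / (1 / 2 + ε * I)) := by
    have hA' : ∀ z ∈ A, ρ ≤ ‖c z‖ := fun z hz => by
      by_contra! hlt
      refine hA _ hlt ?_
      convert hz
      simp only [hc, segCoord]; field_simp; ring
    have hne : ∀ z ∈ A, c z + ε * I ≠ 0 := fun z hz h1 => by
      have h2 := hA' z hz
      rw [eq_neg_of_add_eq_zero_left h1] at h2
      simp [abs_of_pos h0] at h2
      linarith
    have hsl : ∀ z ∈ A, (c z - ε * I) / (c z + ε * I) ∈ slitPlane := fun z hz => by
      by_contra hn
      rw [mem_slitPlane_iff, not_or, not_lt, not_not] at hn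
      set q := (c z - ε * I) / (c z + ε * I) with hq
      obtain ⟨s, hs⟩ : ∃ s : ℝ, q = -s := ⟨-q.re, by
        apply Complex.ext <;> simp [hn.2]⟩
      have hs0 : 0 ≤ s := by
        have := hn.1; rw [hs] at this; simpa using this
      rw [hq, div_eq_iff (hne z hz)] at hs
      have h1 : (1 + s) * c z = (1 - s) * (ε * I) := by linear_combination hs
      have h2 := congrArg norm h1
      have e1 : ‖(1 + s : ℂ)‖ = 1 + s := by
        rw [← ofReal_one, ← ofReal_add, norm_real, Real.norm_of_nonneg (by linarith)]
      have e2 : ‖(1 - s : ℂ)‖ ≤ 1 + s := by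
        rw [← ofReal_one, ← ofReal_sub, norm_real, Real.norm_eq_abs, abs_le]
        constructor <;> linarith
      have e3 : ‖(ε * I : ℂ)‖ = ε := by simp [abs_of_pos h0]
      rw [norm_mul, norm_mul, e1, e3] at h2
      have h3 : (1 + s) * ‖c z‖ ≤ (1 + s) * ε := by
        rw [h2]; exact mul_le_mul_of_nonneg_right e2 h0.le
      have h4 := le_of_mul_le_mul_left h3 (by linarith)
      linarith [hA' z hz]
    rw [dlog_eq (g := fun z => log ((c z - ε * I) / (c z + ε * I)))
      h.fst.isPreconnected h.fst.left_mem h.fst.right_mem ?_ ?_]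
    · simp only [hca, hcb]
      have h1 := hsl b h.fst.right_mem
      rw [hcb] at h1
      have h2 : (-(1 / 2) - ε * I : ℂ) / (-(1 / 2) + ε * I) =
          ((1 / 2 - ε * I) / (1 / 2 + ε * I))⁻¹ := by
        rw [inv_div, ← neg_div_neg_eq]; ring_nf
      rw [h2, log_inv _ (mem_slitPlane_iff_arg.1 h1).1]
      ring
    · exact ContinuousOn.clog (ContinuousOn.div (by fun_prop) (by fun_prop) hne) hsl
    · intro z hz
      rw [exp_log (slitPlane_ne_zero (hsl z hz))]
      have : z = segCoord a b (c z) := by simp only [hc, segCoord]; field_simp; ring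
      conv_rhs => rw [this]
      rw [hdiv]
  rw [wind, hS, hAd] at hw
  have hi := congrArg im hw
  simp only [sub_im, mul_im, log_im, re_ofNat, im_ofNat, zero_mul, add_zero, zero_im] at hi
  have i1 : 0 < arg (ε + 1 / 2 * I) := by
    rw [lt_iff_le_and_ne]
    refine ⟨arg_nonneg_iff.2 (by simp), fun h => ?_⟩
    have := arg_eq_zero_iff.1 h.symm
    simp at this
  have i2 : arg (ε - 1 / 2 * I) < 0 := arg_neg_iff.2 (by simp)
  have i3 : arg ((1 / 2 - ε * I) / (1 / 2 + ε * I)) < 0 := by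
    rw [arg_neg_iff]
    have hns : 0 < normSq (1 / 2 + ε * I) := normSq_pos.2 fun h => by
      have := congrArg re h; simp at this
    rw [div_im, ← sub_div]
    refine div_neg_of_neg_of_pos ?_ hns
    simp
    linarith
  linarith

theorem segCoord_mem_segment {a b w : ℂ} (hw : ‖w‖ ≤ 1 / 2) (h : w.im = 0) :
    segCoord a b w ∈ segment ℝ a b := by
  have h1 : (w.re : ℂ) = w := by apply Complex.ext <;> simp [h]
  rw [← h1]
  exact segment_coord ((abs_re_le_norm w).trans hw)

/-- A point close to the midpoint of a segment and off the segment lies in a half disc. -/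
theorem mem_halfDisc_or {a b w : ℂ} {ρ : ℝ} (hρ : ρ ≤ 1 / 2) (hw : ‖w‖ < ρ)
    (h : segCoord a b w ∉ segment ℝ a b) :
    segCoord a b w ∈ halfDisc a b ρ ∨ segCoord a b w ∈ halfDisc b a ρ := by
  rcases lt_trichotomy w.im 0 with h1 | h1 | h1
  · exact .inr ⟨-w, by simpa using ⟨hw, h1⟩, by rw [segCoord_swap, neg_neg]⟩
  · exact absurd (segCoord_mem_segment (hw.le.trans hρ) h1) h
  · exact .inl ⟨w, ⟨hw, h1⟩, rfl⟩

theorem Loop.twoSided_segment {A : Set ℂ} {a b : ℂ} (h : Loop A (segment ℝ a b) a b) :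
    TwoSided (A ∪ segment ℝ a b) := by
  have hab := h.fst.ne
  obtain ⟨ρ, hρ, hρ', hA⟩ := exists_radius h.fst.isClosed (midpoint_notMem h)
  have hcc : Continuous (segCoord a b) := by unfold segCoord; fun_prop
  obtain ⟨ε, h0, hε⟩ := exists_between hρ
  have hdA : ∀ a' b', (∀ w, segCoord a' b' w = segCoord a b w ∨
      segCoord a' b' w = segCoord a b (-w)) → Disjoint (halfDisc a' b' ρ) A := by
    intro a' b' hs
    refine disjoint_left.2 ?_
    rintro _ ⟨w, hw, rfl⟩ hz
    rcases hs w with h | h <;> rw [h] at hz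
    · exact hA _ hw.1 hz
    · exact hA _ (by simpa using hw.1) hz
  have d1 : Disjoint (halfDisc a b ρ) (A ∪ segment ℝ a b) :=
    disjoint_union_right.2 ⟨hdA a b fun w => .inl rfl, disjoint_halfDisc_segment hab ρ⟩
  have d2 : Disjoint (halfDisc b a ρ) (A ∪ segment ℝ a b) :=
    disjoint_union_right.2 ⟨hdA b a fun w => .inr (segCoord_swap a b w),
      segment_symm ℝ a b ▸ disjoint_halfDisc_segment hab.symm ρ⟩
  have m1 : segCoord a b (ε * I) ∈ halfDisc a b ρ := coord_mem_halfDisc hε h0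
  have m2 : segCoord a b (-(ε * I)) ∈ halfDisc b a ρ := by
    rw [← segCoord_swap]; exact coord_mem_halfDisc hε h0
  have hns := h.not_same_segment hA h0 hε
  have key : ∀ x ∉ A ∪ segment ℝ a b, Same (A ∪ segment ℝ a b) x (segCoord a b (ε * I)) ∨
      Same (A ∪ segment ℝ a b) x (segCoord a b (-(ε * I))) := by
    intro x hx
    have hm : segCoord a b 0 ∈ A ∪ segment ℝ a b :=
      .inr (segCoord_mem_segment (by simp) rfl)
    have hcl := h.mem_closure hx hm
    have hopen : segCoord a b '' Metric.ball 0 ρ ∈ 𝓝 (segCoord a b 0) := by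
      have hba : b - a ≠ 0 := sub_ne_zero.2 hab.symm
      have e : segCoord a b '' Metric.ball 0 ρ =
          (fun z => (z - (a + b) / 2) / (b - a)) ⁻¹' Metric.ball 0 ρ := by
        refine congrFun (image_eq_preimage_of_inverse (fun w => ?_) (fun w => ?_)) _
        · simp only [segCoord]; field_simp; ring
        · simp only [segCoord]; field_simp; ring
      rw [e]
      exact (Metric.isOpen_ball.preimage (by fun_prop)).mem_nhds (by simpa [segCoord] using hρ)
    obtain ⟨_, ⟨w, hw, rfl⟩, hyx⟩ := mem_closure_iff_nhds.1 hcl _ hopen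
    have hyx' : Same (A ∪ segment ℝ a b) x (segCoord a b w) := hyx
    rcases mem_halfDisc_or hρ' (by simpa using hw) (fun h => hyx'.right (.inr h)) with hw | hw
    · exact .inl (hyx'.trans (same_of_isPreconnected (isPreconnected_halfDisc a b ρ) d1 hw m1))
    · exact .inr (hyx'.trans (same_of_isPreconnected (isPreconnected_halfDisc b a ρ) d2 hw m2))
  refine ⟨⟨_, _, disjoint_left.1 d1 m1, disjoint_left.1 d2 m2, hns⟩, ?_⟩
  intro x y z hx hy hz hxy hyz
  rcases key x hx with h1 | h1 <;> rcases key y hy with h2 | h2 <;> rcases key z hz with h3 | h3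
  · exact h1.trans h3.symm
  · exact absurd (h1.trans h2.symm) hxy
  · exact h1.trans h3.symm
  · exact absurd (h2.trans h3.symm) hyz
  · exact absurd (h2.trans h3.symm) hyz
  · exact h1.trans h3.symm
  · exact absurd (h1.trans h2.symm) hxy
  · exact h1.trans h3.symm

/-- Two closed curves sharing an arc wind equally around nearby points of a common region. -/
theorem TwoSided.wind_eq {A B : Set ℂ} {a b x y q : ℂ} (hT : TwoSided (A ∪ B)) (h : Loop A B a b)
    (hx : x ∉ A ∪ B) (hy : y ∉ A ∪ B) (hq : q ∉ A ∪ B) (hxq : wind A B a b x q ≠ 0)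
    (hyq : wind A B a b y q ≠ 0) : wind A B a b x q = wind A B a b y q := by
  have h1 : ¬ Same (A ∪ B) x q := fun hs => hxq (h.wind_eq_zero hs)
  have h2 : ¬ Same (A ∪ B) q y := fun hs => hyq (h.wind_eq_zero hs.symm)
  have := h.wind_eq_zero (hT.same x q y hx hq hy h1 h2)
  rw [← h.wind_add hx hy hq, this, zero_add]

/-- Both sides of a closed curve occur near each of its points. -/
theorem TwoSided.exists_near {A B : Set ℂ} {a b x q : ℂ} (hT : TwoSided (A ∪ B))
    (h : Loop A B a b) (hq : q ∉ A ∪ B) (hx : x ∈ A ∪ B) {U : Set ℂ} (hU : U ∈ 𝓝 x) :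
    (∃ y ∈ U, y ∉ A ∪ B ∧ wind A B a b y q = 0) ∧
      ∃ y ∈ U, y ∉ A ∪ B ∧ wind A B a b y q ≠ 0 := by
  constructor
  · obtain ⟨y, hyU, hy⟩ := mem_closure_iff_nhds.1 (h.mem_closure hq hx) U hU
    exact ⟨y, hyU, Same.right hy, h.wind_eq_zero (Same.symm hy)⟩
  · obtain ⟨r, hr, hrq⟩ : ∃ r, r ∉ A ∪ B ∧ ¬ Same (A ∪ B) r q := by
      obtain ⟨p, r, hp, hr, hpr⟩ := hT.exists_not_same
      by_contra! hcon
      exact hpr ((hcon p hp).trans (hcon r hr).symm)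
    obtain ⟨y, hyU, hy⟩ := mem_closure_iff_nhds.1 (h.mem_closure hr hx) U hU
    exact ⟨y, hyU, Same.right hy, fun h0 => hrq
      (Same.trans hy (h.same_of_wind_eq_zero (Same.right hy) hq h0))⟩

theorem eq_of_three_values {X Y Z σ : ℂ} (hX : X = 0 ∨ X = σ ∨ X = -σ)
    (hY : Y = 0 ∨ Y = σ ∨ Y = -σ) (hZ : Z = 0 ∨ Z = σ ∨ Z = -σ) (hXY : X ≠ Y) (hYZ : Y ≠ Z)
    (m1 : X = σ → Y = -σ → False) (m2 : Y = σ → X = -σ → False) (m3 : X = σ → Z = -σ → False)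
    (m4 : Z = σ → X = -σ → False) (m5 : Y = σ → Z = -σ → False) (m6 : Z = σ → Y = -σ → False) :
    X = Z := by
  rcases hX with h1 | h1 | h1 <;> rcases hY with h2 | h2 | h2 <;> rcases hZ with h3 | h3 | h3 <;>
    first
    | exact h1.trans h3.symm
    | exact absurd (h1.trans h2.symm) hXY
    | exact absurd (h2.trans h3.symm) hYZ
    | exact (m1 h1 h2).elim
    | exact (m2 h2 h1).elim
    | exact (m3 h1 h3).elim
    | exact (m4 h3 h1).elim
    | exact (m5 h2 h3).elim
    | exact (m6 h3 h2).elim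

/-- Three arcs with common endpoints, otherwise disjoint. -/
structure Theta (A₁ A₂ A₃ : Set ℂ) (a b : ℂ) : Prop where
  l12 : Loop A₁ A₂ a b
  l13 : Loop A₁ A₃ a b
  l23 : Loop A₂ A₃ a b

theorem Theta.exists_ball {A₁ A₂ A₃ : Set ℂ} {a b : ℂ} (h : Theta A₁ A₂ A₃ a b) :
    ∃ x r, x ∈ A₁ ∧ 0 < r ∧ Disjoint (Metric.ball x r) (A₂ ∪ A₃) := by
  obtain ⟨x, hx, hx'⟩ := h.l12.fst.exists_mem_diff_pair
  have : x ∉ A₂ ∪ A₃ := by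
    rintro (h1 | h1)
    · exact hx' (h.l12.inter ▸ ⟨hx, h1⟩)
    · exact hx' (h.l13.inter ▸ ⟨hx, h1⟩)
  obtain ⟨r, hr, hr'⟩ := Metric.isOpen_iff.1 h.l23.isClosed.isOpen_compl x this
  exact ⟨x, r, hx, hr, subset_compl_iff_disjoint_right.1 hr'⟩

set_option maxHeartbeats 1000000 in
theorem Theta.twoSided_of_segment {A₁ A₂ : Set ℂ} {a b : ℂ} (h : Theta A₁ A₂ (segment ℝ a b) a b) :
    TwoSided (A₁ ∪ A₂) := by
  have hab := h.l12.fst.ne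
  set S := segment ℝ a b with hS
  have t13 : TwoSided (A₁ ∪ S) := h.l13.twoSided_segment
  have t23 : TwoSided (A₂ ∪ S) := h.l23.twoSided_segment
  have hm : (a + b) / 2 ∉ A₁ ∪ A₂ := by
    rintro (h1 | h1)
    exacts [midpoint_notMem h.l13 h1, midpoint_notMem h.l23 h1]
  obtain ⟨ρ, hρ, hρ', hA⟩ := exists_radius h.l12.isClosed hm
  obtain ⟨ε, h0, hε⟩ := exists_between hρ
  have hnε : ‖(ε * I : ℂ)‖ < ρ := by simpa [abs_of_pos h0] using hε
  have hnε' : ‖-(ε * I : ℂ)‖ < ρ := by rwa [norm_neg]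
  set u := segCoord a b (ε * I) with hu
  set v := segCoord a b (-(ε * I)) with hv
  have hcc : Continuous (segCoord a b) := by unfold segCoord; fun_prop
  have hball : ∀ w, ‖w‖ < ρ → Same (A₁ ∪ A₂) (segCoord a b w) v := fun w hw => by
    refine same_of_isPreconnected ((Metric.isPreconnected_ball (x := (0 : ℂ)) (r := ρ)).image _
      hcc.continuousOn) ?_ (mem_image_of_mem _ (by simpa using hw))
      (mem_image_of_mem _ (by simpa using hnε'))
    refine disjoint_left.2 ?_
    rintro _ ⟨w, hw, rfl⟩
    exact hA w (by simpa using hw)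
  have n1 : ¬ Same (A₁ ∪ S) u v := h.l13.not_same_segment (fun w hw h => hA w hw (.inl h)) h0 hε
  have n2 : ¬ Same (A₂ ∪ S) u v := h.l23.not_same_segment (fun w hw h => hA w hw (.inr h)) h0 hε
  have huS : u ∉ S := disjoint_left.1 (disjoint_halfDisc_segment hab ρ) (coord_mem_halfDisc hε h0)
  have hvS : v ∉ S := by
    rw [hv, ← segCoord_swap, hS, segment_symm]
    exact disjoint_left.1 (disjoint_halfDisc_segment hab.symm ρ) (coord_mem_halfDisc hε h0)
  have huA := hA _ hnε
  have hvA := hA _ hnε'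
  have hu13 : u ∉ A₁ ∪ S := by simp only [mem_union, not_or] at *; exact ⟨huA.1, huS⟩
  have hu23 : u ∉ A₂ ∪ S := by simp only [mem_union, not_or] at *; exact ⟨huA.2, huS⟩
  have hv13 : v ∉ A₁ ∪ S := by simp only [mem_union, not_or] at *; exact ⟨hvA.1, hvS⟩
  have hv23 : v ∉ A₂ ∪ S := by simp only [mem_union, not_or] at *; exact ⟨hvA.2, hvS⟩
  have hsum : ∀ x, wind A₁ A₂ a b x v = wind A₁ S a b x v - wind A₂ S a b x v := fun x => by
    simp only [wind]; ring
  have hσ1 : wind A₁ S a b u v ≠ 0 := fun h0 => n1 (h.l13.same_of_wind_eq_zero hu13 hv13 h0)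
  have hσ2 : wind A₂ S a b u v ≠ 0 := fun h0 => n2 (h.l23.same_of_wind_eq_zero hu23 hv23 h0)
  have hσ : wind A₂ S a b u v = wind A₁ S a b u v := by
    have := hsum u
    rw [h.l12.wind_eq_zero (hball _ hnε)] at this
    linear_combination this
  set σ := wind A₁ S a b u v with hσd
  have v1 : ∀ x ∉ A₁ ∪ A₂, x ∉ S → wind A₁ S a b x v = 0 ∨ wind A₁ S a b x v = σ := fun x hx hxS =>
    or_iff_not_imp_left.2 fun hn => t13.wind_eq h.l13 (by simp at *; tauto) hu13 hv13 hn hσ1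
  have v2 : ∀ x ∉ A₁ ∪ A₂, x ∉ S → wind A₂ S a b x v = 0 ∨ wind A₂ S a b x v = σ := fun x hx hxS =>
    or_iff_not_imp_left.2 fun hn =>
      (t23.wind_eq h.l23 (by simp at *; tauto) hu23 hv23 hn hσ2).trans hσ
  obtain ⟨x, r, hx, hr, hd⟩ := h.exists_ball
  have hd' : ∀ y ∈ Metric.ball x r, ∀ z ∈ Metric.ball x r,
      wind A₂ S a b y v = wind A₂ S a b z v := fun y hy z hz => by
    have h1 := h.l23.wind_eq_zero (same_of_isPreconnected Metric.isPreconnected_ball hd hy hz)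
    rw [← h.l23.wind_add (disjoint_left.1 hd hy) (disjoint_left.1 hd hz) hv23, h1, zero_add]
  have hU := Metric.ball_mem_nhds x hr
  have hdS : ∀ y ∈ Metric.ball x r, y ∉ S := fun y hy h => disjoint_left.1 hd hy (.inr h)
  constructor
  · obtain ⟨⟨y, hyU, hy, hy0⟩, z, hzU, hz, hz0⟩ := t13.exists_near h.l13 hv13 (.inl hx) hU
    have hy2 : y ∉ A₂ := fun h => disjoint_left.1 hd hyU (.inl h)
    have hz2 : z ∉ A₂ := fun h => disjoint_left.1 hd hzU (.inl h)
    have hy12 : y ∉ A₁ ∪ A₂ := by simp at *; tauto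
    have hz12 : z ∉ A₁ ∪ A₂ := by simp at *; tauto
    refine ⟨y, z, hy12, hz12, fun hs => hz0 ?_⟩
    have h1 := h.l12.wind_eq_zero hs
    have h2 := h.l12.wind_add hy12 hz12 hvA
    rw [h1, hsum, hsum, hd' y hyU z hzU, hy0] at h2
    linear_combination h2
  · have hoff : ∀ y ∉ A₁ ∪ A₂, ∃ y', Same (A₁ ∪ A₂) y y' ∧ y' ∉ S := by
      intro y hy
      by_cases hyS : y ∈ S
      · have hSd : Disjoint (S \ {a, b}) (A₁ ∪ A₂) := by
          refine disjoint_left.2 fun z hz hz' => hz.2 ?_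
          rcases hz' with h1 | h1
          · exact h.l13.inter ▸ ⟨h1, hz.1⟩
          · exact h.l23.inter ▸ ⟨h1, hz.1⟩
        have hm' : ∀ y ∈ S, y ∉ A₁ ∪ A₂ → y ∈ S \ {a, b} := fun y hyS hy => ⟨hyS, by
          rintro (rfl | rfl)
          exacts [hy (.inl h.l12.fst.left_mem), hy (.inl h.l12.fst.right_mem)]⟩
        have h2 : Same (A₁ ∪ A₂) y (segCoord a b 0) :=
          same_of_isPreconnected h.l13.snd.isPreconnected_diff_pair hSd (hm' y hyS hy)
            (hm' _ (segCoord_mem_segment (by simp) rfl) (hA 0 (by simpa using hρ)))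
        exact ⟨v, h2.trans (hball 0 (by simpa using hρ)), hvS⟩
      · exact ⟨y, Same.refl hy, hyS⟩
    -- the two mixed values cannot both occur
    have hmix : ∀ y z, y ∉ A₁ ∪ A₂ → z ∉ A₁ ∪ A₂ → wind A₁ A₂ a b y v = σ →
        wind A₁ A₂ a b z v = -σ → False := by
      have hval : ∀ y ∉ A₁ ∪ A₂, ∃ y' ∈ Metric.ball x r, y' ∉ A₁ ∪ A₂ ∧
          wind A₁ A₂ a b y' v = wind A₁ A₂ a b y v := fun y hy => by
        obtain ⟨y', hyU, hy'⟩ := mem_closure_iff_nhds.1 (h.l12.mem_closure hy (.inl hx)) _ hU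
        refine ⟨y', hyU, Same.right hy', ?_⟩
        have h1 := h.l12.wind_eq_zero (Same.symm hy')
        have h2 := h.l12.wind_add (Same.right hy') hy hvA
        rw [h1, zero_add] at h2
        exact h2.symm
      intro y z hy hz hyv hzv
      obtain ⟨y', hyU, hy', hye⟩ := hval y hy
      obtain ⟨z', hzU, hz', hze⟩ := hval z hz
      rw [hyv, hsum] at hye
      rw [hzv, hsum] at hze
      have e := hd' y' hyU z' hzU
      rw [e] at hye
      rcases v1 y' hy' (hdS _ hyU) with h1 | h1 <;> rcases v2 z' hz' (hdS _ hzU) with h2 | h2 <;>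
        rcases v1 z' hz' (hdS _ hzU) with h3 | h3 <;> rw [h1, h2] at hye <;> rw [h2, h3] at hze
      · exact hσ1 (by linear_combination -hye)
      · exact hσ1 (by linear_combination -hye)
      · exact hσ1 (by linear_combination -hye / 2)
      · exact hσ1 (by linear_combination -hye / 2)
      · exact hσ1 (by linear_combination hze)
      · exact hσ1 (by linear_combination hze / 2)
      · exact hσ1 (by linear_combination -hye)
      · exact hσ1 (by linear_combination -hye)
    intro x y z hx hy hz hxy hyz
    have hval : ∀ y ∉ A₁ ∪ A₂, wind A₁ A₂ a b y v = 0 ∨ wind A₁ A₂ a b y v = σ ∨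
        wind A₁ A₂ a b y v = -σ := fun y hy => by
      obtain ⟨y', hyy, hyS⟩ := hoff y hy
      have h1 := h.l12.wind_eq_zero hyy
      have h2 := h.l12.wind_add hy hyy.right hvA
      rw [h1, zero_add, hsum] at h2
      rcases v1 y' hyy.right hyS with h3 | h3 <;> rcases v2 y' hyy.right hyS with h4 | h4 <;>
        rw [h3, h4] at h2
      · exact .inl (by linear_combination -h2)
      · exact .inr (.inr (by linear_combination -h2))
      · exact .inr (.inl (by linear_combination -h2))
      · exact .inl (by linear_combination -h2)
    have hsm : ∀ x y, x ∉ A₁ ∪ A₂ → y ∉ A₁ ∪ A₂ →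
        (Same (A₁ ∪ A₂) x y ↔ wind A₁ A₂ a b x v = wind A₁ A₂ a b y v) := fun x y hx hy => by
      rw [← h.l12.wind_eq_zero_iff hx hy, ← h.l12.wind_add hx hy hvA, add_eq_right]
    rw [hsm _ _ hx hy] at hxy
    rw [hsm _ _ hy hz] at hyz
    rw [hsm _ _ hx hz]
    have m1 := hmix x y hx hy
    have m2 := hmix y x hy hx
    have m3 := hmix x z hx hz
    have m4 := hmix z x hz hx
    have m5 := hmix y z hy hz
    have m6 := hmix z y hz hy
    exact eq_of_three_values (hval x hx) (hval y hy) (hval z hz) hxy hyz m1 m2 m3 m4 m5 m6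

/-- A simple closed curve has exactly two sides. -/
theorem Loop.twoSided {A B : Set ℂ} {a b : ℂ} (h : Loop A B a b) : TwoSided (A ∪ B) := by
  have hab := h.fst.ne
  have hS := isArc_segment hab
  by_cases hsub : segment ℝ a b ⊆ A ∪ B
  · have hdis : ∀ z ∈ segment ℝ a b \ {a, b}, ¬ (z ∈ A ∩ B) := fun z hz hz' =>
      hz.2 (h.inter ▸ hz')
    have hcl : ∀ C, IsClosed C → segment ℝ a b \ {a, b} ⊆ C → segment ℝ a b ⊆ C := fun C hC hs =>
      hS.subset_closure_diff_pair.trans (closure_minimal hs hC)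
    have : segment ℝ a b ⊆ A ∨ segment ℝ a b ⊆ B := by
      by_contra! hcon
      obtain ⟨x, hx, hx'⟩ := not_subset.1 fun hs => hcon.1 (hcl A h.fst.isClosed hs)
      obtain ⟨y, hy, hy'⟩ := not_subset.1 fun hs => hcon.2 (hcl B h.snd.isClosed hs)
      obtain ⟨z, hz, hz'⟩ := isPreconnected_closed_iff.1 hS.isPreconnected_diff_pair A B
        h.fst.isClosed h.snd.isClosed (sdiff_subset.trans hsub)
        ⟨y, hy, (hsub hy.1).resolve_right hy'⟩ ⟨x, hx, (hsub hx.1).resolve_left hx'⟩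
      exact hdis z hz hz'
    rcases this with hs | hs
    · have e := h.fst.eq_of_subset hS hs
      rw [union_comm, ← e]
      exact Loop.twoSided_segment (e ▸ h.swap)
    · have e := h.snd.eq_of_subset hS hs
      rw [← e]
      exact Loop.twoSided_segment (e ▸ h)
  · obtain ⟨x, hx, hxJ⟩ := not_subset.1 hsub
    rw [segment_eq_image_lineMap] at hx
    obtain ⟨τ, hτ, rfl⟩ := hx
    set f : ℝ →ᵃ[ℝ] ℂ := AffineMap.lineMap a b with hf
    have hfc : Continuous f := AffineMap.lineMap_continuous
    have hfi : Function.Injective f := AffineMap.lineMap_injective ℝ hab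
    have hK : IsClosed (f ⁻¹' (A ∪ B)) := h.isClosed.preimage hfc
    have h0 : (0 : ℝ) ∈ f ⁻¹' (A ∪ B) ∩ Iic τ :=
      ⟨by simpa [hf] using Or.inl h.fst.left_mem, hτ.1⟩
    have h1 : (1 : ℝ) ∈ f ⁻¹' (A ∪ B) ∩ Ici τ :=
      ⟨by simpa [hf] using Or.inl h.fst.right_mem, hτ.2⟩
    have bs : BddAbove (f ⁻¹' (A ∪ B) ∩ Iic τ) := bddAbove_Iic.mono inter_subset_right
    have bt : BddBelow (f ⁻¹' (A ∪ B) ∩ Ici τ) := bddBelow_Ici.mono inter_subset_right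
    have ms := (hK.inter isClosed_Iic).csSup_mem ⟨0, h0⟩ bs
    have mt := (hK.inter isClosed_Ici).csInf_mem ⟨1, h1⟩ bt
    set s := sSup (f ⁻¹' (A ∪ B) ∩ Iic τ) with hs
    set t := sInf (f ⁻¹' (A ∪ B) ∩ Ici τ) with ht
    have hsτ : s < τ := lt_of_le_of_ne ms.2 fun e => hxJ (e ▸ ms.1)
    have hτt : τ < t := lt_of_le_of_ne mt.2 fun e => hxJ (e ▸ mt.1)
    have hst := hsτ.trans hτt
    have hgap : ∀ r, s < r → r < t → f r ∉ A ∪ B := by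
      intro r h1 h2 h3
      rcases le_total r τ with h4 | h4
      · exact not_le.2 h1 (le_csSup bs ⟨h3, h4⟩)
      · exact not_le.2 h2 (csInf_le bt ⟨h3, h4⟩)
    have hseg : segment ℝ (f s) (f t) = f '' Icc s t := by
      rw [← segment_eq_Icc hst.le, image_segment]
    have hne : f s ≠ f t := fun e => hst.ne (hfi e)
    obtain ⟨P, Q, hPQ, hu⟩ := h.resplit ms.1 mt.1 hne
    have hloop : ∀ P, IsArc P (f s) (f t) → P ⊆ A ∪ B →
        Loop P (segment ℝ (f s) (f t)) (f s) (f t) := by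
      intro P hP hPJ
      refine ⟨hP, isArc_segment hne, ?_⟩
      ext z
      constructor
      · rintro ⟨hz, hz'⟩
        rw [hseg] at hz'
        obtain ⟨r, hr, rfl⟩ := hz'
        rcases hr.1.eq_or_lt with rfl | h1
        · exact .inl rfl
        rcases hr.2.eq_or_lt with rfl | h2
        · exact .inr rfl
        exact absurd (hPJ hz) (hgap r h1 h2)
      · rintro (rfl | rfl)
        · exact ⟨hP.left_mem, left_mem_segment _ _ _⟩
        · exact ⟨hP.right_mem, right_mem_segment _ _ _⟩
    rw [← hu]
    exact Theta.twoSided_of_segment ⟨hPQ, hloop P hPQ.fst (hu ▸ subset_union_left),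
      hloop Q hPQ.snd (hu ▸ subset_union_right)⟩

theorem wind_symm_arcs (A B : Set ℂ) (a b p q : ℂ) : wind B A a b p q = -wind A B a b p q := by
  simp only [wind]; ring

namespace Theta

variable {A₁ A₂ A₃ : Set ℂ} {a b q : ℂ}

theorem swap (h : Theta A₁ A₂ A₃ a b) : Theta A₂ A₁ A₃ a b := ⟨h.l12.swap, h.l23, h.l13⟩

/-- If `A₃` avoids the side of `q`, then the arc `A₁` is on the side of `q` of the loop opposite
to it. -/
theorem same_of_mem (h : Theta A₁ A₂ A₃ a b) (hq : q ∉ A₁ ∪ A₂)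
    (hP : ∀ x ∈ A₃, ¬ Same (A₁ ∪ A₂) q x) {x : ℂ} (hx : x ∈ A₁) (hx3 : x ∉ A₂ ∪ A₃) :
    Same (A₂ ∪ A₃) x q := by
  obtain ⟨p, hp, hp'⟩ := mem_closure_iff_nhds.1 (h.l12.mem_closure hq (.inl hx)) _
    ((isOpen_same h.l23.isClosed x).mem_nhds (Same.refl hx3))
  refine Same.trans hp (same_of_isPreconnected (isPreconnected_same (K := A₁ ∪ A₂) q) ?_ hp'
    (Same.refl hq))
  refine disjoint_left.2 fun z hz => ?_
  rintro (h1 | h1)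
  · exact hz.right (.inr h1)
  · exact hP z h1 hz

theorem exists_wind_ne_zero (h : Theta A₁ A₂ A₃ a b) (hq : q ∉ A₁ ∪ A₂)
    (hP : ∀ x ∈ A₃, ¬ Same (A₁ ∪ A₂) q x) :
    ∃ y, y ∉ A₁ ∪ A₂ ∧ y ∉ A₃ ∧ wind A₁ A₂ a b y q ≠ 0 ∧ wind A₂ A₃ a b y q = 0 := by
  obtain ⟨x, hx, hx'⟩ := h.l12.fst.exists_mem_diff_pair
  have hx3 : x ∉ A₂ ∪ A₃ := by
    rintro (h1 | h1)
    · exact hx' (h.l12.inter ▸ ⟨hx, h1⟩)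
    · exact hx' (h.l13.inter ▸ ⟨hx, h1⟩)
  obtain ⟨y, hy, hy', hy0⟩ := (h.l12.twoSided.exists_near h.l12 hq (.inl hx)
    ((isOpen_same h.l23.isClosed x).mem_nhds (Same.refl hx3))).2
  refine ⟨y, hy', fun h3 => Same.right hy (.inr h3), hy0, h.l23.wind_eq_zero ?_⟩
  exact (Same.symm hy).trans (h.same_of_mem hq hP hx hx3)

theorem wind_sub (A₁ A₂ A₃ : Set ℂ) (a b x q : ℂ) :
    wind A₁ A₂ a b x q = wind A₁ A₃ a b x q - wind A₂ A₃ a b x q := by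
  simp only [wind]; ring

/-- A connected set avoiding the arc `A₃` and the side of `q` of the loop `A₁ ∪ A₂`, which itself
is not met by `A₃`, lies on the side of `q` of one of the two other loops. -/
theorem same_or_same (h : Theta A₁ A₂ A₃ a b) (hq : q ∉ A₁ ∪ A₂)
    (hP : ∀ x ∈ A₃, ¬ Same (A₁ ∪ A₂) q x) {C : Set ℂ} (hC : IsPreconnected C) (hC3 : Disjoint C A₃)
    (hCq : ∀ x ∈ C, ¬ Same (A₁ ∪ A₂) q x) :
    (∀ x ∈ C, Same (A₁ ∪ A₃) x q) ∨ ∀ x ∈ C, Same (A₂ ∪ A₃) x q := by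
  have hq3 : q ∉ A₃ := fun h3 => hP q h3 (Same.refl hq)
  have hq13 : q ∉ A₁ ∪ A₃ := by simp only [mem_union, not_or] at *; exact ⟨hq.1, hq3⟩
  have hq23 : q ∉ A₂ ∪ A₃ := by simp only [mem_union, not_or] at *; exact ⟨hq.2, hq3⟩
  have hP' : ∀ x ∈ A₃, ¬ Same (A₂ ∪ A₁) q x := by rwa [union_comm]
  have hi : ∀ x ∈ C, x ∈ A₁ → x ∉ A₂ := fun x hx h1 h2 => by
    have h3 : x ∈ ({a, b} : Set ℂ) := h.l12.inter ▸ ⟨h1, h2⟩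
    rw [← h.l13.inter] at h3
    exact disjoint_left.1 hC3 hx h3.2
  have hoff : ∀ x ∈ C, x ∉ A₁ ∪ A₂ → (Same (A₁ ∪ A₃) x q ∨ Same (A₂ ∪ A₃) x q) ∧
      ¬ (Same (A₁ ∪ A₃) x q ∧ Same (A₂ ∪ A₃) x q) := by
    intro x hx hx12
    have hx3 : x ∉ A₃ := disjoint_left.1 hC3 hx
    have hx13 : x ∉ A₁ ∪ A₃ := by simp only [mem_union, not_or] at *; exact ⟨hx12.1, hx3⟩
    have hx23 : x ∉ A₂ ∪ A₃ := by simp only [mem_union, not_or] at *; exact ⟨hx12.2, hx3⟩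
    have h12 : wind A₁ A₂ a b x q ≠ 0 := fun h0 =>
      hCq x hx (h.l12.same_of_wind_eq_zero hx12 hq h0).symm
    rw [← h.l13.wind_eq_zero_iff hx13 hq13, ← h.l23.wind_eq_zero_iff hx23 hq23]
    have hs := wind_sub A₁ A₂ A₃ a b x q
    refine ⟨?_, fun ⟨h1, h2⟩ => h12 (by rw [hs, h1, h2, sub_zero])⟩
    by_contra! hcon
    obtain ⟨y, hy, hy3, hy12, hy0⟩ := h.exists_wind_ne_zero hq hP
    obtain ⟨z, hz, hz3, hz12, hz0⟩ := h.swap.exists_wind_ne_zero (by rwa [union_comm]) hP'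
    rw [union_comm] at hz
    rw [wind_symm_arcs, neg_ne_zero] at hz12
    have sy := wind_sub A₁ A₂ A₃ a b y q
    have sz := wind_sub A₁ A₂ A₃ a b z q
    rw [hy0, sub_zero] at sy
    rw [hz0, zero_sub] at sz
    have e1 := h.l12.twoSided.wind_eq h.l12 hx12 hy hq h12 hy12
    have e2 := h.l12.twoSided.wind_eq h.l12 hx12 hz hq h12 hz12
    have e3 := h.l13.twoSided.wind_eq h.l13 hx13 (by simp only [mem_union, not_or] at *; tauto) hq13
      hcon.1 (sy ▸ hy12)
    have e4 := h.l23.twoSided.wind_eq h.l23 hx23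
      (show z ∉ A₂ ∪ A₃ by simp only [mem_union, not_or] at *; tauto) hq23
      hcon.2 (fun h0 => hz12 (by rw [sz, h0, neg_zero]))
    exact h12 (by linear_combination e1 + e2 + sy + sz - e3 + e4 - hs)
  have hon1 : ∀ x ∈ C, x ∈ A₁ → Same (A₂ ∪ A₃) x q := fun x hx h1 => h.same_of_mem hq hP h1 (by
    rintro (h2 | h2)
    exacts [hi x hx h1 h2, disjoint_left.1 hC3 hx h2])
  have hon2 : ∀ x ∈ C, x ∈ A₂ → Same (A₁ ∪ A₃) x q := fun x hx h1 =>
    h.swap.same_of_mem (by rwa [union_comm]) hP' h1 (by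
      rintro (h2 | h2)
      exacts [hi x hx h2 h1, disjoint_left.1 hC3 hx h2])
  have hopen : ∀ {K : Set ℂ}, IsClosed K → IsOpen {x | Same K x q} := fun hK => by
    convert isOpen_same hK q using 3
    exact ⟨Same.symm, Same.symm⟩
  by_contra! hcon
  obtain ⟨⟨x, hx, hx'⟩, y, hy, hy'⟩ := hcon
  have hcov : ∀ x ∈ C, Same (A₁ ∪ A₃) x q ∨ Same (A₂ ∪ A₃) x q := fun x hx => by
    by_cases h1 : x ∈ A₁
    · exact .inr (hon1 x hx h1)
    by_cases h2 : x ∈ A₂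
    · exact .inl (hon2 x hx h2)
    exact (hoff x hx (by simp [h1, h2])).1
  obtain ⟨z, hz, h1, h2⟩ := hC _ _ (hopen h.l13.isClosed) (hopen h.l23.isClosed) hcov
    ⟨y, hy, (hcov y hy).resolve_right hy'⟩ ⟨x, hx, (hcov x hx).resolve_left hx'⟩
  refine (hoff z hz ?_).2 ⟨h1, h2⟩
  rintro (h3 | h3)
  · exact Same.left h1 (.inl h3)
  · exact Same.left h2 (.inl h3)

end Theta

/-- A drawing of a complete graph in which any two edges meet at most once. -/
structure Drawing (V : Type*) where
  vert : V → ℂ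
  vert_inj : Function.Injective vert
  arc : V → V → Set ℂ
  arc_symm : ∀ i j, arc i j = arc j i
  isArc : ∀ {i j}, i ≠ j → IsArc (arc i j) (vert i) (vert j)
  eq_of_mem : ∀ {i j k}, i ≠ j → vert k ∈ arc i j → k = i ∨ k = j
  inter : ∀ {i j k l}, i ≠ j → k ≠ l → s(i, j) ≠ s(k, l) → (arc i j ∩ arc k l).Subsingleton

namespace Drawing

variable {V : Type*} (D : Drawing V) {a b c d o : V} {p q r x y : ℂ}

/-- The triangle on three vertices. -/
def tri (a b c : V) : Set ℂ := D.arc a b ∪ D.arc b c ∪ D.arc a c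

/-- The variation of the logarithm around a triangle. -/
noncomputable def turn (a b c : V) (p q : ℂ) : ℂ :=
  dlog (D.arc a b) (D.vert a) (D.vert b) p q + dlog (D.arc b c) (D.vert b) (D.vert c) p q +
    dlog (D.arc c a) (D.vert c) (D.vert a) p q

variable {D}

theorem left_mem (h : a ≠ b) : D.vert a ∈ D.arc a b := (D.isArc h).left_mem

theorem right_mem (h : a ≠ b) : D.vert b ∈ D.arc a b := (D.isArc h).right_mem

theorem inter_eq (hab : a ≠ b) (hac : a ≠ c) (hbc : b ≠ c) :
    D.arc a b ∩ D.arc a c = {D.vert a} := by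
  refine (D.inter hab hac ?_).eq_singleton_of_mem ⟨left_mem hab, left_mem hac⟩
  simp only [ne_eq, Sym2.eq_iff]; tauto

theorem eq_vert (hab : a ≠ b) (hac : a ≠ c) (hbc : b ≠ c) (hx : x ∈ D.arc a b)
    (hx' : x ∈ D.arc a c) : x = D.vert a := by
  have : x ∈ D.arc a b ∩ D.arc a c := ⟨hx, hx'⟩
  rwa [inter_eq hab hac hbc] at this

theorem notMem_arc (hab : a ≠ b) (hca : c ≠ a) (hcb : c ≠ b) : D.vert c ∉ D.arc a b := fun h =>
  (D.eq_of_mem hab h).elim hca hcb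

theorem tri_swap (a b c : V) : D.tri a c b = D.tri a b c := by
  simp only [tri, D.arc_symm c b]
  ext; simp; tauto

theorem notMem_tri (hab : a ≠ b) (hac : a ≠ c) (hbc : b ≠ c) (hda : d ≠ a) (hdb : d ≠ b)
    (hdc : d ≠ c) : D.vert d ∉ D.tri a b c := by
  rintro ((h | h) | h)
  exacts [notMem_arc hab hda hdb h, notMem_arc hbc hdb hdc h, notMem_arc hac hda hdc h]

theorem tri_eq (a b c : V) : D.tri a b c = D.arc a b ∪ (D.arc a c ∪ D.arc c b) := by
  simp only [tri, D.arc_symm c b]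
  ext; simp; tauto

theorem isArc_union (hab : a ≠ b) (hac : a ≠ c) (hbc : b ≠ c) :
    IsArc (D.arc a c ∪ D.arc c b) (D.vert a) (D.vert b) :=
  (D.isArc hac).trans (D.isArc hbc.symm)
    (by rw [D.arc_symm a c, inter_eq hac.symm hbc.symm hab])

theorem loop (hab : a ≠ b) (hac : a ≠ c) (hbc : b ≠ c) :
    Loop (D.arc a b) (D.arc a c ∪ D.arc c b) (D.vert a) (D.vert b) := by
  refine ⟨D.isArc hab, isArc_union hab hac hbc, ?_⟩
  rw [inter_union_distrib_left, inter_eq hab hac hbc, D.arc_symm a b, D.arc_symm c b,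
    inter_eq hab.symm hbc hac, singleton_union]

theorem isClosed_tri (hab : a ≠ b) (hac : a ≠ c) (hbc : b ≠ c) : IsClosed (D.tri a b c) :=
  tri_eq (D := D) a b c ▸ (loop hab hac hbc).isClosed

theorem twoSided_tri (hab : a ≠ b) (hac : a ≠ c) (hbc : b ≠ c) : TwoSided (D.tri a b c) :=
  tri_eq (D := D) a b c ▸ (loop hab hac hbc).twoSided

theorem turn_eq_wind (hab : a ≠ b) (hac : a ≠ c) (hbc : b ≠ c) (hp : p ∉ D.tri a b c)
    (hq : q ∉ D.tri a b c) : D.turn a b c p q =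
      wind (D.arc a b) (D.arc a c ∪ D.arc c b) (D.vert a) (D.vert b) p q := by
  rw [tri_eq] at hp hq
  rw [wind, dlog_union (D.isArc hac) (D.isArc hbc.symm) (isArc_union hab hac hbc)
    (fun h => hp (.inr h)) (fun h => hq (.inr h)), turn, D.arc_symm b c, D.arc_symm c a,
    dlog_swap _ (D.vert c) (D.vert b), dlog_swap _ (D.vert a) (D.vert c)]
  ring

theorem turn_eq_zero_iff (hab : a ≠ b) (hac : a ≠ c) (hbc : b ≠ c) (hp : p ∉ D.tri a b c)
    (hq : q ∉ D.tri a b c) : D.turn a b c p q = 0 ↔ Same (D.tri a b c) p q := by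
  rw [turn_eq_wind hab hac hbc hp hq, tri_eq]
  rw [tri_eq] at hp hq
  exact (loop hab hac hbc).wind_eq_zero_iff hp hq

theorem turn_eq_of_same (hab : a ≠ b) (hac : a ≠ c) (hbc : b ≠ c) (hp : Same (D.tri a b c) p r)
    (hq : q ∉ D.tri a b c) : D.turn a b c p q = D.turn a b c r q := by
  have h0 := (turn_eq_zero_iff hab hac hbc hp.left hp.right).2 hp
  rw [turn_eq_wind hab hac hbc hp.left hq, turn_eq_wind hab hac hbc hp.right hq]
  rw [turn_eq_wind hab hac hbc hp.left hp.right] at h0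
  have h1 := hp.left
  have h2 := hp.right
  rw [tri_eq] at h1 h2 hq
  rw [← (loop hab hac hbc).wind_add h1 h2 hq, h0, zero_add]

theorem turn_eq (hab : a ≠ b) (hac : a ≠ c) (hbc : b ≠ c) (hx : x ∉ D.tri a b c)
    (hy : y ∉ D.tri a b c) (hq : q ∉ D.tri a b c) (hxq : D.turn a b c x q ≠ 0)
    (hyq : D.turn a b c y q ≠ 0) : D.turn a b c x q = D.turn a b c y q := by
  refine turn_eq_of_same hab hac hbc ((twoSided_tri hab hac hbc).same x q y hx hq hy ?_ ?_) hq
  · exact fun h => hxq ((turn_eq_zero_iff hab hac hbc hx hq).2 h)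
  · exact fun h => hyq ((turn_eq_zero_iff hab hac hbc hy hq).2 h.symm)

theorem exists_near (hab : a ≠ b) (hac : a ≠ c) (hbc : b ≠ c) (hq : q ∉ D.tri a b c)
    (hx : x ∈ D.tri a b c) {U : Set ℂ} (hU : U ∈ 𝓝 x) :
    (∃ y ∈ U, y ∉ D.tri a b c ∧ D.turn a b c y q = 0) ∧
      ∃ y ∈ U, y ∉ D.tri a b c ∧ D.turn a b c y q ≠ 0 := by
  have hq' := hq
  rw [tri_eq] at hq' hx
  obtain ⟨⟨y, h1, h2, h3⟩, z, k1, k2, k3⟩ :=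
    (loop hab hac hbc).twoSided.exists_near (loop hab hac hbc) hq' hx hU
  rw [← tri_eq] at h2 k2
  rw [← turn_eq_wind hab hac hbc h2 hq] at h3
  rw [← turn_eq_wind hab hac hbc k2 hq] at k3
  exact ⟨⟨y, h1, h2, h3⟩, z, k1, k2, k3⟩

theorem mem_closure_tri (hab : a ≠ b) (hac : a ≠ c) (hbc : b ≠ c) (hp : p ∉ D.tri a b c)
    (hx : x ∈ D.tri a b c) : x ∈ closure {q | Same (D.tri a b c) p q} := by
  rw [tri_eq] at hp hx ⊢
  exact (loop hab hac hbc).mem_closure hp hx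

theorem same_of_mem_closure (hab : a ≠ b) (hac : a ≠ c) (hbc : b ≠ c)
    (hx : x ∈ closure {q | Same (D.tri a b c) p q}) (hx' : x ∉ D.tri a b c) :
    Same (D.tri a b c) p x := by
  by_contra h
  refine hx' (frontier_same_subset (isClosed_tri hab hac hbc) p ⟨hx, ?_⟩)
  rwa [(isOpen_same (isClosed_tri hab hac hbc) p).interior_eq]

theorem turn_add (o a b c : V) (p q : ℂ) :
    D.turn o a b p q + D.turn o b c p q = D.turn o a c p q + D.turn a b c p q := by
  simp only [turn]
  rw [D.arc_symm c a, D.arc_symm b o, dlog_swap _ (D.vert o) (D.vert b),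
    dlog_swap _ (D.vert a) (D.vert c)]
  ring

end Drawing

namespace Drawing

variable {V : Type*} {D : Drawing V}

/-- `U` is a neighborhood of the vertex `o` met only by the edges at `o`, and `g c` is a point of
the edge from `o` to `c` in `U` determining the direction in which this edge leaves `o`. -/
structure Germ (D : Drawing V) (o : V) (U : Set ℂ) (g : V → ℂ) : Prop where
  isOpen : IsOpen U
  isPreconnected : IsPreconnected U
  mem : D.vert o ∈ U
  disjoint : ∀ {i j}, i ≠ o → j ≠ o → i ≠ j → Disjoint U (D.arc i j)
  mem_arc : ∀ {c}, c ≠ o → g c ∈ D.arc o c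
  mem_nhd : ∀ {c}, c ≠ o → g c ∈ U
  ne : ∀ {c}, c ≠ o → g c ≠ D.vert o
  same : ∀ {a b c p}, a ≠ o → b ≠ o → c ≠ o → a ≠ b → c ≠ a → c ≠ b → p ∈ D.arc o c → p ∈ U →
    p ≠ D.vert o → Same (D.tri o a b) p (g c)

theorem exists_germ [Finite V] (D : Drawing V) (o : V) : ∃ U g, D.Germ o U g := by
  classical
  have h1 : ∀ i j, i ≠ o → j ≠ o → i ≠ j → (D.arc i j)ᶜ ∈ 𝓝 (D.vert o) := fun i j hi hj hij =>
    (D.isArc hij).isClosed.isOpen_compl.mem_nhds (notMem_arc hij hi.symm hj.symm)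
  have hW : (⋂ i, ⋂ j, {x | i ≠ o → j ≠ o → i ≠ j → x ∉ D.arc i j}) ∈ 𝓝 (D.vert o) := by
    refine Filter.iInter_mem.2 fun i => Filter.iInter_mem.2 fun j => ?_
    by_cases h : i ≠ o ∧ j ≠ o ∧ i ≠ j
    · exact Filter.mem_of_superset (h1 i j h.1 h.2.1 h.2.2) fun x hx _ _ _ => hx
    · exact Filter.univ_mem' fun x h2 h3 h4 => absurd ⟨h2, h3, h4⟩ h
  set W := ⋂ i, ⋂ j, {x | i ≠ o → j ≠ o → i ≠ j → x ∉ D.arc i j} with hWd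
  have hWm : ∀ x ∈ W, ∀ i j, i ≠ o → j ≠ o → i ≠ j → x ∉ D.arc i j := fun x hx i j =>
    mem_iInter.1 (mem_iInter.1 hx i) j
  have h2 : ∀ c, ∃ P Q, c ≠ o → IsPreconnected (P \ {D.vert o}) ∧ P ∪ Q = D.arc o c ∧ P ⊆ W ∧
      Qᶜ ∈ 𝓝 (D.vert o) := by
    intro c
    by_cases hc : c = o
    · exact ⟨∅, ∅, fun h => absurd hc h⟩
    obtain ⟨P, Q, x, hP, hQ, hu, hi, hs, hx⟩ := (D.isArc (Ne.symm hc)).exists_initial hW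
    refine ⟨P, Q, fun _ => ⟨hP.isPreconnected_diff_left, hu, hs,
      hQ.isClosed.isOpen_compl.mem_nhds fun ho => hP.ne ?_⟩⟩
    have : D.vert o ∈ P ∩ Q := ⟨hP.left_mem, ho⟩
    rwa [hi] at this
  choose P Q hPQ using h2
  have hN : W ∩ (⋂ c, {x | c ≠ o → x ∉ Q c}) ∈ 𝓝 (D.vert o) := by
    refine Filter.inter_mem hW (Filter.iInter_mem.2 fun c => ?_)
    by_cases hc : c = o
    · exact Filter.univ_mem' fun x h => absurd hc h
    · exact Filter.mem_of_superset (hPQ c hc).2.2.2 fun x hx _ => hx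
  obtain ⟨ε, hε, hb⟩ := Metric.mem_nhds_iff.1 hN
  have hg : ∀ c, ∃ x, c ≠ o → x ∈ D.arc o c ∧ x ∈ Metric.ball (D.vert o) ε ∧ x ≠ D.vert o := by
    intro c
    by_cases hc : c = o
    · exact ⟨0, fun h => absurd hc h⟩
    have hA := D.isArc (Ne.symm hc)
    obtain ⟨x, hx, hx'⟩ := mem_closure_iff_nhds.1 (hA.subset_closure_diff_pair hA.left_mem) _
      (Metric.ball_mem_nhds _ hε)
    exact ⟨x, fun _ => ⟨hx'.1, hx, fun h => hx'.2 (.inl h)⟩⟩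
  choose g hg using hg
  refine ⟨Metric.ball (D.vert o) ε, g, Metric.isOpen_ball, Metric.isPreconnected_ball,
    Metric.mem_ball_self hε, ?_, fun hc => (hg _ hc).1, fun hc => (hg _ hc).2.1,
    fun hc => (hg _ hc).2.2, ?_⟩
  · exact fun {i j} hi hj hij => disjoint_left.2 fun x hx => hWm x (hb hx).1 i j hi hj hij
  · intro a b c p ha hb' hc hab hca hcb hp hpU hpo
    obtain ⟨hP, hu, hs, -⟩ := hPQ c hc
    have hmem : ∀ x ∈ D.arc o c, x ∈ Metric.ball (D.vert o) ε → x ≠ D.vert o →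
        x ∈ P c \ {D.vert o} := fun x hx hxU hxo =>
      ⟨(hu ▸ hx : x ∈ P c ∪ Q c).resolve_right (mem_iInter.1 (hb hxU).2 c hc), hxo⟩
    refine same_of_isPreconnected hP (disjoint_left.2 ?_) (hmem p hp hpU hpo)
      (hmem _ (hg c hc).1 (hg c hc).2.1 (hg c hc).2.2)
    rintro x hx ((h | h) | h)
    · exact hx.2 (eq_vert hc.symm ha.symm hca (hu ▸ .inl hx.1) h)
    · exact hWm x (hs hx.1) a b ha hb' hab h
    · exact hx.2 (eq_vert hc.symm hb'.symm hcb (hu ▸ .inl hx.1) h)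

namespace Germ

variable {o : V} {U : Set ℂ} {g : V → ℂ} {a b c d : V}

theorem notMem_tri (hG : D.Germ o U g) (ha : a ≠ o) (hb : b ≠ o) (hc : c ≠ o) (hab : a ≠ b)
    (hca : c ≠ a) (hcb : c ≠ b) : g c ∉ D.tri o a b :=
  (hG.same ha hb hc hab hca hcb (hG.mem_arc hc) (hG.mem_nhd hc) (hG.ne hc)).left

theorem turn_eq_zero (hG : D.Germ o U g) (ha : a ≠ o) (hb : b ≠ o) (hc : c ≠ o) (hab : a ≠ b)
    (hac : a ≠ c) (hbc : b ≠ c) {p q : ℂ} (hp : p ∈ U) (hq : q ∈ U) : D.turn a b c p q = 0 := by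
  have hd : Disjoint U (D.tri a b c) := disjoint_union_right.2 ⟨disjoint_union_right.2
    ⟨hG.disjoint ha hb hab, hG.disjoint hb hc hbc⟩, hG.disjoint ha hc hac⟩
  exact (turn_eq_zero_iff hab hac hbc (disjoint_left.1 hd hp) (disjoint_left.1 hd hq)).2
    (same_of_isPreconnected hG.isPreconnected hd hp hq)

theorem turn_add (hG : D.Germ o U g) (ha : a ≠ o) (hb : b ≠ o) (hc : c ≠ o) (hab : a ≠ b)
    (hac : a ≠ c) (hbc : b ≠ c) {p q : ℂ} (hp : p ∈ U) (hq : q ∈ U) :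
    D.turn o a b p q + D.turn o b c p q = D.turn o a c p q := by
  rw [Drawing.turn_add, hG.turn_eq_zero ha hb hc hab hac hbc hp hq, add_zero]

theorem notMem_tri_of (hG : D.Germ o U g) (ha : a ≠ o) (hb : b ≠ o) (hab : a ≠ b) {p : ℂ}
    (hp : p ∈ U) (h1 : p ∉ D.arc o a) (h2 : p ∉ D.arc o b) : p ∉ D.tri o a b := by
  rintro ((h | h) | h)
  exacts [h1 h, disjoint_left.1 (hG.disjoint ha hb hab) hp h, h2 h]

end Germ

/-- The edges from `o` to `c` and to `d` leave `o` into different sides of the triangle on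
`o`, `a` and `b`. -/
def Sep (D : Drawing V) (o : V) (g : V → ℂ) (a b c d : V) : Prop :=
  ¬ Same (D.tri o a b) (g c) (g d)

variable {o : V} {U : Set ℂ} {g : V → ℂ} {a b c d : V}

theorem Sep.swap (h : D.Sep o g a b c d) : D.Sep o g b a c d := by rwa [Sep, tri_swap]

theorem Sep.swap' (h : D.Sep o g a b c d) : D.Sep o g a b d c := fun hs => h hs.symm

theorem Germ.not_sep (hG : D.Germ o U g) (ha : a ≠ o) (hb : b ≠ o) (hc : c ≠ o) (hd : d ≠ o)
    (hab : a ≠ b) (hac : a ≠ c) (had : a ≠ d) (hbc : b ≠ c) (hbd : b ≠ d) (hcd : c ≠ d)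
    (h : D.Sep o g a c b d) : ¬ D.Sep o g a b c d := by
  intro h'
  set q := g d
  have hqU : q ∈ U := hG.mem_nhd hd
  have hq1 : q ∉ D.tri o a b := hG.notMem_tri ha hb hd hab had.symm hbd.symm
  have hq2 : q ∉ D.tri o a c := hG.notMem_tri ha hc hd hac had.symm hcd.symm
  have hq3 : q ∉ D.tri o b c := hG.notMem_tri hb hc hd hbc hbd.symm hcd.symm
  have hb0 : g b ∉ D.tri o a c := hG.notMem_tri ha hc hb hac hab.symm hbc
  have hc0 : g c ∉ D.tri o a b := hG.notMem_tri ha hb hc hab hac.symm hbc.symm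
  have e0 : D.turn o a c (g b) q ≠ 0 := fun h0 =>
    h ((turn_eq_zero_iff ha.symm hc.symm hac hb0 hq2).1 h0)
  have e1 : D.turn o a b (g c) q ≠ 0 := fun h0 =>
    h' ((turn_eq_zero_iff ha.symm hb.symm hab hc0 hq1).1 h0)
  have nb : U ∩ {x | Same (D.tri o a c) (g b) x} ∈ 𝓝 (g b) := Filter.inter_mem
    (hG.isOpen.mem_nhds (hG.mem_nhd hb)) ((isOpen_same (isClosed_tri ha.symm hc.symm hac) _).mem_nhds
      (Same.refl hb0))
  have nc : U ∩ {x | Same (D.tri o a b) (g c) x} ∈ 𝓝 (g c) := Filter.inter_mem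
    (hG.isOpen.mem_nhds (hG.mem_nhd hc)) ((isOpen_same (isClosed_tri ha.symm hb.symm hab) _).mem_nhds
      (Same.refl hc0))
  have hbc' : ∀ x ∈ U, x ∉ D.tri o a b → x ∉ D.tri o a c → x ∉ D.tri o b c := fun x hx h1 h2 =>
    hG.notMem_tri_of hb hc hbc hx (fun h => h1 (.inr h)) (fun h => h2 (.inr h))
  obtain ⟨⟨y, hy, hy', hy0⟩, z, hz, hz', hz0⟩ := exists_near ha.symm hb.symm hab hq1
    (.inr (hG.mem_arc hb)) nb
  obtain ⟨⟨x, hx, hx', hx0⟩, -⟩ := exists_near ha.symm hc.symm hac hq2 (.inr (hG.mem_arc hc)) nc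
  have ay := hG.turn_add ha hb hc hab hac hbc hy.1 hqU
  have az := hG.turn_add ha hb hc hab hac hbc hz.1 hqU
  have ax := hG.turn_add ha hb hc hab hac hbc hx.1 hqU
  rw [hy0, zero_add, ← turn_eq_of_same ha.symm hc.symm hac hy.2 hq2] at ay
  rw [← turn_eq_of_same ha.symm hc.symm hac hz.2 hq2] at az
  rw [hx0, ← turn_eq_of_same ha.symm hb.symm hab hx.2 hq1] at ax
  have y3 := hbc' y hy.1 hy' (Same.right hy.2)
  have z3 := hbc' z hz.1 hz' (Same.right hz.2)
  have x3 := hbc' x hx.1 (Same.right hx.2) hx'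
  have f1 : D.turn o b c z q = 0 := by
    by_contra hn
    have := turn_eq hb.symm hc.symm hbc z3 y3 hq3 hn (ay ▸ e0)
    exact hz0 (by linear_combination az - ay - this)
  have f2 := turn_eq ha.symm hb.symm hab hz' hc0 hq1 hz0 e1
  have f3 : D.turn o b c x q ≠ 0 := fun hn => e1 (by linear_combination ax - hn)
  have f4 := turn_eq hb.symm hc.symm hbc x3 y3 hq3 f3 (ay ▸ e0)
  exact e0 (by linear_combination (ax - f4 - ay + f2 - az + f1) / 2)

theorem Germ.sep (hG : D.Germ o U g) (ha : a ≠ o) (hb : b ≠ o) (hc : c ≠ o) (hd : d ≠ o)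
    (hab : a ≠ b) (hac : a ≠ c) (had : a ≠ d) (hbc : b ≠ c) (hbd : b ≠ d) (hcd : c ≠ d)
    (h : ¬ D.Sep o g a b c d) (h' : ¬ D.Sep o g a d b c) : D.Sep o g b d a c := by
  intro hs
  rw [Sep, not_not] at h h'
  set q := g c
  have hqU : q ∈ U := hG.mem_nhd hc
  have hba := hab.symm
  have hb_a : D.tri o b a = D.tri o a b := tri_swap o a b
  have hq1 : q ∉ D.tri o b a := hG.notMem_tri hb ha hc hba hbc.symm hac.symm
  have hq2 : q ∉ D.tri o a d := hG.notMem_tri ha hd hc had hac.symm hcd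
  have hq3 : q ∉ D.tri o b d := hG.notMem_tri hb hd hc hbd hbc.symm hcd
  have ha0 : g a ∉ D.tri o b d := hG.notMem_tri hb hd ha hbd hab had
  have h0 := (turn_eq_zero_iff hb.symm hd.symm hbd ha0 hq3).2 hs
  have nb : U ∩ {x | Same (D.tri o a d) (g b) x} ∈ 𝓝 (g b) := Filter.inter_mem
    (hG.isOpen.mem_nhds (hG.mem_nhd hb)) ((isOpen_same (isClosed_tri ha.symm hd.symm had) _).mem_nhds
      (Same.refl h'.left))
  have nd : U ∩ {x | Same (D.tri o b a) (g d) x} ∈ 𝓝 (g d) := Filter.inter_mem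
    (hG.isOpen.mem_nhds (hG.mem_nhd hd)) ((isOpen_same (isClosed_tri hb.symm ha.symm hba) _).mem_nhds
      (Same.refl (hb_a ▸ h.right)))
  have na : U ∩ {x | Same (D.tri o b d) (g a) x} ∈ 𝓝 (g a) := Filter.inter_mem
    (hG.isOpen.mem_nhds (hG.mem_nhd ha)) ((isOpen_same (isClosed_tri hb.symm hd.symm hbd) _).mem_nhds
      (Same.refl ha0))
  obtain ⟨-, z, hz, hz', hz0⟩ := exists_near hb.symm ha.symm hba hq1 (.inl (.inl (hG.mem_arc hb))) nb
  obtain ⟨-, y, hy, hy', hy0⟩ := exists_near ha.symm hd.symm had hq2 (.inr (hG.mem_arc hd)) nd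
  obtain ⟨-, x, hx, hx', hx0⟩ := exists_near hb.symm ha.symm hba hq1 (.inr (hG.mem_arc ha)) na
  have az := hG.turn_add hb ha hd hba hbd had hz.1 hqU
  have ay := hG.turn_add hb ha hd hba hbd had hy.1 hqU
  have ax := hG.turn_add hb ha hd hba hbd had hx.1 hqU
  have k1 : D.turn o a d (g b) q = 0 := (turn_eq_zero_iff ha.symm hd.symm had h'.left hq2).2 h'
  have k2 : D.turn o b a (g d) q = 0 :=
    (turn_eq_zero_iff hb.symm ha.symm hba (hb_a ▸ h.right) hq1).2 (hb_a ▸ h.symm)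
  rw [← turn_eq_of_same ha.symm hd.symm had hz.2 hq2, k1, add_zero] at az
  rw [← turn_eq_of_same hb.symm ha.symm hba hy.2 hq1, k2, zero_add] at ay
  rw [← turn_eq_of_same hb.symm hd.symm hbd hx.2 hq3, h0] at ax
  have z3 : z ∉ D.tri o b d := hG.notMem_tri_of hb hd hbd hz.1 (fun h => hz' (.inl (.inl h)))
    (fun h => Same.right hz.2 (.inr h))
  have y3 : y ∉ D.tri o b d := hG.notMem_tri_of hb hd hbd hy.1
    (fun h => Same.right hy.2 (.inl (.inl h))) (fun h => hy' (.inr h))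
  have x2 : x ∉ D.tri o a d := hG.notMem_tri_of ha hd had hx.1 (fun h => hx' (.inr h))
    (fun h => Same.right hx.2 (.inr h))
  have f1 := turn_eq hb.symm hd.symm hbd z3 y3 hq3 (az ▸ hz0) (ay ▸ hy0)
  have f2 := turn_eq hb.symm ha.symm hba hx' hz' hq1 hx0 hz0
  have f3 : D.turn o a d x q ≠ 0 := fun hn => hx0 (by linear_combination ax - hn)
  have f4 := turn_eq ha.symm hd.symm had x2 hy' hq2 f3 hy0
  exact hx0 (by linear_combination (ax - f4 - ay + f2 + az + f1) / 2)

end Drawing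

/-- Away from a set meeting an arc in at most its first point and one other point, the points of
the arc are connected to its last point or to its germ at the first point. -/
theorem IsArc.same_or_germ {A T : Set ℂ} {a b s x : ℂ} (hA : IsArc A a b) (ha : a ∈ T)
    (hs : ∀ z ∈ A, z ∈ T → z = a ∨ z = s) (hx : x ∈ A) (hxT : x ∉ T) :
    Same T x b ∨ ∃ N ∈ 𝓝 a, ∀ y ∈ A, y ∈ N → y ≠ a → Same T x y := by
  have hxa : x ≠ a := fun h => hxT (h ▸ ha)
  by_cases h1 : s = b
  · subst h1
    refine .inr ⟨{s}ᶜ, isClosed_singleton.isOpen_compl.mem_nhds hA.ne, fun y hy hyN hya => ?_⟩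
    have hm : ∀ z ∈ A, z ≠ a → z ≠ s → z ∈ A \ {a, s} := fun z hz h1 h2 => ⟨hz, by simp [h1, h2]⟩
    by_cases hxs : x = s
    · have hd : Disjoint (A \ {a}) T := disjoint_left.2 fun z hz hzT =>
        hxT (hxs ▸ (hs z hz.1 hzT).resolve_left hz.2 ▸ hzT)
      exact same_of_isPreconnected hA.isPreconnected_diff_left hd ⟨hx, hxa⟩ ⟨hy, hya⟩
    · exact same_of_isPreconnected hA.isPreconnected_diff_pair
        (disjoint_left.2 fun z hz hzT => hz.2 (hs z hz.1 hzT)) (hm x hx hxa hxs) (hm y hy hya hyN)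
  by_cases h2 : s ∈ A ∧ s ≠ a ∧ s ∈ T
  · obtain ⟨P, Q, hP, hQ, rfl, hi⟩ := hA.exists_split h2.1 h2.2.1 h1
    have haQ : a ∉ Q := fun h => h2.2.1 (by
      have : a ∈ P ∩ Q := ⟨hP.left_mem, h⟩
      rw [hi] at this; exact this.symm)
    have hxs : x ≠ s := fun h => hxT (h ▸ h2.2.2)
    rcases hx with hx | hx
    · refine .inr ⟨Qᶜ, hQ.isClosed.isOpen_compl.mem_nhds haQ, fun y hy hyN hya => ?_⟩
      refine same_of_isPreconnected hP.isPreconnected_diff_pair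
        (disjoint_left.2 fun z hz hzT => hz.2 (hs z (.inl hz.1) hzT)) ⟨hx, by simp [hxa, hxs]⟩
        ⟨hy.resolve_right hyN, ?_⟩
      rintro (h | h)
      exacts [hya h, hyN (h ▸ hQ.left_mem)]
    · refine .inl (same_of_isPreconnected hQ.isPreconnected_diff_left
        (disjoint_left.2 fun z hz hzT => ?_) ⟨hx, hxs⟩ ⟨hQ.right_mem, hQ.ne.symm⟩)
      exact (hs z (.inr hz.1) hzT).elim (fun h => haQ (h ▸ hz.1)) hz.2
  · refine .inl (same_of_isPreconnected hA.isPreconnected_diff_left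
      (disjoint_left.2 fun z hz hzT => ?_) ⟨hx, hxa⟩ ⟨hA.right_mem, hA.ne.symm⟩)
    have := (hs z hz.1 hzT).resolve_left hz.2
    subst this
    exact h2 ⟨hz.1, hz.2, hzT⟩

theorem IsArc.same_or_same {A T : Set ℂ} {a b s x : ℂ} (hA : IsArc A a b) (ha : a ∉ T)
    (hb : b ∉ T) (hs : ∀ z ∈ A, z ∈ T → z = s) (hx : x ∈ A) (hxT : x ∉ T) :
    Same T x a ∨ Same T x b := by
  by_cases h : s ∈ A ∧ s ∈ T
  · obtain ⟨P, Q, hP, hQ, rfl, -⟩ := hA.exists_split h.1 (fun e => ha (e ▸ h.2))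
      (fun e => hb (e ▸ h.2))
    have hxs : x ≠ s := fun e => hxT (e ▸ h.2)
    rcases hx with hx | hx
    · exact .inl (same_of_isPreconnected hP.isPreconnected_diff_right
        (disjoint_left.2 fun z hz hzT => hz.2 (hs z (.inl hz.1) hzT)) ⟨hx, hxs⟩
        ⟨hP.left_mem, hP.ne⟩)
    · exact .inr (same_of_isPreconnected hQ.isPreconnected_diff_left
        (disjoint_left.2 fun z hz hzT => hz.2 (hs z (.inr hz.1) hzT)) ⟨hx, hxs⟩
        ⟨hQ.right_mem, hQ.ne.symm⟩)
  · refine .inl (same_of_isPreconnected hA.isPreconnected (disjoint_left.2 fun z hz hzT => ?_) hx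
      hA.left_mem)
    have := hs z hz hzT
    subst this
    exact h ⟨hz, hzT⟩

namespace Drawing

variable {V : Type*} {D : Drawing V} {o u y w : V} {U : Set ℂ} {g : V → ℂ} {r q : ℂ} {C : Set ℂ}

theorem Germ.not_sep_of_same (hG : D.Germ o U g) (hwo : w ≠ o) (huo : u ≠ o) (hwu : w ≠ u)
    {P R Q : Set ℂ} (hP : IsArc P (D.vert o) r) (hR : IsArc R r (D.vert w))
    (hPR : P ∪ R = D.arc o w) (hPR' : P ∩ R = {r}) (hQ : IsArc Q (D.vert u) r)
    (ho : D.vert o ∉ Q) (hL : Loop (D.arc o u ∪ Q) P (D.vert o) r)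
    (hC : ∀ x ∈ C, Same (D.arc o u ∪ Q ∪ P) x q) :
    Disjoint C (D.arc o u) ∧ ∀ c d, c ≠ o → c ≠ w → c ≠ u → d ≠ o → d ≠ w → d ≠ u →
      D.vert o ∈ closure (C ∩ D.arc o c) → D.vert o ∈ closure (C ∩ D.arc o d) →
      ¬ D.Sep o g w u c d := by
  refine ⟨disjoint_left.2 fun x hx h => (hC x hx).left (.inl (.inl h)), ?_⟩
  intro c d hco hcw hcu hdo hdw hdu hc hd
  rw [Sep, not_not]
  have hK : IsClosed (D.arc u w ∪ R ∪ Q) :=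
    ((D.isArc hwu.symm).isClosed.union hR.isClosed).union hQ.isClosed
  have hoK : D.vert o ∉ D.arc u w ∪ R ∪ Q := by
    rintro ((h | h) | h)
    · exact Drawing.notMem_arc hwu.symm huo.symm hwo.symm h
    · have : D.vert o ∈ P ∩ R := ⟨hP.left_mem, h⟩
      rw [hPR'] at this
      exact hP.ne this
    · exact ho h
  obtain ⟨ε, hε, hb⟩ := Metric.isOpen_iff.1 hK.isOpen_compl _ hoK
  have hN : U ∩ Metric.ball (D.vert o) ε ∈ 𝓝 (D.vert o) :=
    Filter.inter_mem (hG.isOpen.mem_nhds hG.mem) (Metric.ball_mem_nhds _ hε)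
  obtain ⟨p, ⟨hpU, hpB⟩, hpC, hpc⟩ := mem_closure_iff_nhds.1 hc _ hN
  obtain ⟨p', ⟨hpU', hpB'⟩, hpC', hpd⟩ := mem_closure_iff_nhds.1 hd _ hN
  have hne : ∀ x ∈ C, x ≠ D.vert o := fun x hx h => (hC x hx).left (.inr (h ▸ hP.left_mem))
  have s1 := hG.same hwo huo hco hwu hcw hcu hpc hpU (hne p hpC)
  have s2 := hG.same hwo huo hdo hwu hdw hdu hpd hpU' (hne p' hpC')
  refine s1.symm.trans (Same.trans ?_ s2)
  have hp := s1.left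
  have hp' := s2.left
  obtain ⟨k, hk⟩ := (same_of_isPreconnected Metric.isPreconnected_ball
    (subset_compl_iff_disjoint_right.1 hb) hpB hpB').exists_potential hK
  have hs := (hC p hpC).trans (hC p' hpC').symm
  have hw0 := hL.wind_eq_zero hs
  have hs1 := hs.left
  have hs2 := hs.right
  simp only [mem_union, not_or] at hs1 hs2
  rw [wind, dlog_union (D.isArc huo.symm) hQ hL.fst (by simp [hs1]) (by simp [hs2]),
    hk Q _ _ hQ subset_union_right] at hw0
  have h1 := dlog_union hP hR (hPR ▸ D.isArc hwo.symm : IsArc (P ∪ R) _ _) (p := p) (q := p')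
    (fun h => hp (.inl (.inl (hPR ▸ h)))) (fun h => hp' (.inl (.inl (hPR ▸ h))))
  rw [hPR, hk R _ _ hR (subset_union_right.trans subset_union_left)] at h1
  rw [← turn_eq_zero_iff hwo.symm huo.symm hwu hp hp', turn, h1, D.arc_symm w u,
    dlog_swap _ (D.vert u) (D.vert w), hk _ _ _ (D.isArc hwu.symm)
      (subset_union_left.trans subset_union_left), D.arc_symm u o, dlog_swap _ (D.vert o)]
  linear_combination -hw0

/-- A connected set avoiding the edge `ow` (but for `w`), which meets the opposite edge of the
triangle on `o`, `u`, `y`, and lying on the side of the germ of `ow`, cannot surround `ow`. -/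
theorem Germ.cut (hG : D.Germ o U g) (huo : u ≠ o) (hyo : y ≠ o) (hwo : w ≠ o) (huy : u ≠ y)
    (hwu : w ≠ u) (hwy : w ≠ y) (hr : r ∈ D.arc u y) (hr' : r ∈ D.arc o w)
    (hq : q ∉ D.tri o u y) (hqw : ¬ Same (D.tri o u y) q (g w)) (hC : IsPreconnected C)
    (hCw : ∀ x ∈ C, x ∈ D.arc o w → x = D.vert w) (hCq : ∀ x ∈ C, ¬ Same (D.tri o u y) q x) :
    (Disjoint C (D.arc o u) ∧ ∀ c d, c ≠ o → c ≠ w → c ≠ u → d ≠ o → d ≠ w → d ≠ u →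
      D.vert o ∈ closure (C ∩ D.arc o c) → D.vert o ∈ closure (C ∩ D.arc o d) →
      ¬ D.Sep o g w u c d) ∨
    (Disjoint C (D.arc o y) ∧ ∀ c d, c ≠ o → c ≠ w → c ≠ y → d ≠ o → d ≠ w → d ≠ y →
      D.vert o ∈ closure (C ∩ D.arc o c) → D.vert o ∈ closure (C ∩ D.arc o d) →
      ¬ D.Sep o g w y c d) := by
  have hou : D.vert o ∉ D.arc u y := Drawing.notMem_arc huy huo.symm hyo.symm
  have hro : r ≠ D.vert o := fun h => hou (h ▸ hr)
  have hrw : r ≠ D.vert w := fun h => Drawing.notMem_arc huy hwu hwy (h ▸ hr)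
  have hru : r ≠ D.vert u := fun h => Drawing.notMem_arc hwo.symm huo hwu.symm (h ▸ hr')
  have hry : r ≠ D.vert y := fun h => Drawing.notMem_arc hwo.symm hyo hwy.symm (h ▸ hr')
  have hsub : ∀ z, z ∈ D.arc u y → z ∈ D.arc o w → z = r := fun z h1 h2 =>
    D.inter huy hwo.symm (by simp only [ne_eq, Sym2.eq_iff]; tauto) ⟨h1, h2⟩ ⟨hr, hr'⟩
  obtain ⟨P, R, hP, hR, hPR, hPR'⟩ := (D.isArc hwo.symm).exists_split hr' hro hrw
  obtain ⟨Q, Q', hQ, hQ', hQQ, hQQ'⟩ := (D.isArc huy).exists_split hr hru hry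
  have qs : ∀ z, z ∈ Q → z ∈ D.arc u y := fun z hz => hQQ ▸ .inl hz
  have qs' : ∀ z, z ∈ Q' → z ∈ D.arc u y := fun z hz => hQQ ▸ .inr hz
  have ps : ∀ z, z ∈ P → z ∈ D.arc o w := fun z hz => hPR ▸ .inl hz
  have huQ : D.vert u ∉ Q' := fun h => hru (by
    have : D.vert u ∈ Q ∩ Q' := ⟨hQ.left_mem, h⟩
    rw [hQQ'] at this; exact this.symm)
  have hyQ : D.vert y ∉ Q := fun h => hry (by
    have : D.vert y ∈ Q ∩ Q' := ⟨h, hQ'.right_mem⟩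
    rw [hQQ'] at this; exact this.symm)
  have hwP : D.vert w ∉ P := fun h => hrw (by
    have : D.vert w ∈ P ∩ R := ⟨h, hR.right_mem⟩
    rw [hPR'] at this; exact this.symm)
  have i1 : ∀ z, z ∈ D.arc o u → z ∈ D.arc u y → z = D.vert u := fun z h1 h2 =>
    eq_vert huo huy hyo.symm (D.arc_symm o u ▸ h1) h2
  have i2 : ∀ z, z ∈ D.arc o y → z ∈ D.arc u y → z = D.vert y := fun z h1 h2 =>
    eq_vert hyo huy.symm huo.symm (D.arc_symm o y ▸ h1) (D.arc_symm u y ▸ h2)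
  have a1 : IsArc (D.arc o u ∪ Q) (D.vert o) r := (D.isArc huo.symm).trans hQ <| by
    ext z
    exact ⟨fun h => i1 z h.1 (qs z h.2), fun h => h ▸ ⟨right_mem huo.symm, hQ.left_mem⟩⟩
  have a2 : IsArc (D.arc o y ∪ Q') (D.vert o) r := (D.isArc hyo.symm).trans hQ'.symm <| by
    ext z
    exact ⟨fun h => i2 z h.1 (qs' z h.2), fun h => h ▸ ⟨right_mem hyo.symm, hQ'.right_mem⟩⟩
  have hTh : Theta (D.arc o u ∪ Q) (D.arc o y ∪ Q') P (D.vert o) r := by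
    refine ⟨⟨a1, a2, ?_⟩, ⟨a1, hP, ?_⟩, ⟨a2, hP, ?_⟩⟩
    · ext z
      constructor
      · rintro ⟨h1 | h1, h2 | h2⟩
        · exact .inl (eq_vert huo.symm hyo.symm huy h1 h2)
        · exact absurd (i1 z h1 (qs' z h2) ▸ h2) huQ
        · exact absurd (i2 z h2 (qs z h1) ▸ h1) hyQ
        · have : z ∈ Q ∩ Q' := ⟨h1, h2⟩
          rw [hQQ'] at this
          exact .inr this
      · rintro (h | h) <;> rw [h]
        exacts [⟨a1.left_mem, a2.left_mem⟩, ⟨a1.right_mem, a2.right_mem⟩]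
    · ext z
      constructor
      · rintro ⟨h1 | h1, h2⟩
        · exact .inl (eq_vert huo.symm hwo.symm hwu.symm h1 (ps z h2))
        · exact .inr (hsub z (qs z h1) (ps z h2))
      · rintro (h | h) <;> rw [h]
        exacts [⟨a1.left_mem, hP.left_mem⟩, ⟨a1.right_mem, hP.right_mem⟩]
    · ext z
      constructor
      · rintro ⟨h1 | h1, h2⟩
        · exact .inl (eq_vert hyo.symm hwo.symm hwy.symm h1 (ps z h2))
        · exact .inr (hsub z (qs' z h1) (ps z h2))
      · rintro (h | h) <;> rw [h]
        exacts [⟨a2.left_mem, hP.left_mem⟩, ⟨a2.right_mem, hP.right_mem⟩]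
  have hT : D.tri o u y = D.arc o u ∪ Q ∪ (D.arc o y ∪ Q') := by
    rw [tri, ← hQQ]; ext; simp only [mem_union]; tauto
  have hPT : ∀ z ∈ P, z ∈ D.tri o u y → z = D.vert o ∨ z = r := by
    rintro z hz ((h | h) | h)
    · exact .inl (eq_vert huo.symm hwo.symm hwu.symm h (ps z hz))
    · exact .inr (hsub z h (ps z hz))
    · exact .inl (eq_vert hyo.symm hwo.symm hwy.symm h (ps z hz))
  have hPq : ∀ x ∈ P, ¬ Same (D.arc o u ∪ Q ∪ (D.arc o y ∪ Q')) q x := by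
    rw [← hT]
    intro x hx hs
    obtain ⟨z, hzU, hzP⟩ := mem_closure_iff_nhds.1 (hP.subset_closure_diff_pair hP.left_mem) _
      (hG.isOpen.mem_nhds hG.mem)
    have h1 : Same (D.tri o u y) x z := same_of_isPreconnected hP.isPreconnected_diff_pair
      (disjoint_left.2 fun z hz hzT => hz.2 (hPT z hz.1 hzT)) ⟨hx, by
        rintro (h | h)
        · exact hs.right (h ▸ .inl (.inl (left_mem huo.symm)))
        · exact hs.right (h ▸ .inl (.inr hr))⟩ hzP
    exact hqw (hs.trans (h1.trans (hG.same huo hyo hwo huy hwu hwy (ps z hzP.1) hzU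
      fun h => hzP.2 (.inl h))))
  rw [hT] at hq hCq
  have hCP : Disjoint C P := disjoint_left.2 fun x hx hxP => hwP (hCw x hx (ps x hxP) ▸ hxP)
  refine (hTh.same_or_same hq hPq hC hCP hCq).imp (fun h => ?_) fun h => ?_
  · exact hG.not_sep_of_same hwo huo hwu hP hR hPR hPR' hQ (fun h => hou (qs _ h)) hTh.l13 h
  · exact hG.not_sep_of_same hwo hyo hwy hP hR hPR hPR' hQ'.symm (fun h => hou (qs' _ h)) hTh.l23 h

end Drawing

namespace Drawing

variable {V : Type*} {D : Drawing V} {o u y w : V} {U : Set ℂ} {g : V → ℂ} {p : ℂ}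

/-- The side of `p` of the triangle on `a`, `b`, `c` contains every edge whose endpoints it
contains. -/
def ConvexSide (D : Drawing V) (a b c : V) (p : ℂ) : Prop :=
  ∀ i j, i ≠ j → (D.vert i ∈ D.tri a b c ∨ Same (D.tri a b c) p (D.vert i)) →
    (D.vert j ∈ D.tri a b c ∨ Same (D.tri a b c) p (D.vert j)) →
    ∀ x ∈ D.arc i j, x ∈ D.tri a b c ∨ Same (D.tri a b c) p x

/-- Every triangle has a convex side. -/
def Convex (D : Drawing V) : Prop :=
  ∀ a b c, a ≠ b → b ≠ c → a ≠ c → ∃ p, p ∉ D.tri a b c ∧ D.ConvexSide a b c p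

theorem ConvexSide.of_same {a b c : V} {q : ℂ} (h : D.ConvexSide a b c p)
    (hs : Same (D.tri a b c) q p) : D.ConvexSide a b c q := by
  intro i j hij hi hj x hx
  exact (h i j hij (hi.imp_right hs.symm.trans) (hj.imp_right hs.symm.trans) x hx).imp_right
    hs.trans

theorem exists_forall_eq {S : Set ℂ} (h : S.Subsingleton) : ∃ s, ∀ z ∈ S, z = s := by
  rcases S.eq_empty_or_nonempty with rfl | ⟨s, hs⟩
  exacts [⟨0, by simp⟩, ⟨s, fun z hz => h hz hs⟩]

theorem vert_mem_tri_fst {a b c : V} (h : a ≠ b) : D.vert a ∈ D.tri a b c :=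
  .inl (.inl (left_mem h))

theorem vert_mem_tri_snd {a b c : V} (h : a ≠ b) : D.vert b ∈ D.tri a b c :=
  .inl (.inl (right_mem h))

theorem vert_mem_tri_thd {a b c : V} (h : a ≠ c) : D.vert c ∈ D.tri a b c :=
  .inr (right_mem h)

/-- A side of a triangle `o`, `u`, `y` containing a vertex `z` such that `oz` meets the edge `uy`
is not convex. -/
theorem Germ.not_convexSide (hG : D.Germ o U g) {z : V} (huo : u ≠ o) (hyo : y ≠ o) (hzo : z ≠ o)
    (huy : u ≠ y) (hzu : z ≠ u) (hzy : z ≠ y) (hr : (D.arc u y ∩ D.arc o z).Nonempty)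
    (hp : Same (D.tri o u y) p (D.vert z)) : ¬ D.ConvexSide o u y p := by
  intro hc
  obtain ⟨r, hr, hr'⟩ := hr
  have hgz : Same (D.tri o u y) p (g z) :=
    (hc o z hzo.symm (.inl (vert_mem_tri_fst huo.symm)) (.inr hp) _ (hG.mem_arc hzo)).resolve_left
      (hG.notMem_tri huo hyo hzo huy hzu hzy)
  obtain ⟨q, hqT, hqp⟩ : ∃ q, q ∉ D.tri o u y ∧ ¬ Same (D.tri o u y) q p := by
    obtain ⟨s, t, hs, ht, hst⟩ := (twoSided_tri huo.symm hyo.symm huy).exists_not_same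
    by_cases h : Same (D.tri o u y) s p
    · exact ⟨t, ht, fun h' => hst (h.trans h'.symm)⟩
    · exact ⟨s, hs, h⟩
  have hC : IsPreconnected (D.arc z u ∪ D.arc z y) :=
    (D.isArc hzu).isPreconnected.union (D.vert z) (left_mem hzu) (left_mem hzy)
      (D.isArc hzy).isPreconnected
  have h := hG.cut huo hyo hzo huy hzu hzy hr hr' hqT (fun h => hqp (h.trans hgz.symm)) hC
    (by
      rw [D.arc_symm o z]
      rintro x (hx | hx) h
      exacts [eq_vert hzu hzo huo hx h, eq_vert hzy hzo hyo hx h])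
    (by
      have hw : ∀ x, (x ∈ D.tri o u y ∨ Same (D.tri o u y) p x) → ¬ Same (D.tri o u y) q x :=
        fun x hx hs => hx.elim hs.right fun h => hqp (hs.trans h.symm)
      rintro x (hx | hx)
      · exact hw x (hc z u hzu (.inr hp) (.inl (vert_mem_tri_snd huo.symm)) x hx)
      · exact hw x (hc z y hzy (.inr hp) (.inl (vert_mem_tri_thd hyo.symm)) x hx))
  rcases h with ⟨h, -⟩ | ⟨h, -⟩
  · exact disjoint_left.1 h (.inl (right_mem hzu)) (right_mem huo.symm)
  · exact disjoint_left.1 h (.inr (right_mem hzy)) (right_mem hyo.symm)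

/-- A point of an initial piece of a star edge `ox`, off a triangle at `o`, lies on the side of
the endpoint or of the germ of `ox`. -/
theorem Germ.same_or_same (hG : D.Germ o U g) {x : V} {A : Set ℂ} {b z : ℂ} (huo : u ≠ o)
    (hyo : y ≠ o) (hxo : x ≠ o) (huy : u ≠ y) (hxu : x ≠ u) (hxy : x ≠ y)
    (hA : IsArc A (D.vert o) b) (hAx : A ⊆ D.arc o x) (hz : z ∈ A) (hzT : z ∉ D.tri o u y) :
    Same (D.tri o u y) z b ∨ Same (D.tri o u y) z (g x) := by
  obtain ⟨s, hs⟩ := exists_forall_eq (D.inter huy hxo.symm (k := o) (l := x)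
    (by simp only [ne_eq, Sym2.eq_iff]; tauto))
  refine (hA.same_or_germ (s := s) (vert_mem_tri_fst huo.symm) ?_ hz hzT).imp_right ?_
  · rintro t ht ((h | h) | h)
    · exact .inl (eq_vert huo.symm hxo.symm hxu.symm h (hAx ht))
    · exact .inr (hs t ⟨h, hAx ht⟩)
    · exact .inl (eq_vert hyo.symm hxo.symm hxy.symm h (hAx ht))
  · rintro ⟨N, hN, h⟩
    obtain ⟨t, ⟨htN, htU⟩, ht⟩ := mem_closure_iff_nhds.1 (hA.subset_closure_diff_pair hA.left_mem) _
      (Filter.inter_mem hN (hG.isOpen.mem_nhds hG.mem))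
    have hto : t ≠ D.vert o := fun h => ht.2 (.inl h)
    exact (h t ht.1 htN hto).trans (hG.same huo hyo hxo huy hxu hxy (hAx ht.1) htU hto)

theorem mem_closure_of_diff_subset {x : V} {C : Set ℂ} (hxo : x ≠ o)
    (hC : D.arc o x \ {D.vert o} ⊆ C) : D.vert o ∈ closure (C ∩ D.arc o x) := by
  have h : D.arc o x \ {D.vert o, D.vert x} ⊆ C ∩ D.arc o x := fun z hz =>
    ⟨hC ⟨hz.1, fun h => hz.2 (.inl h)⟩, hz.1⟩
  exact closure_mono h ((D.isArc hxo.symm).subset_closure_diff_pair (left_mem hxo.symm))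

/-- If the star edge `ow` meets `uy`, and `w` has two neighbours in the rotation whose edges to `w`
avoid the other star edges, then `w` and the germ of `ow` lie on different sides of `ouy`. -/
theorem Germ.not_same_of_neighbors (hG : D.Germ o U g) (hD : D.Convex) {x₁ x₂ : V} (huo : u ≠ o)
    (hyo : y ≠ o) (hwo : w ≠ o) (huy : u ≠ y) (hwu : w ≠ u) (hwy : w ≠ y)
    (hr : (D.arc u y ∩ D.arc o w).Nonempty) (hx : ∀ x, x = x₁ ∨ x = x₂ → x ≠ o ∧ x ≠ w ∧
      (∀ c, c ≠ o → c ≠ w → c ≠ x → Disjoint (D.arc x w) (D.arc o c)) ∧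
      (x ≠ u → x ≠ y → ¬ D.Sep o g u y w x))
    (hsep : ∀ t, t = u ∨ t = y → t ≠ x₁ → t ≠ x₂ → D.Sep o g w t x₁ x₂) :
    ¬ Same (D.tri o u y) (g w) (D.vert w) := by
  intro hs
  obtain ⟨q, hqT, hq⟩ := hD o u y huo.symm huy hyo.symm
  have hqw : ¬ Same (D.tri o u y) q (g w) := fun h =>
    hG.not_convexSide huo hyo hwo huy hwu hwy hr (h.trans hs) hq
  have ho : D.vert o ∈ D.tri o u y := vert_mem_tri_fst huo.symm
  have key : ∀ x, x = x₁ ∨ x = x₂ → (∀ z ∈ D.arc x w, ¬ Same (D.tri o u y) q z) ∧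
      ∀ z ∈ D.arc o x, ¬ Same (D.tri o u y) q z := by
    intro x hxx
    obtain ⟨hxo, hxw, hd, hns⟩ := hx x hxx
    by_cases hxu : x = u
    · subst hxu
      refine ⟨fun z hz hqz => ?_, fun z hz hqz => hqz.right (.inl (.inl hz))⟩
      have h1 : Disjoint (D.arc x w \ {D.vert x}) (D.tri o x y) := by
        refine disjoint_left.2 ?_
        rintro t ⟨ht, htx⟩ ((h | h) | h)
        · exact htx (eq_vert hxw hxo hwo ht (D.arc_symm o x ▸ h))
        · exact htx (eq_vert hxw huy hwy ht h)
        · exact disjoint_left.1 (hd y hyo hwy.symm huy.symm) ht h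
      refine hqw (hqz.trans ((same_of_isPreconnected (D.isArc hxw).isPreconnected_diff_left h1
        ⟨hz, ?_⟩ ⟨right_mem hxw, (D.isArc hxw).ne.symm⟩).trans hs.symm))
      rintro rfl
      exact hqz.right (vert_mem_tri_snd huo.symm)
    by_cases hxy : x = y
    · subst hxy
      refine ⟨fun z hz hqz => ?_, fun z hz hqz => hqz.right (.inr hz)⟩
      have h1 : Disjoint (D.arc x w \ {D.vert x}) (D.tri o u x) := by
        refine disjoint_left.2 ?_
        rintro t ⟨ht, htx⟩ ((h | h) | h)
        · exact disjoint_left.1 (hd u huo hwu.symm huy) ht h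
        · exact htx (eq_vert hxw huy.symm hwu ht (D.arc_symm u x ▸ h))
        · exact htx (eq_vert hxw hxo hwo ht (D.arc_symm o x ▸ h))
      refine hqw (hqz.trans ((same_of_isPreconnected (D.isArc hxw).isPreconnected_diff_left h1
        ⟨hz, ?_⟩ ⟨right_mem hxw, (D.isArc hxw).ne.symm⟩).trans hs.symm))
      rintro rfl
      exact hqz.right (vert_mem_tri_thd hyo.symm)
    have hxT : D.vert x ∉ D.tri o u y :=
      Drawing.notMem_tri huo.symm hyo.symm huy hxo hxu hxy
    have hgx : Same (D.tri o u y) (g w) (g x) := not_not.1 (hns hxu hxy)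
    have hqx : ¬ Same (D.tri o u y) q (D.vert x) := fun h => by
      have := (hq o x hxo.symm (.inl ho) (.inr h) _ (hG.mem_arc hxo)).resolve_left hgx.right
      exact hqw (this.trans hgx.symm)
    constructor
    · intro z hz hqz
      obtain ⟨s, hs'⟩ := exists_forall_eq (D.inter huy hxw (k := x) (l := w)
        (by simp only [ne_eq, Sym2.eq_iff]; tauto))
      rcases (D.isArc hxw).same_or_same (s := s) hxT hs.right (by
        rintro t ht ((h | h) | h)
        · exact absurd h (disjoint_left.1 (hd u huo hwu.symm (Ne.symm hxu)) ht)
        · exact hs' t ⟨h, ht⟩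
        · exact absurd h (disjoint_left.1 (hd y hyo hwy.symm (Ne.symm hxy)) ht)) hz hqz.right
        with h | h
      · exact hqx (hqz.trans h)
      · exact hqw (hqz.trans (h.trans hs.symm))
    · intro z hz hqz
      rcases hG.same_or_same huo hyo hxo huy hxu hxy (D.isArc hxo.symm) subset_rfl hz hqz.right
        with h | h
      · exact hqx (hqz.trans h)
      · exact hqw (hqz.trans (h.trans hgx.symm))
  obtain ⟨hx1o, hx1w, -, -⟩ := hx x₁ (.inl rfl)
  obtain ⟨hx2o, hx2w, -, -⟩ := hx x₂ (.inr rfl)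
  obtain ⟨k1, k2⟩ := key x₁ (.inl rfl)
  obtain ⟨k3, k4⟩ := key x₂ (.inr rfl)
  obtain ⟨r, hr, hr'⟩ := hr
  have c1 : ∀ x, x ≠ o → x ≠ w → IsPreconnected (D.arc x w ∪ D.arc o x \ {D.vert o}) := fun x h1 h2 =>
    (D.isArc h2).isPreconnected.union (D.vert x) (left_mem h2)
      ⟨right_mem h1.symm, (D.isArc h1).ne⟩ (D.isArc h1.symm).isPreconnected_diff_left
  have hC := (c1 x₁ hx1o hx1w).union (D.vert w) (.inl (right_mem hx1w)) (.inl (right_mem hx2w))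
    (c1 x₂ hx2o hx2w)
  have c2 : ∀ x, x ≠ o → x ≠ w → ∀ z ∈ D.arc x w ∪ D.arc o x \ {D.vert o}, z ∈ D.arc o w →
      z = D.vert w := by
    rintro x h1 h2 z (h | h) h'
    · exact eq_vert h2.symm hwo h1 (D.arc_symm x w ▸ h) (D.arc_symm o w ▸ h')
    · exact absurd (eq_vert h1.symm hwo.symm h2 h.1 h') h.2
  have n1 : D.vert o ∈ closure ((D.arc x₁ w ∪ D.arc o x₁ \ {D.vert o} ∪
      (D.arc x₂ w ∪ D.arc o x₂ \ {D.vert o})) ∩ D.arc o x₁) :=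
    mem_closure_of_diff_subset hx1o fun z hz => .inl (.inr hz)
  have n2 : D.vert o ∈ closure ((D.arc x₁ w ∪ D.arc o x₁ \ {D.vert o} ∪
      (D.arc x₂ w ∪ D.arc o x₂ \ {D.vert o})) ∩ D.arc o x₂) :=
    mem_closure_of_diff_subset hx2o fun z hz => .inr (.inr hz)
  rcases hG.cut huo hyo hwo huy hwu hwy hr hr' hqT hqw hC
    (fun z hz => hz.elim (c2 x₁ hx1o hx1w z) (c2 x₂ hx2o hx2w z))
    (fun z hz => hz.elim (fun h => h.elim (k1 z) fun h => k2 z h.1)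
      fun h => h.elim (k3 z) fun h => k4 z h.1) with ⟨hd, h⟩ | ⟨hd, h⟩
  · have h1 : u ≠ x₁ := by
      rintro rfl
      exact disjoint_left.1 hd (.inl (.inl (left_mem hx1w))) (right_mem huo.symm)
    have h2 : u ≠ x₂ := by
      rintro rfl
      exact disjoint_left.1 hd (.inr (.inl (left_mem hx2w))) (right_mem huo.symm)
    exact h x₁ x₂ hx1o hx1w h1.symm hx2o hx2w h2.symm n1 n2 (hsep u (.inl rfl) h1 h2)
  · have h1 : y ≠ x₁ := by
      rintro rfl
      exact disjoint_left.1 hd (.inl (.inl (left_mem hx1w))) (right_mem hyo.symm)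
    have h2 : y ≠ x₂ := by
      rintro rfl
      exact disjoint_left.1 hd (.inr (.inl (left_mem hx2w))) (right_mem hyo.symm)
    exact h x₁ x₂ hx1o hx1w h1.symm hx2o hx2w h2.symm n1 n2 (hsep y (.inr rfl) h1 h2)

end Drawing

theorem IsArc.exists_subarc {A : Set ℂ} {a b r : ℂ} (hA : IsArc A a b) (hr : r ∈ A) (hra : r ≠ a) :
    ∃ B, IsArc B a r ∧ B ⊆ A := by
  by_cases hrb : r = b
  · exact ⟨A, hrb ▸ hA, subset_rfl⟩
  · obtain ⟨P, Q, hP, -, rfl, -⟩ := hA.exists_split hr hra hrb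
    exact ⟨P, hP, subset_union_left⟩

namespace Drawing

variable {V : Type*} {D : Drawing V} {o u y w : V} {U : Set ℂ} {g : V → ℂ} {p : ℂ}

/-- In a convex drawing where the star edge `ow` meets `vv'`, an edge `uy` whose endpoints lie
beyond `v'` does not meet a star edge `oz` on the other side of `v'`. -/
theorem Germ.not_crosses (hG : D.Germ o U g) (hD : D.Convex) {v v' x₁ x₂ z : V}
    (hvo : v ≠ o) (hvo' : v' ≠ o) (hwo : w ≠ o) (hvv : v ≠ v') (hwv : w ≠ v) (hwv' : w ≠ v')
    (hc : (D.arc v v' ∩ D.arc o w).Nonempty)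
    (hx : ∀ x, x = x₁ ∨ x = x₂ → x ≠ o ∧ x ≠ w ∧
      ∀ c, c ≠ o → c ≠ w → c ≠ x → Disjoint (D.arc x w) (D.arc o c))
    (huo : u ≠ o) (hyo : y ≠ o) (huy : u ≠ y) (huv : u ≠ v) (huw : u ≠ w) (hyv : y ≠ v)
    (hyw : y ≠ w) (ht : ∀ t, t = u ∨ t = y → t ≠ v' → Disjoint (D.arc v v') (D.arc o t))
    (hzo : z ≠ o) (hzv' : z ≠ v')
    (h1 : ∀ t, t = x₁ ∨ t = x₂ ∨ t = u ∨ t = y ∨ t = z → t ≠ v → t ≠ v' → t ≠ w →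
      ¬ D.Sep o g v v' w t)
    (h2 : ∀ t, t = v ∨ t = v' ∨ t = u ∨ t = y → t ≠ x₁ → t ≠ x₂ → D.Sep o g w t x₁ x₂)
    (h3 : ∀ x, x = x₁ ∨ x = x₂ → x ≠ u → x ≠ y → ¬ D.Sep o g u y w x)
    (h4 : ¬ D.Sep o g u y w v) (h5 : z ≠ v → z ≠ w → D.Sep o g w v u z)
    (h6 : z ≠ w → u ≠ v' → D.Sep o g w v' u z) :
    Disjoint (D.arc u y) (D.arc o z) := by
  rw [disjoint_iff_inter_eq_empty, ← not_nonempty_iff_eq_empty]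
  intro hr
  have hwT : D.vert w ∉ D.tri o v v' :=
    Drawing.notMem_tri hvo.symm hvo'.symm hvv hwo hwv hwv'
  have hgw : g w ∉ D.tri o v v' := hG.notMem_tri hvo hvo' hwo hvv hwv hwv'
  have hoT : D.vert o ∈ D.tri o v v' := vert_mem_tri_fst hvo.symm
  have nS : ¬ Same (D.tri o v v') (g w) (D.vert w) :=
    hG.not_same_of_neighbors hD hvo hvo' hwo hvv hwv hwv' hc
      (fun x h => ⟨(hx x h).1, (hx x h).2.1, (hx x h).2.2, fun hv hv' =>
        h1 x (h.imp_right .inl) hv hv' (hx x h).2.1⟩) (fun t h => h2 t (h.imp_right .inl))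
  have hS : D.ConvexSide o v v' (g w) := by
    obtain ⟨p, hpT, hp⟩ := hD o v v' hvo.symm hvv hvo'.symm
    have hpw : ¬ Same (D.tri o v v') p (D.vert w) := fun h =>
      hG.not_convexSide hvo hvo' hwo hvv hwv hwv' hc h hp
    exact hp.of_same (((twoSided_tri hvo.symm hvo'.symm hvv).same p (D.vert w) (g w) hpT hwT hgw
      hpw fun h => nS h.symm).symm)
  have hvert : ∀ t, t = u ∨ t = y → t ≠ o → t ≠ v → t ≠ w →
      D.vert t ∈ D.tri o v v' ∨ Same (D.tri o v v') (g w) (D.vert t) := by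
    intro t htt hto htv htw
    by_cases htv' : t = v'
    · exact .inl (htv' ▸ vert_mem_tri_thd hto.symm)
    have hd : Disjoint (D.arc o t \ {D.vert o}) (D.tri o v v') := by
      refine disjoint_left.2 ?_
      rintro s ⟨hs, hso⟩ ((h | h) | h)
      · exact hso (eq_vert hto.symm hvo.symm htv hs h)
      · exact disjoint_left.1 (ht t htt htv') h hs
      · exact hso (eq_vert hto.symm hvo'.symm htv' hs h)
    exact .inr ((not_not.1 (h1 t (.inr (.inr (htt.imp_right .inl))) htv htv' htw)).trans
      (same_of_isPreconnected (D.isArc hto.symm).isPreconnected_diff_left hd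
        ⟨hG.mem_arc hto, hG.ne hto⟩ ⟨right_mem hto.symm, (D.isArc hto).ne⟩))
  have hu := hvert u (.inl rfl) huo huv huw
  have hy := hvert y (.inr rfl) hyo hyv hyw
  have e1 := hS u y huy hu hy
  have e2 := hS o u huo.symm (.inl hoT) hu
  have e3 := hS o y hyo.symm (.inl hoT) hy
  have hn : ∀ x, (x ∈ D.tri o v v' ∨ Same (D.tri o v v') (g w) x) →
      ¬ Same (D.tri o v v') (D.vert w) x := fun x hx h =>
    hx.elim h.right fun h' => nS (h'.trans h.symm)
  have hd : Disjoint {x | Same (D.tri o v v') (D.vert w) x} (D.tri o u y) := by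
    refine disjoint_left.2 ?_
    rintro x hx ((h | h) | h)
    exacts [hn x (e2 x h) hx, hn x (e1 x h) hx, hn x (e3 x h) hx]
  have hgv : Same (D.tri o u y) (D.vert w) (g v) := by
    have m1 : g v ∈ closure {x | Same (D.tri o v v') (D.vert w) x} :=
      mem_closure_tri hvo.symm hvo'.symm hvv hwT (.inl (.inl (hG.mem_arc hvo)))
    have m2 : g v ∉ D.tri o u y := hG.notMem_tri huo hyo hvo huy huv.symm hyv.symm
    obtain ⟨t, ht1, ht2⟩ := mem_closure_iff_nhds.1 m1 {x | Same (D.tri o u y) (g v) x}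
      ((isOpen_same (isClosed_tri huo.symm hyo.symm huy) (g v)).mem_nhds (Same.refl m2))
    exact (same_of_isPreconnected (isPreconnected_same _) hd (Same.refl hwT) ht2).trans
      (Same.symm ht1)
  have hgw' : Same (D.tri o u y) (g w) (D.vert w) := (not_not.1 h4).trans hgv.symm
  have hdw : Disjoint (D.arc u y) (D.arc o w) := by
    rw [disjoint_iff_inter_eq_empty, ← not_nonempty_iff_eq_empty]
    exact fun h => hG.not_same_of_neighbors hD huo hyo hwo huy huw.symm hyw.symm h
      (fun x h => ⟨(hx x h).1, (hx x h).2.1, (hx x h).2.2, h3 x h⟩)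
      (fun t h => h2 t (.inr (.inr h))) hgw'
  have hzw : z ≠ w := by
    rintro rfl
    exact not_nonempty_iff_eq_empty.2 (disjoint_iff_inter_eq_empty.1 hdw) hr
  obtain ⟨c, hc, hc'⟩ := hc
  obtain ⟨r, hr, hr'⟩ := hr
  have hro : r ≠ D.vert o := fun h =>
    Drawing.notMem_arc huy huo.symm hyo.symm (h ▸ hr)
  obtain ⟨A, hA, hAz⟩ := IsArc.exists_subarc (D.isArc hzo.symm) hr' hro
  have e4 : ∀ x ∈ A, x ∈ D.tri o v v' ∨ Same (D.tri o v v') (g w) x := by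
    intro x hxA
    by_cases hzv : z = v
    · exact .inl (.inl (.inl (hzv ▸ hAz hxA)))
    by_contra hcon
    rw [not_or] at hcon
    rcases hG.same_or_same hvo hvo' hzo hvv hzv hzv' hA hAz hxA hcon.1 with h | h
    · exact hcon.2 (((e1 r hr).resolve_left h.right).trans h.symm)
    · exact hcon.2 ((not_not.1 (h1 z (.inr (.inr (.inr (.inr rfl)))) hzv hzv' hzw)).trans h.symm)
  have hC : IsPreconnected (D.arc u y ∪ D.arc o u \ {D.vert o} ∪ D.arc o y \ {D.vert o} ∪
      A \ {D.vert o}) := by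
    have k1 := (D.isArc huy).isPreconnected.union (D.vert u) (left_mem huy)
      (t := D.arc o u \ {D.vert o}) ⟨right_mem huo.symm, (D.isArc huo).ne⟩
      (D.isArc huo.symm).isPreconnected_diff_left
    have k2 := k1.union (D.vert y) (.inl (right_mem huy)) (t := D.arc o y \ {D.vert o})
      ⟨right_mem hyo.symm, (D.isArc hyo).ne⟩ (D.isArc hyo.symm).isPreconnected_diff_left
    exact k2.union r (.inl (.inl hr)) ⟨hA.right_mem, hro⟩ hA.isPreconnected_diff_left
  have n1 : D.vert o ∈ closure ((D.arc u y ∪ D.arc o u \ {D.vert o} ∪ D.arc o y \ {D.vert o} ∪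
      A \ {D.vert o}) ∩ D.arc o u) :=
    mem_closure_of_diff_subset huo fun x hx => .inl (.inl (.inr hx))
  have n2 : D.vert o ∈ closure ((D.arc u y ∪ D.arc o u \ {D.vert o} ∪ D.arc o y \ {D.vert o} ∪
      A \ {D.vert o}) ∩ D.arc o z) := by
    have h : A \ {D.vert o, r} ⊆ (D.arc u y ∪ D.arc o u \ {D.vert o} ∪ D.arc o y \ {D.vert o} ∪
        A \ {D.vert o}) ∩ D.arc o z := fun x hx =>
      ⟨.inr ⟨hx.1, fun h => hx.2 (.inl h)⟩, hAz hx.1⟩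
    exact closure_mono h (hA.subset_closure_diff_pair hA.left_mem)
  rcases hG.cut hvo hvo' hwo hvv hwv hwv' hc hc' hwT (fun h => nS h.symm) hC
    (by
      rintro x (((h | h) | h) | h) hxw
      · exact absurd hxw (disjoint_left.1 hdw h)
      · exact absurd (eq_vert huo.symm hwo.symm huw h.1 hxw) h.2
      · exact absurd (eq_vert hyo.symm hwo.symm hyw h.1 hxw) h.2
      · exact absurd (eq_vert hzo.symm hwo.symm hzw (hAz h.1) hxw) h.2)
    (by
      rintro x (((h | h) | h) | h)
      exacts [hn x (e1 x h), hn x (e2 x h.1), hn x (e3 x h.1), hn x (e4 x h.1)])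
    with ⟨hd', h⟩ | ⟨hd', h⟩
  · have hzv : z ≠ v := by
      rintro rfl
      exact disjoint_left.1 hd' (.inl (.inl (.inl hr))) hr'
    exact h u z huo huw huv hzo hzw hzv n1 n2 (h5 hzv hzw)
  · have huv' : u ≠ v' := by
      rintro rfl
      exact disjoint_left.1 hd' (.inl (.inl (.inl (left_mem huy)))) (right_mem huo.symm)
    exact h u z huo huw huv' hzo hzw hzv' n1 n2 (h6 hzw huv')

end Drawing

/-- The standard identification of the plane with the complex numbers. -/
noncomputable def toComplex : ℝ × ℝ ≃ₜ ℂ := Complex.equivRealProdCLM.symm.toHomeomorph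

theorem same_image_iff {K : Set (ℝ × ℝ)} {p q : ℝ × ℝ} :
    Same (toComplex '' K) (toComplex p) (toComplex q) ↔ q ∈ connectedComponentIn Kᶜ p := by
  by_cases hp : p ∈ Kᶜ
  · rw [Same, ← image_compl_eq toComplex.bijective, ← toComplex.image_connectedComponentIn hp,
      toComplex.injective.mem_set_image]
  · refine ⟨fun h => absurd ?_ h.left, fun h => ?_⟩
    · exact mem_image_of_mem _ (not_not.1 hp)
    · rw [connectedComponentIn_eq_empty hp] at h
      exact h.elim

end PlanarArc

namespace SimpleDrawing

open PlanarArc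

variable {n : ℕ} (D : SimpleDrawing n)

/-- The drawing in the complex plane given by a drawing in the real plane. -/
noncomputable def toDrawing : Drawing (Fin n) where
  vert i := toComplex (D.vert i)
  vert_inj := toComplex.injective.comp D.vert_inj
  arc i j := toComplex '' D.arc i j
  arc_symm i j := by rw [D.arc_symm]
  isArc {i j} h := by
    obtain ⟨f, h1, h2, h3, h4, h5⟩ := D.arc_simple i j h
    exact ⟨toComplex ∘ f, toComplex.continuous.comp_continuousOn h1,
      toComplex.injective.comp_injOn h2, by rw [image_comp, h3], by simp [h4], by simp [h5]⟩
  eq_of_mem {i j k} h hk :=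
    D.no_through_vertex i j k h ((toComplex.injective.mem_set_image).1 hk)
  inter {i j k l} h h' hne := by
    rw [← image_inter toComplex.injective]
    exact (D.inter_subsingleton i j k l h h' hne).image _

theorem tri_toDrawing (a b c : Fin n) :
    D.toDrawing.tri a b c = toComplex '' D.triangle a b c := by
  simp only [Drawing.tri, triangle, image_union]; rfl

theorem convex_toDrawing (hD : D.Convex) : D.toDrawing.Convex := by
  intro a b c hab hbc hac
  obtain ⟨S, ⟨p, hp, hS⟩, h⟩ := hD a b c hab hbc hac
  have hp' : toComplex p ∉ D.toDrawing.tri a b c := by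
    rwa [tri_toDrawing, toComplex.injective.mem_set_image]
  have key : ∀ x, x ∈ S ↔ toComplex x ∈
      closure {q | Same (D.toDrawing.tri a b c) (toComplex p) q} := by
    intro x
    have : {q | Same (D.toDrawing.tri a b c) (toComplex p) q} =
        toComplex '' connectedComponentIn (D.triangle a b c)ᶜ p := by
      ext q
      obtain ⟨q, rfl⟩ := toComplex.surjective q
      rw [toComplex.injective.mem_set_image, ← same_image_iff, tri_toDrawing]; rfl
    rw [this, ← toComplex.image_closure, toComplex.injective.mem_set_image, hS]
  have key' : ∀ x, (toComplex x ∈ D.toDrawing.tri a b c ∨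
      Same (D.toDrawing.tri a b c) (toComplex p) (toComplex x)) → x ∈ S := fun x hx =>
    (key x).2 (hx.elim (Drawing.mem_closure_tri hab hac hbc hp') fun h => subset_closure h)
  refine ⟨toComplex p, hp', fun i j hij hi hj x hx => ?_⟩
  obtain ⟨x, hx, rfl⟩ := hx
  by_cases hxT : toComplex x ∈ D.toDrawing.tri a b c
  · exact .inl hxT
  · exact .inr (Drawing.same_of_mem_closure hab hac hbc
      ((key x).1 (h i j hij (key' _ hi) (key' _ hj) hx)) hxT)

theorem SeparatesAt.sep {D : SimpleDrawing n} {o a b c d : Fin n} {U : Set ℂ} {g : Fin n → ℂ}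
    (hG : D.toDrawing.Germ o U g) (hao : a ≠ o) (hbo : b ≠ o) (hco : c ≠ o) (hdo : d ≠ o)
    (hac : a ≠ c) (hba : b ≠ a) (hbc : b ≠ c) (hda : d ≠ a) (hdc : d ≠ c)
    (h : D.SeparatesAt o a c b d) : D.toDrawing.Sep o g a c b d := by
  obtain ⟨p, q, hp, hq, hpq, hb, hd⟩ := h
  have key : ∀ (x : Fin n) (r : ℝ × ℝ), x ≠ o → x ≠ a → x ≠ c →
      D.EmanatesInto o x (connectedComponentIn (D.triangle o a c)ᶜ r) →
      Same (D.toDrawing.tri o a c) (toComplex r) (g x) := by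
    rintro x r hxo hxa hxc ⟨W, hW, h⟩
    have hW' : toComplex '' W ∈ nhds (D.toDrawing.vert o) := toComplex.isOpenMap.image_mem_nhds hW
    obtain ⟨t, ⟨htW, htU⟩, ht, hto⟩ := mem_closure_iff_nhds.1
      ((D.toDrawing.isArc hxo.symm).subset_closure_diff_pair (Drawing.left_mem hxo.symm))
      (toComplex '' W ∩ U) (Filter.inter_mem hW' (hG.isOpen.mem_nhds hG.mem))
    have hto' : t ≠ D.toDrawing.vert o := fun h => hto (.inl h)
    have h2 := hG.same hao hco hxo hac hxa hxc ht htU hto'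
    obtain ⟨s, hs, rfl⟩ := htW
    have hs' : s ∈ D.arc o x := toComplex.injective.mem_set_image.1 ht
    have h3 := h ⟨⟨hs', hs⟩, fun h => hto' (congrArg toComplex h)⟩
    rw [← same_image_iff, ← tri_toDrawing] at h3
    exact h3.trans h2
  intro hs
  have h1 := ((key b p hbo hba hbc hb).trans hs).trans (key d q hdo hda hdc hd).symm
  rw [tri_toDrawing, same_image_iff] at h1
  exact hpq (connectedComponentIn_eq h1)

variable {D}

theorem Crosses.inter_nonempty {a b c o : Fin n} (h : D.Crosses s(a, b) s(c, o)) :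
    (D.toDrawing.arc a b ∩ D.toDrawing.arc o c).Nonempty := by
  obtain ⟨-, p, ⟨h1, h2⟩, -⟩ := h
  rw [D.toDrawing.arc_symm o c]
  exact ⟨toComplex p, mem_image_of_mem _ h1, mem_image_of_mem _ h2⟩

theorem disjoint_of_not_crosses {a b c o : Fin n} (hca : c ≠ a) (hcb : c ≠ b) (hoa : a ≠ o)
    (hob : b ≠ o) (h : ¬ D.Crosses s(a, b) s(c, o)) :
    Disjoint (D.toDrawing.arc a b) (D.toDrawing.arc o c) := by
  rw [D.toDrawing.arc_symm o c]
  refine disjoint_left.2 ?_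
  rintro _ ⟨p, hp, rfl⟩ hp'
  refine h ⟨fun he => ?_, p, ⟨hp, toComplex.injective.mem_set_image.1 hp'⟩, ?_⟩
  · simp only [Sym2.eq_iff] at he
    tauto
  · rintro ⟨e, h1, h2, -⟩
    simp only [Sym2.mem_iff] at h1 h2
    rcases h1 with rfl | rfl <;> rcases h2 with rfl | rfl <;> contradiction

theorem Crosses.ne_of_endpoint {a b c o : Fin n} (hab : a ≠ b) (hao : a ≠ o) (hbo : b ≠ o)
    (hco : c ≠ o) (h : D.Crosses s(a, b) s(c, o)) : c ≠ a ∧ c ≠ b := by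
  obtain ⟨-, p, ⟨h1, h2⟩, hn⟩ := h
  have key : ∀ d e : Fin n, c = d → d ≠ e → e ≠ o → p ∈ D.arc d e → p = D.vert d := by
    rintro d e rfl hde heo hp
    refine D.inter_subsingleton c e c o hde hco ?_ ⟨hp, h2⟩ ⟨?_, ?_⟩
    · simp only [ne_eq, Sym2.eq_iff]; tauto
    · obtain ⟨f, -, -, hf, h0, -⟩ := D.arc_simple c e hde
      exact hf ▸ ⟨0, by simp, h0⟩
    · obtain ⟨f, -, -, hf, h0, -⟩ := D.arc_simple c o hco
      exact hf ▸ ⟨0, by simp, h0⟩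
  refine ⟨fun hc => hn ⟨a, by simp, by simp [hc], key a b hc hab hbo h1⟩, fun hc =>
    hn ⟨b, by simp, by simp [hc], key b a hc hab.symm hao ?_⟩⟩
  rw [D.arc_symm]
  exact h1

end SimpleDrawing

/-- Exactly one of `b` and `d` lies strictly between `a` and `c`. -/
def Interlaced (a c b d : ℕ) : Prop :=
  (a < b ∧ b < c ∨ c < b ∧ b < a) ↔ ¬ (a < d ∧ d < c ∨ c < d ∧ d < a)

namespace SimpleDrawing

open PlanarArc

variable {n : ℕ} {D : SimpleDrawing n} {vs : Fin n} {lab : Fin (n - 1) → Fin n}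

namespace IsRotationLabeling

theorem ne_star (h : D.IsRotationLabeling vs lab) (i : Fin (n - 1)) : lab i ≠ vs := by
  have : lab i ∈ {x | x ≠ vs} := h.2.1 ▸ mem_range_self i
  exact this

theorem exists_eq (h : D.IsRotationLabeling vs lab) {x : Fin n} (hx : x ≠ vs) :
    ∃ i, lab i = x := by
  have : x ∈ range lab := h.2.1 ▸ hx
  exact this

theorem sep_iff (h : D.IsRotationLabeling vs lab) {U : Set ℂ} {g : Fin n → ℂ}
    (hG : D.toDrawing.Germ vs U g) {a b c d : Fin (n - 1)} (hac : a ≠ c) (hab : a ≠ b)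
    (had : a ≠ d) (hcb : c ≠ b) (hcd : c ≠ d) (hbd : b ≠ d) :
    D.toDrawing.Sep vs g (lab a) (lab c) (lab b) (lab d) ↔ Interlaced a c b d := by
  have ne : ∀ {i j}, i ≠ j → lab i ≠ lab j := fun h' => h.1.ne h'
  have st := h.ne_star
  have n1 : ∀ i j k l, i ≠ j → i ≠ k → i ≠ l → j ≠ k → j ≠ l → k ≠ l →
      D.toDrawing.Sep vs g (lab i) (lab k) (lab j) (lab l) →
      ¬ D.toDrawing.Sep vs g (lab i) (lab j) (lab k) (lab l) := fun i j k l h1 h2 h3 h4 h5 h6 =>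
    hG.not_sep (st i) (st j) (st k) (st l) (ne h1) (ne h2) (ne h3) (ne h4) (ne h5) (ne h6)
  have base : ∀ i j k l, i < j → j < k → k < l →
      D.toDrawing.Sep vs g (lab i) (lab k) (lab j) (lab l) ∧
      D.toDrawing.Sep vs g (lab j) (lab l) (lab i) (lab k) ∧
      ¬ D.toDrawing.Sep vs g (lab i) (lab j) (lab k) (lab l) ∧
      ¬ D.toDrawing.Sep vs g (lab i) (lab l) (lab j) (lab k) ∧
      ¬ D.toDrawing.Sep vs g (lab j) (lab k) (lab i) (lab l) ∧
      ¬ D.toDrawing.Sep vs g (lab k) (lab l) (lab i) (lab j) := by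
    intro i j k l hij hjk hkl
    have h1 := hij.ne
    have h2 := (hij.trans hjk).ne
    have h3 := (hij.trans (hjk.trans hkl)).ne
    have h4 := hjk.ne
    have h5 := (hjk.trans hkl).ne
    have h6 := hkl.ne
    have s := (h.2.2 i j k l hij hjk hkl).sep hG (st i) (st j) (st k) (st l) (ne h2) (ne h1.symm)
      (ne h4) (ne h3.symm) (ne h6.symm)
    have a1 := n1 i j k l h1 h2 h3 h4 h5 h6 s
    have a2 := fun hs => n1 i l k j h3 h2 h1 h6.symm h5.symm h4.symm s.swap' (Drawing.Sep.swap' hs)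
    have s' := hG.sep (st i) (st j) (st k) (st l) (ne h1) (ne h2) (ne h3) (ne h4) (ne h5) (ne h6)
      a1 a2
    refine ⟨s, s', a1, a2, fun hs => ?_, fun hs => ?_⟩
    · exact n1 k j i l h4.symm h2.symm h6 h1.symm h5 h3 s.swap hs.swap
    · exact n1 k l i j h6 h2.symm h4.symm h3.symm h5.symm h1 s.swap.swap' hs
  have key : ∀ a b c d, a ≠ b → a ≠ d → c ≠ b → c ≠ d → a < c → b < d →
      (D.toDrawing.Sep vs g (lab a) (lab c) (lab b) (lab d) ↔ Interlaced a c b d) := by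
    intro a b c d hab had hcb hcd hac hbd
    rcases lt_or_gt_of_ne hab with h1 | h1
    · rcases lt_or_gt_of_ne hcb with h2 | h2
      · exact iff_of_false (base a c b d hac h2 hbd).2.2.1 (by unfold Interlaced; omega)
      · rcases lt_or_gt_of_ne hcd with h3 | h3
        · exact iff_of_true (base a b c d h1 h2 h3).1 (by unfold Interlaced; omega)
        · exact iff_of_false (base a b d c h1 hbd h3).2.2.2.1 (by unfold Interlaced; omega)
    · rcases lt_or_gt_of_ne had with h2 | h2
      · rcases lt_or_gt_of_ne hcd with h3 | h3
        · exact iff_of_false (base b a c d h1 hac h3).2.2.2.2.1 (by unfold Interlaced; omega)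
        · exact iff_of_true (base b a d c h1 h2 h3).2.1 (by unfold Interlaced; omega)
      · exact iff_of_false (base b d a c hbd h2 hac).2.2.2.2.2 (by unfold Interlaced; omega)
  have swap : ∀ a b c d, D.toDrawing.Sep vs g a b c d ↔ D.toDrawing.Sep vs g b a c d :=
    fun _ _ _ _ => ⟨Drawing.Sep.swap, Drawing.Sep.swap⟩
  have swap' : ∀ a b c d, D.toDrawing.Sep vs g a b c d ↔ D.toDrawing.Sep vs g a b d c :=
    fun _ _ _ _ => ⟨Drawing.Sep.swap', Drawing.Sep.swap'⟩
  rcases lt_or_gt_of_ne hac with h1 | h1 <;> rcases lt_or_gt_of_ne hbd with h2 | h2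
  · exact key a b c d hab had hcb hcd h1 h2
  · rw [swap', key a d c b had hab hcd hcb h1 h2]
    unfold Interlaced; omega
  · rw [swap, key c b a d hcb hcd hab had h1 h2]
    unfold Interlaced; omega
  · rw [swap, swap', key c d a b hcd hcb had hab h1 h2]
    unfold Interlaced; omega

theorem not_crosses (h : D.IsRotationLabeling vs lab) (hD : D.Convex)
    {v v' w x₁ x₂ u y z : Fin (n - 1)} (hvv : v ≠ v') (hwv : w ≠ v) (hwv' : w ≠ v')
    (hc : D.Crosses s(lab v, lab v') s(lab w, vs))
    (hx : ∀ x, x = x₁ ∨ x = x₂ → x ≠ w ∧ ∀ c, c ≠ w → c ≠ x →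
      ¬ D.Crosses s(lab x, lab w) s(lab c, vs)) (hx₁₂ : x₁ ≠ x₂)
    (huy : u ≠ y) (huv : u ≠ v) (huw : u ≠ w) (hyv : y ≠ v) (hyw : y ≠ w) (hzu : z ≠ u)
    (hzv' : z ≠ v') (ht : ∀ t, t = u ∨ t = y → ¬ D.Crosses s(lab v, lab v') s(lab t, vs))
    (h1 : ∀ t, t = x₁ ∨ t = x₂ ∨ t = u ∨ t = y ∨ t = z → t ≠ v → t ≠ v' → t ≠ w →
      ¬ Interlaced v v' w t)
    (h2 : ∀ t, t = v ∨ t = v' ∨ t = u ∨ t = y → t ≠ x₁ → t ≠ x₂ → Interlaced w t x₁ x₂)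
    (h3 : ∀ x, x = x₁ ∨ x = x₂ → x ≠ u → x ≠ y → ¬ Interlaced u y w x)
    (h4 : ¬ Interlaced u y w v) (h5 : z ≠ v → z ≠ w → Interlaced w v u z)
    (h6 : z ≠ w → u ≠ v' → Interlaced w v' u z) :
    ¬ D.Crosses s(lab u, lab y) s(lab z, vs) := by
  obtain ⟨U, g, hG⟩ := Drawing.exists_germ D.toDrawing vs
  have ne : ∀ {i j}, i ≠ j → lab i ≠ lab j := fun h' => h.1.ne h'
  have st := h.ne_star
  have ex : ∀ {P : Fin n → Prop} (a b : Fin (n - 1)), (∀ x, x = a ∨ x = b → P (lab x)) →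
      ∀ x, x = lab a ∨ x = lab b → P x := by
    rintro P a b hP x (rfl | rfl)
    exacts [hP a (.inl rfl), hP b (.inr rfl)]
  intro hcr
  have hx1 := (hx x₁ (.inl rfl)).1
  have hx2 := (hx x₂ (.inr rfl)).1
  refine not_nonempty_iff_eq_empty.2 (disjoint_iff_inter_eq_empty.1 (hG.not_crosses
    (convex_toDrawing D hD) (x₁ := lab x₁) (x₂ := lab x₂) (st v) (st v') (st w) (ne hvv) (ne hwv)
    (ne hwv') hc.inter_nonempty
    (ex _ _ fun x hxx => ⟨st x, ne (hx x hxx).1, fun c hco hcw hcx => ?_⟩) (st u) (st y) (ne huy)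
    (ne huv) (ne huw) (ne hyv) (ne hyw)
    (ex _ _ fun t htt htv => disjoint_of_not_crosses ?_ htv (st v) (st v') (ht t htt)) (st z)
    (ne hzv') ?_ ?_ (ex _ _ fun x hxx hxu hxy => ?_) ?_ ?_ ?_)) hcr.inter_nonempty
  · obtain ⟨c, rfl⟩ := h.exists_eq hco
    exact disjoint_of_not_crosses hcx hcw (st x) (st w)
      ((hx x hxx).2 c (ne_of_apply_ne lab hcw) (ne_of_apply_ne lab hcx))
  · rcases htt with rfl | rfl
    exacts [ne huv, ne hyv]
  · intro t htt htv htv' htw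
    obtain ⟨t, ht', rfl⟩ : ∃ t', (t' = x₁ ∨ t' = x₂ ∨ t' = u ∨ t' = y ∨ t' = z) ∧ lab t' = t := by
      rcases htt with h | h | h | h | h <;> exact ⟨_, by tauto, h.symm⟩
    replace htv := ne_of_apply_ne lab htv
    replace htv' := ne_of_apply_ne lab htv'
    replace htw := ne_of_apply_ne lab htw
    rw [h.sep_iff hG hvv hwv.symm htv.symm hwv'.symm htv'.symm htw.symm]
    exact h1 t ht' htv htv' htw
  · intro t htt htx htx'
    obtain ⟨t, ht', rfl⟩ : ∃ t', (t' = v ∨ t' = v' ∨ t' = u ∨ t' = y) ∧ lab t' = t := by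
      rcases htt with h | h | h | h <;> exact ⟨_, by tauto, h.symm⟩
    replace htx := ne_of_apply_ne lab htx
    replace htx' := ne_of_apply_ne lab htx'
    have htw : w ≠ t := by
      rcases ht' with rfl | rfl | rfl | rfl
      exacts [hwv, hwv', huw.symm, hyw.symm]
    rw [h.sep_iff hG htw hx1.symm hx2.symm htx htx' hx₁₂]
    exact h2 t ht' htx htx'
  · replace hxu := ne_of_apply_ne lab hxu
    replace hxy := ne_of_apply_ne lab hxy
    rw [h.sep_iff hG huy huw hxu.symm hyw hxy.symm (hx x hxx).1.symm]
    exact h3 x hxx hxu hxy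
  · rwa [h.sep_iff hG huy huw huv hyw hyv hwv]
  · intro hzv hzw
    replace hzv := ne_of_apply_ne lab hzv
    replace hzw := ne_of_apply_ne lab hzw
    rw [h.sep_iff hG hwv huw.symm hzw.symm huv.symm hzv.symm hzu.symm]
    exact h5 hzv hzw
  · intro hzw huv'
    replace hzw := ne_of_apply_ne lab hzw
    replace huv' := ne_of_apply_ne lab huv'
    rw [h.sep_iff hG hwv' huw.symm hzw.symm huv'.symm hzv'.symm hzu.symm]
    exact h6 hzw huv'

end IsRotationLabeling

end SimpleDrawing

theorem finCycSucc_val_cases {m : ℕ} (i : Fin m) :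
    (i + 1 < m ∧ (finCycSucc i : ℕ) = i + 1) ∨ ((i : ℕ) + 1 = m ∧ (finCycSucc i : ℕ) = 0) := by
  rcases lt_or_eq_of_le (Nat.succ_le_of_lt i.isLt) with h | h
  · exact .inl ⟨h, Nat.mod_eq_of_lt h⟩
  · exact .inr ⟨h, (congrArg (· % m) h).trans (Nat.mod_self m)⟩

theorem exists_finCycSucc_eq {m : ℕ} (i : Fin m) : ∃ j, finCycSucc j = i := by
  have hi := i.isLt
  by_cases h : (i : ℕ) = 0
  · refine ⟨⟨m - 1, by omega⟩, Fin.ext ?_⟩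
    have := finCycSucc_val_cases (⟨m - 1, by omega⟩ : Fin m)
    simp only at this
    omega
  · refine ⟨⟨i - 1, by omega⟩, Fin.ext ?_⟩
    have := finCycSucc_val_cases (⟨i - 1, by omega⟩ : Fin m)
    simp only at this
    omega

namespace SimpleDrawing

variable {n : ℕ} {D : SimpleDrawing n} {vs : Fin n} {lab : Fin (n - 1) → Fin n}

namespace IsRotationLabeling

theorem ne_of_badWitness (hlab : D.IsRotationLabeling vs lab) {x c : Fin (n - 1)}
    (hx : x ≠ finCycSucc x) (h : D.BadWitness vs lab x c) : c ≠ x ∧ c ≠ finCycSucc x := by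
  obtain ⟨h1, h2⟩ := h.ne_of_endpoint (hlab.1.ne hx) (hlab.ne_star _) (hlab.ne_star _)
    (hlab.ne_star _)
  exact ⟨ne_of_apply_ne lab h1, ne_of_apply_ne lab h2⟩

theorem forall_not_crosses {w x₁ : Fin (n - 1)} (hw : finCycSucc x₁ = w)
    (h₁ : ∀ c, ¬ D.BadWitness vs lab x₁ c) (h₂ : ∀ c, ¬ D.BadWitness vs lab w c) (h₃ : x₁ ≠ w)
    (h₄ : finCycSucc w ≠ w) : ∀ x, x = x₁ ∨ x = finCycSucc w → x ≠ w ∧ ∀ c, c ≠ w → c ≠ x →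
      ¬ D.Crosses s(lab x, lab w) s(lab c, vs) := by
  rintro x (rfl | rfl)
  · exact ⟨h₃, fun c _ _ h => h₁ c (by rwa [BadWitness, hw])⟩
  · exact ⟨h₄, fun c _ _ h => h₂ c (by rwa [BadWitness, Sym2.eq_swap])⟩

theorem not_badWitness (hside : ∀ x w, D.BadWitness vs lab x w → w < x)
    (hnest : ∀ x x' w w', D.BadWitness vs lab x w → D.BadWitness vs lab x' w' → x < x' → w' < w)
    {x x' w : Fin (n - 1)} (h : D.BadWitness vs lab x' w) (hx : x < x') (hxw : x ≤ w)
    (c : Fin (n - 1)) : ¬ D.BadWitness vs lab x c := fun hc =>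
  absurd ((hnest _ _ _ _ hc h hx).trans (hside _ _ hc)) hxw.not_gt

/-- If `w` is the smallest witness of the bad edge at `v`, then an edge avoiding the labels from `w`
to `v` crosses no star edge with label from `w` to `v`. -/
theorem not_crosses_of_mem (hlab : D.IsRotationLabeling vs lab) (hD : D.Convex)
    (hside : ∀ x w, D.BadWitness vs lab x w → w < x)
    (hnest : ∀ x x' w w', D.BadWitness vs lab x w → D.BadWitness vs lab x' w' → x < x' → w' < w)
    {v w u y z : Fin (n - 1)} (hw : D.BadWitness vs lab v w)
    (hmin : ∀ c, D.BadWitness vs lab v c → w ≤ c) (hw0 : 0 < (w : ℕ)) (hv : (v : ℕ) + 1 < n - 1)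
    (huy : u ≠ y) (hu : u < w ∨ v < u) (hy : y < w ∨ v < y) (hz : w ≤ z) (hz' : z ≤ v) :
    ¬ D.Crosses s(lab u, lab y) s(lab z, vs) := by
  have hwv := hside _ _ hw
  have hsv := finCycSucc_val_cases v
  obtain ⟨x, hx⟩ := exists_finCycSucc_eq w
  have hsx := finCycSucc_val_cases x
  have hsw := finCycSucc_val_cases w
  have hub : (u : ℕ) ≠ y := Fin.val_ne_of_ne huy
  rw [hx] at hsx
  replace hsv : (finCycSucc v : ℕ) = v + 1 := by omega
  replace hsx : (w : ℕ) = x + 1 := by omega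
  replace hsw : (finCycSucc w : ℕ) = w + 1 := by omega
  refine hlab.not_crosses hD (v := v) (v' := finCycSucc v) (w := w) (x₁ := x)
    (x₂ := finCycSucc w) ?_ ?_ ?_ hw (forall_not_crosses hx ?_ ?_ ?_ ?_)
    ?_ huy ?_ ?_ ?_ ?_ ?_ ?_ ?_ ?_ ?_ ?_ ?_ ?_ ?_
  · exact fun h => by rw [Fin.ext_iff] at h; omega
  · exact fun h => by rw [Fin.ext_iff] at h; omega
  · exact fun h => by rw [Fin.ext_iff] at h; omega
  · exact not_badWitness hside hnest hw (by omega) (by omega)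
  · exact not_badWitness hside hnest hw hwv le_rfl
  · exact fun h => by rw [Fin.ext_iff] at h; omega
  · exact fun h => by rw [Fin.ext_iff] at h; omega
  · exact fun h => by rw [Fin.ext_iff] at h; omega
  · exact fun h => by rw [Fin.ext_iff] at h; omega
  · exact fun h => by rw [Fin.ext_iff] at h; omega
  · exact fun h => by rw [Fin.ext_iff] at h; omega
  · exact fun h => by rw [Fin.ext_iff] at h; omega
  · exact fun h => by rw [Fin.ext_iff] at h; omega
  · exact fun h => by rw [Fin.ext_iff] at h; omega
  · intro t ht h
    have h1 := hside _ _ h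
    have h2 := hmin t h
    rcases ht with rfl | rfl <;> omega
  · intro t _ h1 h2 h3
    rw [Ne, Fin.ext_iff] at h1 h2 h3
    unfold Interlaced
    clear hu hy
    omega
  · intro t ht h1 h2
    rw [Ne, Fin.ext_iff] at h1 h2
    unfold Interlaced
    rcases ht with rfl | rfl | rfl | rfl <;> omega
  · intro t ht h1 h2
    rw [Ne, Fin.ext_iff] at h1 h2
    unfold Interlaced
    rcases ht with rfl | rfl <;> omega
  · unfold Interlaced
    omega
  · intro h1 h2
    rw [Ne, Fin.ext_iff] at h1 h2
    unfold Interlaced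
    omega
  · intro h1 h2
    rw [Ne, Fin.ext_iff] at h1 h2
    unfold Interlaced
    omega

/-- If `w` is the largest witness of the bad edge at `v`, then an edge with labels after `w` and up
to `v` crosses only star edges with such labels. -/
theorem not_crosses_of_notMem (hlab : D.IsRotationLabeling vs lab) (hD : D.Convex)
    (hside : ∀ x w, D.BadWitness vs lab x w → w < x)
    (hnest : ∀ x x' w w', D.BadWitness vs lab x w → D.BadWitness vs lab x' w' → x < x' → w' < w)
    {v w u y z : Fin (n - 1)} (hw : D.BadWitness vs lab v w)
    (hmax : ∀ c, D.BadWitness vs lab v c → c ≤ w) (huy : u ≠ y) (hu : w < u) (hu' : u ≤ v)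
    (hy : w < y) (hy' : y ≤ v) (hz : z ≤ w ∨ v < z) :
    ¬ D.Crosses s(lab u, lab y) s(lab z, vs) := by
  have hwv := hside _ _ hw
  have hsv := finCycSucc_val_cases v
  obtain ⟨x, hx⟩ := exists_finCycSucc_eq w
  have hsx := finCycSucc_val_cases x
  have hsw := finCycSucc_val_cases w
  have hub : (u : ℕ) ≠ y := Fin.val_ne_of_ne huy
  have hvl := v.isLt
  have hzl := z.isLt
  have hxl := x.isLt
  rw [hx] at hsx
  replace hsw : (finCycSucc w : ℕ) = w + 1 := by omega
  have hne := Fin.val_ne_of_ne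
    (hlab.ne_of_badWitness (fun h => by rw [Fin.ext_iff] at h; omega) hw).2
  refine hlab.not_crosses hD (v := finCycSucc v) (v' := v) (w := w) (x₁ := x)
    (x₂ := finCycSucc w) ?_ ?_ ?_ ?_ (forall_not_crosses hx ?_ ?_ ?_ ?_)
    ?_ huy ?_ ?_ ?_ ?_ ?_ ?_ ?_ ?_ ?_ ?_ ?_ ?_ ?_
  · exact fun h => by rw [Fin.ext_iff] at h; omega
  · exact fun h => hne (congrArg _ h)
  · exact hwv.ne
  · rwa [Sym2.eq_swap]
  · by_cases hxv : x < v
    · exact not_badWitness hside hnest hw hxv (by omega)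
    · intro c h
      have := hnest _ _ _ _ hw h (by omega)
      omega
  · exact not_badWitness hside hnest hw hwv le_rfl
  · exact fun h => by rw [Fin.ext_iff] at h; omega
  · exact fun h => by rw [Fin.ext_iff] at h; omega
  · exact fun h => by rw [Fin.ext_iff] at h; omega
  · exact fun h => by rw [Fin.ext_iff] at h; omega
  · exact hu.ne'
  · exact fun h => by rw [Fin.ext_iff] at h; omega
  · exact hy.ne'
  · exact fun h => by rw [Fin.ext_iff] at h; omega
  · exact fun h => by rw [Fin.ext_iff] at h; omega
  · intro t ht h
    rw [Sym2.eq_swap] at h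
    have h2 := hmax t h
    rcases ht with rfl | rfl <;> omega
  · intro t ht h1 h2 h3
    have htl := t.isLt
    rw [Ne, Fin.ext_iff] at h1 h2 h3
    unfold Interlaced
    clear ht hu hu' hy hy' hz hsx hub
    omega
  · intro t ht h1 h2
    rw [Ne, Fin.ext_iff] at h1 h2
    unfold Interlaced
    clear hz
    rcases hsx with hsx | hsx <;> rcases ht with rfl | rfl | rfl | rfl <;> omega
  · intro t ht h1 h2
    rw [Ne, Fin.ext_iff] at h1 h2
    unfold Interlaced
    clear hz hsv
    rcases hsx with hsx | hsx <;> rcases ht with rfl | rfl <;> omega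
  · unfold Interlaced
    clear hz hsx
    omega
  · intro h1 h2
    rw [Ne, Fin.ext_iff] at h1 h2
    unfold Interlaced
    clear hsx
    omega
  · intro h1 h2
    rw [Ne, Fin.ext_iff] at h1 h2
    unfold Interlaced
    clear hsx hsv
    omega

end IsRotationLabeling

end SimpleDrawing

/-- With `m ≥ 2` bad edges as in the standard labeling (sidedness and nestedness), and the
blocks `L i = {x | wR (i+1) < x < wL i}` and `R i = {x | v i + 1 ≤ x ≤ v (i+1)}`: no edge
with both endpoints in `L i ∪ R i` crosses a star edge `{lab z, vs}` with `z ∉ L i ∪ R i`. -/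
theorem no_crossing_outside_blocks (n : ℕ) (D : SimpleDrawing n) (hD : D.Convex)
    (vs : Fin n) (lab : Fin (n - 1) → Fin n) (hlab : D.IsRotationLabeling vs lab)
    (m : ℕ) (hm : 2 ≤ m) (v wL wR : ℕ → Fin (n - 1))
    (hmono : ∀ i j, i < j → j < m → v i < v j)
    (hbadall : ∀ x w, D.BadWitness vs lab x w → ∃ i, i < m ∧ x = v i)
    (hwitL : ∀ i, i < m → D.BadWitness vs lab (v i) (wL i))
    (hwitR : ∀ i, i < m → D.BadWitness vs lab (v i) (wR i))
    (hwitLR : ∀ i, i < m → ∀ w, D.BadWitness vs lab (v i) w → wL i ≤ w ∧ w ≤ wR i)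
    (hside : ∀ x w, D.BadWitness vs lab x w → w < x)
    (hnest : ∀ x x' w w', D.BadWitness vs lab x w → D.BadWitness vs lab x' w' → x < x' → w' < w)
    :
    ∀ i, i + 1 < m → ∀ u y z : Fin (n - 1), u ≠ y →
      ((wR (i+1) < u ∧ u < wL i) ∨ (finCycSucc (v i) ≤ u ∧ u ≤ v (i+1))) →
      ((wR (i+1) < y ∧ y < wL i) ∨ (finCycSucc (v i) ≤ y ∧ y ≤ v (i+1))) →
      ¬((wR (i+1) < z ∧ z < wL i) ∨ (finCycSucc (v i) ≤ z ∧ z ≤ v (i+1))) →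
      ¬D.Crosses s(lab u, lab y) s(lab z, vs) := by
  intro i hi u y z huy hu hy hz
  have hv := hmono i (i + 1) (Nat.lt_succ_self i) hi
  have hi' : i < m := Nat.lt_of_succ_lt hi
  have hw := hnest _ _ _ _ (hwitL i hi') (hwitR (i + 1) hi) hv
  have hwv := hside _ _ (hwitL i hi')
  have hsv := finCycSucc_val_cases (v i)
  by_cases hcase : wL i ≤ z ∧ z ≤ v i
  · exact hlab.not_crosses_of_mem hD hside hnest (hwitL i hi')
      (fun c hc => (hwitLR i hi' c hc).1) (by omega) (by omega) huy (by omega) (by omega)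
      hcase.1 hcase.2
  · exact hlab.not_crosses_of_notMem hD hside hnest (hwitR (i + 1) hi)
      (fun c hc => (hwitLR (i + 1) hi c hc).2) huy (by omega) (by omega) (by omega) (by omega)
      (by omega)
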